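/- Let Ω ⊂ ℝ be an open bounded interval, let f satisfy hypothesis (F), and let the data satisfy the smooth-data hypothesis (I∞), with u_{0t} := v₀. Then the problem (P) admits at least one global weak solution (u,Θ) which additionally satisfies u ∈ C⁰([0,∞);W₀^{1,2}(Ω)), u_t ∈ C⁰([0,∞);L²(Ω)), and Θ ∈ C⁰([0,∞);L²(Ω)) ∩ L²_loc([0,∞);W^{1,2}(Ω)). -/

import Mathlib

open MeasureTheory Filter Set Function

noncomputable section

/-- Integral over `Ω = (a,b)`. -/
def intOm (a b : ℝ) (g : ℝ → ℝ) : ℝ := ∫ x in Ioo a b, g x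

/-- Double integral over `Ω × (0,T)`. -/
def intOmT (a b T : ℝ) (F : ℝ → ℝ → ℝ) : ℝ :=
  ∫ p in (Ioo a b) ×ˢ (Ioo 0 T), F p.1 p.2

/-- Squared `L²(Ω)` integral of `g`. -/
def sqOm (a b : ℝ) (g : ℝ → ℝ) : ℝ := ∫ x in Ioo a b, (g x) ^ 2

/-- `L²(Ω)` norm. -/
def nrmL2 (a b : ℝ) (g : ℝ → ℝ) : ℝ := (∫ x in Ioo a b, (g x) ^ 2) ^ (1 / 2 : ℝ)

/-- `L¹(Ω)` norm. -/
def nrmL1 (a b : ℝ) (g : ℝ → ℝ) : ℝ := ∫ x in Ioo a b, |g x|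

/-- Membership in `L²(Ω)`. -/
def MemL2 (a b : ℝ) (g : ℝ → ℝ) : Prop :=
  AEStronglyMeasurable g (volume.restrict (Ioo a b)) ∧
    IntegrableOn (fun x => (g x) ^ 2) (Ioo a b)

/-- Zero-trace weak derivative on `(a,b)`: `g ∈ W₀^{1,1}(a,b)` with weak derivative `g'`
(integration by parts against all smooth test functions, with no boundary terms). -/
def WeakDerivZ (a b : ℝ) (g g' : ℝ → ℝ) : Prop :=
  ∀ ψ : ℝ → ℝ, ContDiff ℝ (⊤ : ℕ∞) ψ →
    ∫ x in Ioo a b, g x * deriv ψ x = - ∫ x in Ioo a b, g' x * ψ x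

/-- Interior weak derivative on `(a,b)`: `g ∈ W^{1,1}(a,b)` with weak derivative `g'`. -/
def WeakDerivI (a b : ℝ) (g g' : ℝ → ℝ) : Prop :=
  ∀ ψ : ℝ → ℝ, ContDiff ℝ (⊤ : ℕ∞) ψ → tsupport ψ ⊆ Ioo a b →
    ∫ x in Ioo a b, g x * deriv ψ x = - ∫ x in Ioo a b, g' x * ψ x

/-- Hypothesis (F) on the nonlinearity `f`, where `f'`, `f''` denote its first and second
derivatives on `[0,∞)`: `f ∈ C²([0,∞))`, `f(0)=0`, `f' > 0` on `[0,∞)`,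
and `f' ∈ W^{1,∞}((0,∞))` (i.e. `f'` and `f''` are bounded). -/
structure HypF (f f' f'' : ℝ → ℝ) : Prop where
  hasDeriv₁ : ∀ x ∈ Ici (0 : ℝ), HasDerivWithinAt f (f' x) (Ici 0) x
  hasDeriv₂ : ∀ x ∈ Ici (0 : ℝ), HasDerivWithinAt f' (f'' x) (Ici 0) x
  cont₂ : ContinuousOn f'' (Ici 0)
  zero : f 0 = 0
  pos : ∀ x ∈ Ici (0 : ℝ), 0 < f' x
  bdd : ∃ M : ℝ, ∀ x ∈ Ici (0 : ℝ), |f' x| ≤ M ∧ |f'' x| ≤ M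

/-- Partial derivative in the first (spatial) variable. -/
def pdx (w : ℝ → ℝ → ℝ) : ℝ → ℝ → ℝ := fun x t => deriv (fun y => w y t) x

/-- Partial derivative in the second (time) variable. -/
def pdt (w : ℝ → ℝ → ℝ) : ℝ → ℝ → ℝ := fun x t => deriv (fun s => w x s) t

/-- Test functions in `C₀^∞(Ω × [0,T))`. -/
structure TestU (a b T : ℝ) (φ : ℝ → ℝ → ℝ) : Prop where
  smooth : ContDiff ℝ (⊤ : ℕ∞) (uncurry φ)
  suppx : ∃ K : Set ℝ, IsCompact K ∧ K ⊆ Ioo a b ∧ ∀ x t, x ∉ K → φ x t = 0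
  suppt : ∃ T' : ℝ, T' < T ∧ ∀ x t, T' ≤ t → φ x t = 0

/-- Test functions in `C^∞(Ω̄ × [0,T))`, compactly supported in time. -/
structure TestT (T : ℝ) (φ : ℝ → ℝ → ℝ) : Prop where
  smooth : ContDiff ℝ (⊤ : ℕ∞) (uncurry φ)
  suppt : ∃ T' : ℝ, T' < T ∧ ∀ x t, T' ≤ t → φ x t = 0

/-- Test functions in `C₀^∞(Ω × (0,T))`. -/
structure TestInt (a b T : ℝ) (φ : ℝ → ℝ → ℝ) : Prop where
  smooth : ContDiff ℝ (⊤ : ℕ∞) (uncurry φ)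
  suppx : ∃ K : Set ℝ, IsCompact K ∧ K ⊆ Ioo a b ∧ ∀ x t, x ∉ K → φ x t = 0
  supptime : ∃ K : Set ℝ, IsCompact K ∧ K ⊆ Ioo 0 T ∧ ∀ x t, t ∉ K → φ x t = 0

/-- Definition (W): weak solution of (P) on `Ω × (0,T)`.  Here `ut`, `ux`, `Θx` denote
the weak derivatives of `u` (in time and space) and of `Θ` (in space). -/
structure IsWeakSol (a b T : ℝ) (f f' : ℝ → ℝ) (u0 u0t Θ0 : ℝ → ℝ)
    (u ut ux Θ Θx : ℝ → ℝ → ℝ) : Prop where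
  u_sliceL1 : ∀ t ∈ Icc 0 T, IntegrableOn (fun x => u x t) (Ioo a b)
  u_contL1 : ∀ t₀ ∈ Icc 0 T,
    Tendsto (fun t => ∫ x in Ioo a b, |u x t - u x t₀|) (nhdsWithin t₀ (Icc 0 T)) (nhds 0)
  u_int : IntegrableOn (fun p : ℝ × ℝ => u p.1 p.2) ((Ioo a b) ×ˢ (Ioo 0 T))
  ux_int : IntegrableOn (fun p : ℝ × ℝ => ux p.1 p.2) ((Ioo a b) ×ˢ (Ioo 0 T))
  u_W0 : ∀ᵐ t ∂volume.restrict (Ioo 0 T), WeakDerivZ a b (fun x => u x t) (fun x => ux x t)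
  Θ_int : IntegrableOn (fun p : ℝ × ℝ => Θ p.1 p.2) ((Ioo a b) ×ˢ (Ioo 0 T))
  Θx_int : IntegrableOn (fun p : ℝ × ℝ => Θx p.1 p.2) ((Ioo a b) ×ˢ (Ioo 0 T))
  Θ_W : ∀ᵐ t ∂volume.restrict (Ioo 0 T), WeakDerivI a b (fun x => Θ x t) (fun x => Θx x t)
  Θ_nonneg : ∀ᵐ p ∂volume.restrict ((Ioo a b) ×ˢ (Ioo 0 T)), 0 ≤ Θ p.1 p.2
  ut_weak : ∀ φ : ℝ → ℝ → ℝ, TestInt a b T φ →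
    intOmT a b T (fun x t => u x t * pdt φ x t) = - intOmT a b T (fun x t => ut x t * φ x t)
  ut_int : IntegrableOn (fun p : ℝ × ℝ => ut p.1 p.2) ((Ioo a b) ×ˢ (Ioo 0 T))
  g1_int : IntegrableOn (fun p : ℝ × ℝ => f' (Θ p.1 p.2) * Θx p.1 p.2)
    ((Ioo a b) ×ˢ (Ioo 0 T))
  g2_int : IntegrableOn (fun p : ℝ × ℝ => f' (Θ p.1 p.2) * Θx p.1 p.2 * ut p.1 p.2)
    ((Ioo a b) ×ˢ (Ioo 0 T))
  g3_int : IntegrableOn (fun p : ℝ × ℝ => f (Θ p.1 p.2) * ut p.1 p.2)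
    ((Ioo a b) ×ˢ (Ioo 0 T))
  weak_u : ∀ φ : ℝ → ℝ → ℝ, TestU a b T φ →
    intOmT a b T (fun x t => u x t * pdt (pdt φ) x t)
        - intOm a b (fun x => u0t x * φ x 0) + intOm a b (fun x => u0 x * pdt φ x 0)
      = - intOmT a b T (fun x t => ux x t * pdx φ x t)
        - intOmT a b T (fun x t => f' (Θ x t) * Θx x t * φ x t)
  weak_Θ : ∀ φ : ℝ → ℝ → ℝ, TestT T φ →
    - intOmT a b T (fun x t => Θ x t * pdt φ x t) - intOm a b (fun x => Θ0 x * φ x 0)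
      = - intOmT a b T (fun x t => Θx x t * pdx φ x t)
        + intOmT a b T (fun x t => f' (Θ x t) * Θx x t * ut x t * φ x t)
        + intOmT a b T (fun x t => f (Θ x t) * ut x t * pdx φ x t)

/-- Continuity of `t ↦ w(·,t)` as a map `J → L²(Ω)` (with slices in `L²(Ω)`). -/
def ContL2 (a b : ℝ) (J : Set ℝ) (w : ℝ → ℝ → ℝ) : Prop :=
  (∀ t ∈ J, MemL2 a b (fun x => w x t)) ∧
    ∀ t₀ ∈ J, Tendsto (fun t => ∫ x in Ioo a b, (w x t - w x t₀) ^ 2)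
      (nhdsWithin t₀ J) (nhds 0)

/-- The regularity class (R_T):  `u ∈ C⁰([0,T];W₀^{1,2})`, `u_t ∈ C⁰([0,T];L²)`,
`Θ ∈ C⁰([0,T];L²) ∩ L²((0,T);W^{1,2})`. -/
structure RegT (a b T : ℝ) (u ut ux Θ Θx : ℝ → ℝ → ℝ) : Prop where
  u_cont : ContL2 a b (Icc 0 T) u
  ux_cont : ContL2 a b (Icc 0 T) ux
  u_W0 : ∀ t ∈ Icc (0 : ℝ) T, WeakDerivZ a b (fun x => u x t) (fun x => ux x t)
  ut_cont : ContL2 a b (Icc 0 T) ut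
  Θ_cont : ContL2 a b (Icc 0 T) Θ
  Θ_sq_int : IntegrableOn (fun p : ℝ × ℝ => (Θ p.1 p.2) ^ 2) ((Ioo a b) ×ˢ (Ioo 0 T))
  Θx_sq_int : IntegrableOn (fun p : ℝ × ℝ => (Θx p.1 p.2) ^ 2) ((Ioo a b) ×ˢ (Ioo 0 T))

/-- Data hypothesis (I), with `u0x` the weak derivative of `u0 ∈ W₀^{1,2}(Ω)`. -/
structure DataI (a b : ℝ) (u0 u0x u0t Θ0 : ℝ → ℝ) : Prop where
  u0_L2 : MemL2 a b u0
  u0x_L2 : MemL2 a b u0x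
  u0_W0 : WeakDerivZ a b u0 u0x
  u0t_L2 : MemL2 a b u0t
  Θ0_L2 : MemL2 a b Θ0
  Θ0_nonneg : ∀ᵐ x ∂volume.restrict (Ioo a b), 0 ≤ Θ0 x

/-- Smooth-data hypothesis (I∞). -/
structure SmoothData (a b : ℝ) (v0 u0 Θ0 : ℝ → ℝ) : Prop where
  v0_smooth : ContDiff ℝ (⊤ : ℕ∞) v0
  v0_supp : ∃ K : Set ℝ, IsCompact K ∧ K ⊆ Ioo a b ∧ ∀ x, x ∉ K → v0 x = 0
  u0_smooth : ContDiff ℝ (⊤ : ℕ∞) u0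
  u0_supp : ∃ K : Set ℝ, IsCompact K ∧ K ⊆ Ioo a b ∧ ∀ x, x ∉ K → u0 x = 0
  Θ0_smooth : ContDiff ℝ (⊤ : ℕ∞) Θ0
  Θ0_pos : ∀ x ∈ Icc a b, 0 < Θ0 x
  Θ0x_supp : ∃ K : Set ℝ, IsCompact K ∧ K ⊆ Ioo a b ∧ ∀ x, x ∉ K → deriv Θ0 x = 0

/-- Classical solution of the regularized problem (P_ε), of class
`C^{4,1} × C^{2,1} × C^{2,1}(Ω̄ × [0,∞))`, with positive temperature. -/
structure IsClassicalSolEps (a b : ℝ) (f : ℝ → ℝ) (ε : ℝ) (v0 u0 Θ0 : ℝ → ℝ)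
    (v u Θ : ℝ → ℝ → ℝ) : Prop where
  diffx_v : ∀ k < 4, ∀ x ∈ Icc a b, ∀ t ∈ Ici (0 : ℝ),
    DifferentiableAt ℝ (fun y => pdx^[k] v y t) x
  difft_v : ∀ x ∈ Icc a b, ∀ t ∈ Ici (0 : ℝ), DifferentiableAt ℝ (fun s => v x s) t
  cont_v : ∀ k ≤ 4, ContinuousOn (uncurry (pdx^[k] v)) ((Icc a b) ×ˢ (Ici 0))
  contt_v : ContinuousOn (uncurry (pdt v)) ((Icc a b) ×ˢ (Ici 0))
  diffx_u : ∀ k < 2, ∀ x ∈ Icc a b, ∀ t ∈ Ici (0 : ℝ),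
    DifferentiableAt ℝ (fun y => pdx^[k] u y t) x
  difft_u : ∀ x ∈ Icc a b, ∀ t ∈ Ici (0 : ℝ), DifferentiableAt ℝ (fun s => u x s) t
  cont_u : ∀ k ≤ 2, ContinuousOn (uncurry (pdx^[k] u)) ((Icc a b) ×ˢ (Ici 0))
  contt_u : ContinuousOn (uncurry (pdt u)) ((Icc a b) ×ˢ (Ici 0))
  diffx_Θ : ∀ k < 2, ∀ x ∈ Icc a b, ∀ t ∈ Ici (0 : ℝ),
    DifferentiableAt ℝ (fun y => pdx^[k] Θ y t) x
  difft_Θ : ∀ x ∈ Icc a b, ∀ t ∈ Ici (0 : ℝ), DifferentiableAt ℝ (fun s => Θ x s) t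
  cont_Θ : ∀ k ≤ 2, ContinuousOn (uncurry (pdx^[k] Θ)) ((Icc a b) ×ˢ (Ici 0))
  contt_Θ : ContinuousOn (uncurry (pdt Θ)) ((Icc a b) ×ˢ (Ici 0))
  Θ_pos : ∀ x ∈ Icc a b, ∀ t ∈ Ici (0 : ℝ), 0 < Θ x t
  eq_v : ∀ x ∈ Ioo a b, ∀ t ∈ Ioi (0 : ℝ),
    pdt v x t = -ε * pdx^[4] v x t + pdx^[2] u x t - pdx (fun y s => f (Θ y s)) x t
  eq_u : ∀ x ∈ Ioo a b, ∀ t ∈ Ioi (0 : ℝ), pdt u x t = ε * pdx^[2] u x t + v x t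
  eq_Θ : ∀ x ∈ Ioo a b, ∀ t ∈ Ioi (0 : ℝ),
    pdt Θ x t = pdx^[2] Θ x t - f (Θ x t) * pdx v x t
  bc_v : ∀ t ∈ Ioi (0 : ℝ),
    v a t = 0 ∧ v b t = 0 ∧ pdx^[2] v a t = 0 ∧ pdx^[2] v b t = 0
  bc_u : ∀ t ∈ Ioi (0 : ℝ), u a t = 0 ∧ u b t = 0
  bc_Θ : ∀ t ∈ Ioi (0 : ℝ), pdx Θ a t = 0 ∧ pdx Θ b t = 0
  init : ∀ x ∈ Icc a b, v x 0 = v0 x ∧ u x 0 = u0 x ∧ Θ x 0 = Θ0 x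

/-- Weak convergence in `L²_loc(Ω̄ × [0,∞))`. -/
def WkL2loc (a b : ℝ) (wj : ℕ → ℝ → ℝ → ℝ) (w : ℝ → ℝ → ℝ) : Prop :=
  ∀ T > (0 : ℝ), ∀ ψ : ℝ → ℝ → ℝ,
    AEStronglyMeasurable (fun p : ℝ × ℝ => ψ p.1 p.2)
      (volume.restrict ((Icc a b) ×ˢ (Icc 0 T))) →
    IntegrableOn (fun p : ℝ × ℝ => (ψ p.1 p.2) ^ 2) ((Icc a b) ×ˢ (Icc 0 T)) →
    Tendsto (fun j => ∫ p in (Icc a b) ×ˢ (Icc 0 T), wj j p.1 p.2 * ψ p.1 p.2) atTop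
      (nhds (∫ p in (Icc a b) ×ˢ (Icc 0 T), w p.1 p.2 * ψ p.1 p.2))

namespace Thermo

section

/-- Forward difference quotient, mapping node values to cell values. -/
def fwd (h : ℝ) (v : ℕ → ℝ) (j : ℕ) : ℝ := (v (j + 1) - v j) / h

/-- Backward difference quotient of the cell values `w 0, …, w n`, vanishing at the end nodes
`0` and `n + 1`. -/
def bwd (n : ℕ) (h : ℝ) (w : ℕ → ℝ) (j : ℕ) : ℝ := (w (min j n) - w (j - 1)) / h

/-- Discrete `L²` inner product over the cells `0, …, n` of length `h`. -/
def ip (n : ℕ) (h : ℝ) (p q : ℕ → ℝ) : ℝ := h * ∑ j ∈ Finset.range (n + 1), p j * q j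

variable {n : ℕ} {h : ℝ}

@[simp] lemma bwd_zero (w : ℕ → ℝ) : bwd n h w 0 = 0 := by simp [bwd]

@[simp] lemma bwd_last (w : ℕ → ℝ) : bwd n h w (n + 1) = 0 := by simp [bwd]

lemma bwd_of_le {j : ℕ} (hj : j ≤ n) (w : ℕ → ℝ) : bwd n h w j = (w j - w (j - 1)) / h := by
  simp [bwd, hj]

lemma ip_comm (p q : ℕ → ℝ) : ip n h p q = ip n h q p := by
  simp [ip, mul_comm]

lemma ip_congr {p q p' q' : ℕ → ℝ} (hp : ∀ j ≤ n, p j = p' j) (hq : ∀ j ≤ n, q j = q' j) :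
    ip n h p q = ip n h p' q' := by
  unfold ip
  congr 1
  refine Finset.sum_congr rfl fun j hj => ?_
  have : j ≤ n := by simpa [Nat.lt_succ_iff] using hj
  rw [hp j this, hq j this]

lemma ip_add_left (p p' q : ℕ → ℝ) :
    ip n h (fun j => p j + p' j) q = ip n h p q + ip n h p' q := by
  simp [ip, add_mul, Finset.sum_add_distrib, mul_add]

lemma ip_sub_left (p p' q : ℕ → ℝ) :
    ip n h (fun j => p j - p' j) q = ip n h p q - ip n h p' q := by
  simp [ip, sub_mul, Finset.sum_sub_distrib, mul_sub]

lemma ip_add_right (p q q' : ℕ → ℝ) :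
    ip n h p (fun j => q j + q' j) = ip n h p q + ip n h p q' := by
  simp [ip, Finset.sum_add_distrib, mul_add]

lemma ip_sub_right (p q q' : ℕ → ℝ) :
    ip n h p (fun j => q j - q' j) = ip n h p q - ip n h p q' := by
  simp [ip, Finset.sum_sub_distrib, mul_sub]

lemma ip_self_nonneg (hh : 0 < h) (p : ℕ → ℝ) : 0 ≤ ip n h p p :=
  mul_nonneg hh.le (Finset.sum_nonneg fun _ _ => mul_self_nonneg _)

lemma ip_mono (hh : 0 < h) {p q p' q' : ℕ → ℝ} (H : ∀ j ≤ n, p j * q j ≤ p' j * q' j) :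
    ip n h p q ≤ ip n h p' q' := by
  exact mul_le_mul_of_nonneg_left (Finset.sum_le_sum fun j hj =>
    H j (by simpa [Nat.lt_succ_iff] using hj)) hh.le

lemma abs_ip_le_ip_abs (hh : 0 < h) (p q : ℕ → ℝ) :
    |ip n h p q| ≤ ip n h (fun j => |p j|) (fun j => |q j|) := by
  unfold ip
  rw [abs_mul, abs_of_pos hh]
  gcongr
  refine (Finset.abs_sum_le_sum_abs _ _).trans (le_of_eq ?_)
  simp [abs_mul]

lemma abs_ip_le (hh : 0 < h) (p q : ℕ → ℝ) :
    |ip n h p q| ≤ √(ip n h p p) * √(ip n h q q) := by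
  rw [← Real.sqrt_mul (ip_self_nonneg hh p)]
  refine Real.abs_le_sqrt ?_
  have := Finset.sum_mul_sq_le_sq_mul_sq (Finset.range (n + 1)) p q
  have h2 : 0 ≤ h ^ 2 := sq_nonneg h
  unfold ip
  simp only [← pow_two]
  nlinarith [mul_le_mul_of_nonneg_left this h2]

lemma ip_le (hh : 0 < h) (p q : ℕ → ℝ) :
    ip n h p q ≤ √(ip n h p p) * √(ip n h q q) := (le_abs_self _).trans (abs_ip_le hh p q)

lemma ip_abs_abs (p : ℕ → ℝ) :
    ip n h (fun j => |p j|) (fun j => |p j|) = ip n h p p := by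
  simp [ip]

lemma ip_abs_le (hh : 0 < h) (p q : ℕ → ℝ) :
    ip n h (fun j => |p j|) (fun j => |q j|) ≤ √(ip n h p p) * √(ip n h q q) := by
  have := ip_le (n := n) hh (fun j => |p j|) (fun j => |q j|)
  rwa [ip_abs_abs, ip_abs_abs] at this

lemma sq_le_ip (hh : 0 < h) (p : ℕ → ℝ) {j : ℕ} (hj : j ≤ n) : h * p j ^ 2 ≤ ip n h p p := by
  unfold ip
  gcongr
  rw [pow_two]
  exact Finset.single_le_sum (f := fun j => p j * p j) (fun _ _ => mul_self_nonneg _)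
    (by simpa [Nat.lt_succ_iff] using hj)

/-- A bounded sequence has bounded discrete norm. -/
lemma ip_self_le_of_abs_le (hh : 0 < h) {p : ℕ → ℝ} {C : ℝ} (hC : ∀ j ≤ n, |p j| ≤ C) :
    ip n h p p ≤ (n + 1) * h * C ^ 2 := by
  have : ip n h p p ≤ ip n h (fun _ => C) (fun _ => C) := by
    refine ip_mono hh fun j hj => ?_
    have := hC j hj
    have h0 := abs_nonneg (p j)
    rw [← abs_mul_abs_self (p j)]
    nlinarith
  refine this.trans (le_of_eq ?_)
  simp [ip]
  ring

/-- Summation by parts against node values vanishing at the end nodes. -/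
lemma ip_fwd (w v : ℕ → ℝ) (h0 : v 0 = 0) (hn : v (n + 1) = 0) :
    ip n h w (fwd h v) = - ip n h (bwd n h w) v := by
  have key : ∀ m, ∑ j ∈ Finset.range (m + 1), w j * (v (j + 1) - v j)
      = w m * v (m + 1) - ∑ j ∈ Finset.range (m + 1), (w j - w (j - 1)) * v j := by
    intro m
    induction m with
    | zero => simp [h0]
    | succ m ih =>
      rw [Finset.sum_range_succ, ih, Finset.sum_range_succ (n := m + 1)]
      simp only [Nat.add_sub_cancel]
      ring
  have e1 : ∑ j ∈ Finset.range (n + 1), w j * fwd h v j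
      = (∑ j ∈ Finset.range (n + 1), w j * (v (j + 1) - v j)) / h := by
    rw [Finset.sum_div]
    refine Finset.sum_congr rfl fun j _ => ?_
    simp [fwd, mul_div_assoc]
  have e2 : ∑ j ∈ Finset.range (n + 1), bwd n h w j * v j
      = (∑ j ∈ Finset.range (n + 1), (w j - w (j - 1)) * v j) / h := by
    rw [Finset.sum_div]
    refine Finset.sum_congr rfl fun j hj => ?_
    rw [bwd_of_le (by simpa [Nat.lt_succ_iff] using hj)]
    ring
  rw [ip, ip, e1, e2, key n, hn]
  ring

lemma hasDerivAt_ip {p q : ℝ → ℕ → ℝ} {p' q' : ℕ → ℝ} {t : ℝ}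
    (hp : ∀ j ≤ n, HasDerivAt (fun s => p s j) (p' j) t)
    (hq : ∀ j ≤ n, HasDerivAt (fun s => q s j) (q' j) t) :
    HasDerivAt (fun s => ip n h (p s) (q s)) (ip n h p' (q t) + ip n h (p t) q') t := by
  unfold ip
  rw [← mul_add, ← Finset.sum_add_distrib]
  refine HasDerivAt.const_mul h (HasDerivAt.fun_sum fun j hj => ?_)
  have : j ≤ n := by simpa [Nat.lt_succ_iff] using hj
  exact (hp j this).mul (hq j this)

/-- Telescoping bound of an oscillation. -/
lemma abs_sub_le_sum (φ : ℕ → ℝ) {i j : ℕ} (hi : i ≤ n) (hj : j ≤ n) :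
    |φ j - φ i| ≤ ∑ k ∈ Finset.range (n + 1), |φ k - φ (k - 1)| := by
  wlog hij : i ≤ j generalizing i j
  · rw [abs_sub_comm]
    exact this hj hi (by omega)
  have h1 : φ j - φ i = ∑ k ∈ Finset.Ico i j, (φ (k + 1) - φ k) := by
    rw [Finset.sum_Ico_sub φ hij]
  rw [h1]
  refine (Finset.abs_sum_le_sum_abs _ _).trans ?_
  have h2 : ∑ k ∈ Finset.Ico i j, |φ (k + 1) - φ k|
      = ∑ k ∈ Finset.Ico (i + 1) (j + 1), |φ k - φ (k - 1)| := by
    rw [← Finset.sum_Ico_add' (fun k => |φ k - φ (k - 1)|) i j 1]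
    simp
  rw [h2]
  refine Finset.sum_le_sum_of_subset_of_nonneg (fun k hk => ?_) fun _ _ _ => abs_nonneg _
  simp only [Finset.mem_Ico, Finset.mem_range] at *
  omega

lemma abs_sub_sq_le (hh : 0 < h) (w : ℕ → ℝ) {i j : ℕ} (hij : i ≤ j) (hj : j ≤ n) :
    (w j - w i) ^ 2 ≤ h * (j - i) * ip n h (bwd n h w) (bwd n h w) := by
  have h1 : w j - w i = ∑ k ∈ Finset.Ico i j, (w (k + 1) - w k) * 1 := by
    simp [Finset.sum_Ico_sub w hij]
  have h2 := Finset.sum_mul_sq_le_sq_mul_sq (Finset.Ico i j) (fun k => w (k + 1) - w k)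
    (fun _ => 1)
  rw [← h1] at h2
  refine h2.trans ?_
  have h3 : ∑ k ∈ Finset.Ico i j, (w (k + 1) - w k) ^ 2
      ≤ h ^ 2 * ∑ k ∈ Finset.range (n + 1), bwd n h w k * bwd n h w k := by
    have : ∑ k ∈ Finset.Ico i j, (w (k + 1) - w k) ^ 2
        = ∑ k ∈ Finset.Ico (i + 1) (j + 1), h ^ 2 * (bwd n h w k * bwd n h w k) := by
      rw [← Finset.sum_Ico_add' (fun k => h ^ 2 * (bwd n h w k * bwd n h w k)) i j 1]
      refine Finset.sum_congr rfl fun k hk => ?_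
      simp only [Finset.mem_Ico] at hk
      rw [bwd_of_le (by omega)]
      simp only [Nat.add_sub_cancel]
      field_simp
    rw [this, Finset.mul_sum]
    refine Finset.sum_le_sum_of_subset_of_nonneg (fun k hk => ?_)
      fun _ _ _ => mul_nonneg (sq_nonneg _) (mul_self_nonneg _)
    simp only [Finset.mem_Ico, Finset.mem_range] at *
    omega
  have h4 : ∑ k ∈ Finset.Ico i j, (1 : ℝ) ^ 2 = (j : ℝ) - i := by
    simp [Nat.cast_sub hij]
  rw [h4]
  have h5 : (0 : ℝ) ≤ (j : ℝ) - i := by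
    rw [sub_nonneg]; exact_mod_cast hij
  calc _ ≤ (h ^ 2 * ∑ k ∈ Finset.range (n + 1), bwd n h w k * bwd n h w k) * ((j : ℝ) - i) := by
        gcongr
    _ = _ := by unfold ip; ring

/-- Sup bound for node values vanishing at the first node. -/
lemma sq_le_fwd (hh : 0 < h) (q : ℕ → ℝ) (h0 : q 0 = 0) {j : ℕ} (hj : j ≤ n + 1) :
    q j ^ 2 ≤ (n + 1) * h * ip n h (fwd h q) (fwd h q) := by
  have h1 : q j = ∑ k ∈ Finset.range j, (q (k + 1) - q k) * 1 := by
    simp only [mul_one]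
    rw [Finset.sum_range_sub, h0, sub_zero]
  have h2 := Finset.sum_mul_sq_le_sq_mul_sq (Finset.range j) (fun k => q (k + 1) - q k)
    (fun _ => 1)
  rw [← h1] at h2
  refine h2.trans ?_
  have h3 : ∑ k ∈ Finset.range j, (q (k + 1) - q k) ^ 2
      ≤ h ^ 2 * ∑ k ∈ Finset.range (n + 1), fwd h q k * fwd h q k := by
    rw [Finset.mul_sum]
    calc _ ≤ ∑ k ∈ Finset.range (n + 1), (q (k + 1) - q k) ^ 2 :=
          Finset.sum_le_sum_of_subset_of_nonneg (Finset.range_mono hj) fun _ _ _ => sq_nonneg _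
      _ = _ := by
          refine Finset.sum_congr rfl fun k _ => ?_
          unfold fwd
          field_simp
  have h4 : ∑ k ∈ Finset.range j, (1 : ℝ) ^ 2 ≤ (n : ℝ) + 1 := by
    simp; exact_mod_cast hj
  have h5 : 0 ≤ h ^ 2 * ∑ k ∈ Finset.range (n + 1), fwd h q k * fwd h q k :=
    mul_nonneg (sq_nonneg _) (Finset.sum_nonneg fun _ _ => mul_self_nonneg _)
  calc _ ≤ (h ^ 2 * ∑ k ∈ Finset.range (n + 1), fwd h q k * fwd h q k) * ((n : ℝ) + 1) := by
        gcongr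
    _ = _ := by unfold ip; ring

lemma ip_shift_le (hh : 0 < h) (q : ℕ → ℝ) (hn : q (n + 1) = 0) :
    ip n h (fun j => q (j + 1)) (fun j => q (j + 1)) ≤ ip n h q q := by
  unfold ip
  gcongr h * ?_
  simp only
  rw [Finset.sum_range_succ, hn, Finset.sum_range_succ' (fun j => q j * q j)]
  nlinarith [mul_self_nonneg (q 0)]

lemma ip_shift_back_le (hh : 0 < h) (q : ℕ → ℝ) :
    ip n h (fun j => q (j - 1)) (fun j => q (j - 1)) ≤ 2 * ip n h q q := by
  unfold ip
  rw [mul_left_comm]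
  gcongr h * ?_
  rw [Finset.sum_range_succ' (fun j => q (j - 1) * q (j - 1)), two_mul]
  simp only [Nat.add_sub_cancel]
  refine add_le_add (Finset.sum_le_sum_of_subset_of_nonneg (Finset.range_mono (by omega))
    fun _ _ _ => mul_self_nonneg _) ?_
  exact Finset.single_le_sum (f := fun j => q j * q j) (fun _ _ => mul_self_nonneg _) (by simp)

/-- Discrete Agmon inequality. -/
lemma agmon (hh : 0 < h) (w : ℕ → ℝ) {j : ℕ} (hj : j ≤ n) :
    w j ^ 2 ≤ ip n h w w / ((n + 1) * h)
      + 3 * √(ip n h w w) * √(ip n h (bwd n h w) (bwd n h w)) := by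
  obtain ⟨i, hi, hmin⟩ := Finset.exists_min_image (Finset.range (n + 1)) (fun i => w i * w i)
    ⟨0, by simp⟩
  have hi' : i ≤ n := by simpa [Nat.lt_succ_iff] using hi
  have h1 : w i ^ 2 ≤ ip n h w w / ((n + 1) * h) := by
    rw [le_div_iff₀ (by positivity)]
    have := Finset.card_nsmul_le_sum (Finset.range (n + 1)) (fun i => w i * w i) (w i * w i) hmin
    simp only [Finset.card_range, nsmul_eq_mul, Nat.cast_add, Nat.cast_one] at this
    unfold ip
    nlinarith [mul_le_mul_of_nonneg_left this hh.le]
  have h2 : w j ^ 2 - w i ^ 2 ≤ ∑ k ∈ Finset.range (n + 1), |w k ^ 2 - w (k - 1) ^ 2| :=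
    (le_abs_self _).trans (abs_sub_le_sum (n := n) (fun k => w k ^ 2) hi' hj)
  have h3 : ∑ k ∈ Finset.range (n + 1), |w k ^ 2 - w (k - 1) ^ 2|
      ≤ ip n h (fun j => |bwd n h w j|) (fun j => |w j|)
        + ip n h (fun j => |bwd n h w j|) (fun j => |w (j - 1)|) := by
    rw [← ip_add_right, ip, Finset.mul_sum]
    refine Finset.sum_le_sum fun k hk => ?_
    rw [bwd_of_le (by simpa [Nat.lt_succ_iff] using hk), abs_div, abs_of_pos hh]
    have : w k ^ 2 - w (k - 1) ^ 2 = (w k - w (k - 1)) * (w k + w (k - 1)) := by ring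
    rw [this, abs_mul]
    have e : h * (|w k - w (k - 1)| / h * (|w k| + |w (k - 1)|))
        = |w k - w (k - 1)| * (|w k| + |w (k - 1)|) := by field_simp
    rw [e]
    gcongr
    exact abs_add_le _ _
  have h4 := ip_abs_le (n := n) hh (bwd n h w) w
  have h5 := ip_abs_le (n := n) hh (bwd n h w) (fun j => w (j - 1))
  have h6 : √(ip n h (fun j => w (j - 1)) (fun j => w (j - 1))) ≤ 2 * √(ip n h w w) := by
    have : (2 : ℝ) * √(ip n h w w) = √(4 * ip n h w w) := by
      rw [Real.sqrt_mul (by norm_num), show (4 : ℝ) = 2 ^ 2 by norm_num,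
        Real.sqrt_sq (by norm_num)]
    rw [this]
    refine Real.sqrt_le_sqrt ((ip_shift_back_le hh w).trans ?_)
    linarith [ip_self_nonneg (n := n) hh w]
  have h7 := mul_le_mul_of_nonneg_left h6 (Real.sqrt_nonneg (ip n h (bwd n h w) (bwd n h w)))
  linarith

end

section

section ODE
variable {E : Type*} [NormedAddCommGroup E] [NormedSpace ℝ E] [CompleteSpace E]

/-- A bounded Lipschitz vector field has global integral curves. -/
lemma exists_global_integral_curve {F : E → E} {K B : NNReal} (hK : LipschitzWith K F)
    (hB : ∀ x, ‖F x‖ ≤ B) (x₀ : E) :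
    ∃ α : ℝ → E, α 0 = x₀ ∧ ∀ t, HasDerivAt α (F (α t)) t := by
  have step : ∀ N : ℕ, ∃ α : ℝ → E, α 0 = x₀ ∧
      ∀ t ∈ Ioo (-(N + 1) : ℝ) (N + 1), HasDerivAt α (F (α t)) t := by
    intro N
    have hN : (0 : ℝ) ≤ N + 1 := by positivity
    have hpl : IsPicardLindelof (fun _ => F) (tmin := -(N + 1 : ℝ)) (tmax := (N + 1 : ℝ))
        ⟨0, by constructor <;> linarith⟩ x₀ (B * (N + 1)) 0 B K :=
      { lipschitzOnWith := fun t _ => hK.lipschitzOnWith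
        continuousOn := fun x _ => continuousOn_const
        norm_le := fun t _ x _ => hB x
        mul_max_le := by simp }
    obtain ⟨α, h0, hα⟩ := hpl.exists_eq_forall_mem_Icc_hasDerivWithinAt₀
    exact ⟨α, h0, fun t ht => (hα t (Ioo_subset_Icc_self ht)).hasDerivAt
      (Icc_mem_nhds ht.1 ht.2)⟩
  choose α h0 hα using step
  have agree : ∀ N m : ℕ, N ≤ m → EqOn (α N) (α m) (Ioo (-(N + 1) : ℝ) (N + 1)) := by
    intro N m hm
    have hm' : (N : ℝ) ≤ m := by exact_mod_cast hm
    refine ODE_solution_unique_of_mem_Ioo (v := fun _ => F) (s := fun _ => univ) (K := K)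
      (fun t _ => hK.lipschitzOnWith) (t₀ := 0) ?_ (fun t ht => ⟨hα N t ht, mem_univ _⟩)
      (fun t ht => ⟨hα m t ⟨by linarith [ht.1], by linarith [ht.2]⟩, mem_univ _⟩)
      (by rw [h0, h0])
    constructor <;> linarith [(Nat.cast_nonneg N : (0 : ℝ) ≤ N)]
  refine ⟨fun t => α ⌈|t|⌉₊ t, by simp [h0], fun t => ?_⟩
  have hmem : ∀ s : ℝ, s ∈ Ioo (-((⌈|s|⌉₊ : ℝ) + 1)) ((⌈|s|⌉₊ : ℝ) + 1) := fun s => by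
    have h1 := Nat.le_ceil |s|
    have h2 := abs_le.1 h1
    constructor <;> linarith
  set m := ⌈|t|⌉₊ + 1 with hm
  have hev : (fun s => α ⌈|s|⌉₊ s) =ᶠ[nhds t] α m := by
    have h1 := Nat.le_ceil |t|
    have : {s : ℝ | |s| < (m : ℝ)} ∈ nhds t :=
      (isOpen_lt continuous_abs continuous_const).mem_nhds (by
        simp only [mem_ofPred_eq, hm]; push_cast; linarith)
    filter_upwards [this] with s hs
    exact agree _ _ (Nat.ceil_le.2 (le_of_lt hs)) (hmem s)
  have h2 := hα m t ⟨by have := (hmem t).1; push_cast [hm]; linarith,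
    by have := (hmem t).2; push_cast [hm]; linarith⟩
  rw [show F (α ⌈|t|⌉₊ t) = F (α m t) by rw [agree _ _ (Nat.le_succ _) (hmem t)]]
  exact h2.congr_of_eventuallyEq hev

end ODE

end

section

section Cutoff
variable {E : Type*} [NormedAddCommGroup E]

/-- Real-valued functions that are bounded and Lipschitz on a set. -/
def LipBdd (S : Set E) (φ : E → ℝ) : Prop :=
  ∃ K : ℝ, 0 ≤ K ∧ (∀ x ∈ S, |φ x| ≤ K) ∧ ∀ x ∈ S, ∀ y ∈ S, |φ x - φ y| ≤ K * ‖x - y‖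

variable {S : Set E} {φ ψ : E → ℝ}

lemma LipBdd.add (hφ : LipBdd S φ) (hψ : LipBdd S ψ) : LipBdd S (fun x => φ x + ψ x) := by
  obtain ⟨K, hK, h1, h2⟩ := hφ
  obtain ⟨L, hL, h3, h4⟩ := hψ
  refine ⟨K + L, by positivity, fun x hx => ?_, fun x hx y hy => ?_⟩
  · exact (abs_add_le _ _).trans (add_le_add (h1 x hx) (h3 x hx))
  · rw [add_sub_add_comm, add_mul]
    exact (abs_add_le _ _).trans (add_le_add (h2 x hx y hy) (h4 x hx y hy))

lemma LipBdd.mul (hφ : LipBdd S φ) (hψ : LipBdd S ψ) : LipBdd S (fun x => φ x * ψ x) := by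
  obtain ⟨K, hK, h1, h2⟩ := hφ
  obtain ⟨L, hL, h3, h4⟩ := hψ
  refine ⟨2 * (K * L), by positivity, fun x hx => ?_, fun x hx y hy => ?_⟩
  · rw [abs_mul]
    have := mul_le_mul (h1 x hx) (h3 x hx) (abs_nonneg _) hK
    nlinarith [mul_nonneg hK hL]
  · have : φ x * ψ x - φ y * ψ y = φ x * (ψ x - ψ y) + (φ x - φ y) * ψ y := by ring
    rw [this]
    refine (abs_add_le _ _).trans ?_
    rw [abs_mul, abs_mul]
    have a1 := mul_le_mul (h1 x hx) (h4 x hx y hy) (abs_nonneg _) hK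
    have a2 := mul_le_mul (h2 x hx y hy) (h3 y hy) (abs_nonneg _) (by positivity)
    linarith

lemma LipBdd.const (c : ℝ) : LipBdd S (fun _ => c) :=
  ⟨|c|, abs_nonneg _, fun _ _ => le_rfl, fun x _ y _ => by
    rw [sub_self, abs_zero]; positivity⟩

lemma LipBdd.sub (hφ : LipBdd S φ) (hψ : LipBdd S ψ) : LipBdd S (fun x => φ x - ψ x) := by
  simpa [sub_eq_add_neg] using hφ.add ((LipBdd.const (-1)).mul hψ)

lemma LipBdd.div_const (hφ : LipBdd S φ) (c : ℝ) : LipBdd S (fun x => φ x / c) := by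
  simpa [div_eq_mul_inv] using hφ.mul (LipBdd.const c⁻¹)

lemma LipBdd.comp_lipschitz (hφ : LipBdd S φ) {g : ℝ → ℝ} {M : ℝ} (hM : 0 ≤ M)
    (hg : ∀ x y, |g x - g y| ≤ M * |x - y|) : LipBdd S (fun x => g (φ x)) := by
  obtain ⟨K, hK, h1, h2⟩ := hφ
  refine ⟨|g 0| + M * K, by positivity, fun x hx => ?_, fun x hx y hy => ?_⟩
  · have a1 := hg (φ x) 0
    have a2 := mul_le_mul_of_nonneg_left (h1 x hx) hM
    have a3 := abs_sub_abs_le_abs_sub (g (φ x)) (g 0)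
    rw [sub_zero] at a1
    linarith
  · have a1 := hg (φ x) (φ y)
    have a2 := mul_le_mul_of_nonneg_left (h2 x hx y hy) hM
    have a3 : 0 ≤ |g 0| * ‖x - y‖ := by positivity
    nlinarith

/-- A Lipschitz cutoff equal to `1` on the ball of radius `R` and to `0` outside radius `2 R`. -/
def cutoff (R : ℝ) (x : E) : ℝ := max 0 (min 1 (2 - ‖x‖ / R))

lemma cutoff_nonneg (R : ℝ) (x : E) : 0 ≤ cutoff R x := le_max_left _ _

lemma cutoff_le_one (R : ℝ) (x : E) : cutoff R x ≤ 1 :=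
  max_le zero_le_one (min_le_left _ _)

lemma cutoff_eq_one {R : ℝ} (hR : 0 < R) {x : E} (hx : ‖x‖ ≤ R) : cutoff R x = 1 := by
  have : ‖x‖ / R ≤ 1 := (div_le_one hR).2 hx
  unfold cutoff
  rw [min_eq_left (by linarith), max_eq_right zero_le_one]

lemma cutoff_eq_zero {R : ℝ} (hR : 0 < R) {x : E} (hx : 2 * R < ‖x‖) : cutoff R x = 0 := by
  have : 2 ≤ ‖x‖ / R := (le_div_iff₀ hR).2 hx.le
  unfold cutoff
  rw [min_eq_right (by linarith), max_eq_left (by linarith)]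

lemma abs_cutoff_sub_le {R : ℝ} (hR : 0 < R) (x y : E) :
    |cutoff R x - cutoff R y| ≤ ‖x - y‖ / R := by
  have h1 : |cutoff R x - cutoff R y| ≤ |(2 - ‖x‖ / R) - (2 - ‖y‖ / R)| := by
    unfold cutoff
    rw [max_comm 0, max_comm 0, min_comm 1, min_comm 1]
    refine (abs_max_sub_max_le_abs _ _ _).trans ?_
    have := abs_min_sub_min_le_max (2 - ‖x‖ / R) 1 (2 - ‖y‖ / R) 1
    simpa using this
  refine h1.trans ?_
  have : (2 - ‖x‖ / R) - (2 - ‖y‖ / R) = (‖y‖ - ‖x‖) / R := by ring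
  rw [this, abs_div, abs_of_pos hR, norm_sub_rev]
  gcongr
  exact abs_norm_sub_norm_le _ _

/-- The cut-off of a locally bounded Lipschitz function is globally bounded and Lipschitz. -/
lemma LipBdd.cutoff_mul {R : ℝ} (hR : 0 < R) (hφ : LipBdd {x : E | ‖x‖ ≤ 2 * R} φ) :
    LipBdd univ (fun x => cutoff R x * φ x) := by
  obtain ⟨K, hK, h1, h2⟩ := hφ
  have hb : ∀ x : E, |cutoff R x * φ x| ≤ K := fun x => by
    by_cases hx : ‖x‖ ≤ 2 * R
    · rw [abs_mul, abs_of_nonneg (cutoff_nonneg R x)]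
      exact (mul_le_of_le_one_left (abs_nonneg _) (cutoff_le_one R x)).trans (h1 x hx)
    · rw [cutoff_eq_zero hR (not_le.1 hx)]
      simpa using hK
  have hout : ∀ x y : E, ‖x‖ ≤ 2 * R → ¬ ‖y‖ ≤ 2 * R →
      |cutoff R x * φ x| ≤ (K + K / R) * ‖x - y‖ := fun x y hx hy => by
    have a1 := abs_cutoff_sub_le hR x y
    rw [cutoff_eq_zero hR (not_le.1 hy), sub_zero] at a1
    rw [abs_mul]
    have a2 := mul_le_mul a1 (h1 x hx) (abs_nonneg _) (by positivity)
    have a3 : 0 ≤ K * ‖x - y‖ := by positivity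
    have a4 : ‖x - y‖ / R * K = K / R * ‖x - y‖ := by ring
    linarith
  refine ⟨K + K / R, by positivity, fun x _ => (hb x).trans ?_, fun x _ y _ => ?_⟩
  · have : 0 ≤ K / R := by positivity
    linarith
  show |cutoff R x * φ x - cutoff R y * φ y| ≤ _
  by_cases hx : ‖x‖ ≤ 2 * R <;> by_cases hy : ‖y‖ ≤ 2 * R
  · have : cutoff R x * φ x - cutoff R y * φ y
        = cutoff R x * (φ x - φ y) + (cutoff R x - cutoff R y) * φ y := by ring
    rw [this]
    refine (abs_add_le _ _).trans ?_
    rw [abs_mul, abs_mul, abs_of_nonneg (cutoff_nonneg R x)]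
    have a1 := (mul_le_of_le_one_left (abs_nonneg (φ x - φ y)) (cutoff_le_one R x)).trans
      (h2 x hx y hy)
    have a2 := mul_le_mul (abs_cutoff_sub_le hR x y) (h1 y hy) (abs_nonneg _) (by positivity)
    have a4 : ‖x - y‖ / R * K = K / R * ‖x - y‖ := by ring
    linarith
  · have := hout x y hx hy
    rwa [cutoff_eq_zero hR (not_le.1 hy), zero_mul, sub_zero]
  · have := hout y x hy hx
    rwa [cutoff_eq_zero hR (not_le.1 hx), zero_mul, zero_sub, abs_neg, norm_sub_rev]
  · rw [cutoff_eq_zero hR (not_le.1 hx), cutoff_eq_zero hR (not_le.1 hy)]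
    simp only [zero_mul, sub_self, abs_zero]
    positivity

/-- A vector field on a finite product with bounded Lipschitz components is bounded and
Lipschitz. -/
lemma exists_lipschitzWith_of_lipBdd {ι : Type*} [Fintype ι] {F : E → ι → ℝ}
    (hF : ∀ i, LipBdd univ (fun x => F x i)) :
    ∃ K B : NNReal, LipschitzWith K F ∧ ∀ x, ‖F x‖ ≤ B := by
  choose K hK h1 h2 using hF
  have hs : 0 ≤ ∑ i, K i := Finset.sum_nonneg fun i _ => hK i
  have hle : ∀ i, K i ≤ ∑ i, K i := fun i =>
    Finset.single_le_sum (fun i _ => hK i) (Finset.mem_univ i)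
  refine ⟨(∑ i, K i).toNNReal, (∑ i, K i).toNNReal,
    LipschitzWith.of_dist_le_mul fun x y => ?_, fun x => ?_⟩ <;> rw [Real.coe_toNNReal _ hs]
  · rw [dist_eq_norm, dist_eq_norm, pi_norm_le_iff_of_nonneg (by positivity)]
    intro i
    exact (h2 i x trivial y trivial).trans
      (mul_le_mul_of_nonneg_right (hle i) (norm_nonneg _))
  · rw [pi_norm_le_iff_of_nonneg hs]
    exact fun i => (h1 i x trivial).trans (hle i)

end Cutoff

end

section

/-- The semi-discrete thermoelastic system on `n + 1` cells of length `h`, slowed down by a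
nonnegative time factor `κ`. -/
structure SemiSol (n : ℕ) (h : ℝ) (g : ℝ → ℝ) (κ : ℝ → ℝ) (u v θ : ℝ → ℕ → ℝ) : Prop where
  κ_nonneg : ∀ t, 0 ≤ κ t
  du : ∀ t, ∀ j ≤ n + 1, HasDerivAt (fun s => u s j) (κ t * v t j) t
  dv : ∀ t, ∀ j ≤ n + 1, HasDerivAt (fun s => v s j)
    (κ t * (bwd n h (fwd h (u t)) j - bwd n h (fun i => g (θ t i)) j)) t
  dθ : ∀ t, ∀ j ≤ n, HasDerivAt (fun s => θ s j)
    (κ t * (fwd h (bwd n h (θ t)) j - g (θ t j) * fwd h (v t) j)) t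
  u_first : u 0 0 = 0
  u_last : u 0 (n + 1) = 0
  v_first : v 0 0 = 0
  v_last : v 0 (n + 1) = 0
  θ_init : ∀ j ≤ n, 0 ≤ θ 0 j

variable {n : ℕ} {h : ℝ} {g κ : ℝ → ℝ} {u v θ : ℝ → ℕ → ℝ}

lemma const_of_hasDerivAt_zero {y : ℝ → ℝ} (hy : ∀ t, HasDerivAt y 0 t) (t : ℝ) : y t = y 0 :=
  is_const_of_deriv_eq_zero (fun t => (hy t).differentiableAt) (fun t => (hy t).deriv) t 0

lemma SemiSol.v_bdry (S : SemiSol n h g κ u v θ) (t : ℝ) : v t 0 = 0 ∧ v t (n + 1) = 0 := by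
  constructor
  · exact (const_of_hasDerivAt_zero (y := fun t => v t 0)
      (fun t => by simpa using S.dv t 0 (by omega)) t).trans S.v_first
  · exact (const_of_hasDerivAt_zero (y := fun t => v t (n + 1))
      (fun t => by simpa using S.dv t (n + 1) le_rfl) t).trans S.v_last

lemma SemiSol.u_bdry (S : SemiSol n h g κ u v θ) (t : ℝ) : u t 0 = 0 ∧ u t (n + 1) = 0 := by
  constructor
  · exact (const_of_hasDerivAt_zero (y := fun t => u t 0)
      (fun t => by simpa [(S.v_bdry t).1] using S.du t 0 (by omega)) t).trans S.u_first
  · exact (const_of_hasDerivAt_zero (y := fun t => u t (n + 1))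
      (fun t => by simpa [(S.v_bdry t).2] using S.du t (n + 1) le_rfl) t).trans S.u_last

lemma fwd_const_mul (c : ℝ) (w : ℕ → ℝ) (j : ℕ) : fwd h (fun i => c * w i) j = c * fwd h w j := by
  unfold fwd; ring

lemma ip_const_mul_right (c : ℝ) (p q : ℕ → ℝ) :
    ip n h p (fun j => c * q j) = c * ip n h p q := by
  unfold ip
  rw [mul_left_comm, Finset.mul_sum _ _ c]
  congr 1
  exact Finset.sum_congr rfl fun j _ => by ring

lemma ip_const_mul_left (c : ℝ) (p q : ℕ → ℝ) :
    ip n h (fun j => c * p j) q = c * ip n h p q := by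
  rw [ip_comm, ip_const_mul_right, ip_comm]

lemma hasDerivAt_fwd {w : ℝ → ℕ → ℝ} {w' : ℕ → ℝ} {t : ℝ} {j : ℕ}
    (h1 : HasDerivAt (fun s => w s j) (w' j) t)
    (h2 : HasDerivAt (fun s => w s (j + 1)) (w' (j + 1)) t) :
    HasDerivAt (fun s => fwd h (w s) j) (fwd h w' j) t :=
  (h2.sub h1).div_const h

lemma hasDerivAt_bwd {w : ℝ → ℕ → ℝ} {w' : ℕ → ℝ} {t : ℝ}
    (hw : ∀ j ≤ n, HasDerivAt (fun s => w s j) (w' j) t) {j : ℕ} (hj : j ≤ n + 1) :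
    HasDerivAt (fun s => bwd n h (w s) j) (bwd n h w' j) t :=
  ((hw _ (min_le_right _ _)).sub (hw _ (by omega))).div_const h

/-- Discrete total energy. -/
def energy (n : ℕ) (h : ℝ) (u v θ : ℕ → ℝ) : ℝ :=
  ip n h v v / 2 + ip n h (fwd h u) (fwd h u) / 2 + ip n h θ (fun _ => 1)

/-- Conservation of the total energy. -/
lemma SemiSol.energy_eq (S : SemiSol n h g κ u v θ) (t : ℝ) :
    energy n h (u t) (v t) (θ t) = energy n h (u 0) (v 0) (θ 0) := by
  refine const_of_hasDerivAt_zero (y := fun t => energy n h (u t) (v t) (θ t)) (fun t => ?_) t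
  have h1 := hasDerivAt_ip (n := n) (h := h) (fun j hj => S.dv t j (by omega))
    (fun j hj => S.dv t j (by omega))
  have h2 : ∀ j ≤ n, HasDerivAt (fun s => fwd h (u s) j) (κ t * fwd h (v t) j) t := fun j hj => by
    have := hasDerivAt_fwd (h := h) (w' := fun j => κ t * v t j) (S.du t j (by omega)) (S.du t (j + 1) (by omega))
    rwa [fwd_const_mul] at this
  have h3 := hasDerivAt_ip (n := n) (h := h) h2 h2
  have h4 := hasDerivAt_ip (n := n) (h := h) (S.dθ t)
    (q := fun _ _ => 1) (q' := fun _ => 0) (fun j _ => hasDerivAt_const _ _)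
  have h5 := ((h1.div_const 2).add (h3.div_const 2)).add h4
  refine h5.congr_deriv ?_
  have hv := S.v_bdry t
  have a1 := ip_fwd (n := n) (h := h) (fwd h (u t)) (v t) hv.1 hv.2
  have a2 := ip_fwd (n := n) (h := h) (fun j => g (θ t j)) (v t) hv.1 hv.2
  have a3 := ip_fwd (n := n) (h := h) (fun _ => 1) (bwd n h (θ t)) (by simp) (by simp)
  have a4 : ip n h (bwd n h (fun _ => 1)) (bwd n h (θ t)) = 0 := by simp [ip, bwd]
  have a5 : ip n h (fun j => g (θ t j) * fwd h (v t) j) (fun _ => 1)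
      = ip n h (fun j => g (θ t j)) (fwd h (v t)) := by simp [ip]
  have a6 : ip n h (θ t) (fun _ => 0) = 0 := by simp [ip]
  rw [a4, ip_comm] at a3
  simp only [ip_const_mul_left, ip_const_mul_right, ip_sub_left, a5, a6,
    ip_comm (v t), ip_comm (fwd h (v t))]
  rw [a1, a2, a3]
  ring

lemma hasDerivAt_min_zero_sq (x : ℝ) :
    HasDerivAt (fun x : ℝ => min x 0 * min x 0) (2 * min x 0) x := by
  rcases lt_trichotomy x 0 with hx | hx | hx
  · have : (fun x : ℝ => min x 0 * min x 0) =ᶠ[nhds x] fun x => x * x := by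
      filter_upwards [Iio_mem_nhds hx] with y hy
      rw [min_eq_left (le_of_lt hy)]
    rw [min_eq_left hx.le]
    refine HasDerivAt.congr_of_eventuallyEq ?_ this
    exact ((hasDerivAt_id x).mul (hasDerivAt_id x)).congr_deriv (by simp; ring)
  · subst hx
    rw [min_self, mul_zero, hasDerivAt_iff_isLittleO]
    simp only [min_self, mul_zero, sub_zero, smul_zero]
    refine Asymptotics.isLittleO_iff.2 fun c hc => ?_
    filter_upwards [Metric.ball_mem_nhds (0 : ℝ) hc] with y hy
    rw [Metric.mem_ball, dist_zero_right] at hy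
    rw [norm_mul]
    have : ‖min y 0‖ ≤ ‖y‖ := by
      rcases le_total y 0 with h | h
      · rw [min_eq_left h]
      · rw [min_eq_right h]; simp
    exact mul_le_mul (this.trans hy.le) this (norm_nonneg _) hc.le
  · have : (fun x : ℝ => min x 0 * min x 0) =ᶠ[nhds x] fun _ => 0 := by
      filter_upwards [Ioi_mem_nhds hx] with y hy
      rw [min_eq_right (le_of_lt hy), mul_zero]
    rw [min_eq_right hx.le, mul_zero]
    exact HasDerivAt.congr_of_eventuallyEq (hasDerivAt_const _ _) this

/-- Nonnegativity of the discrete temperature. -/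
lemma SemiSol.θ_nonneg (S : SemiSol n h g κ u v θ) (hh : 0 < h) (hg : ∀ x ≤ 0, g x = 0)
    {t : ℝ} (ht : 0 ≤ t) {j : ℕ} (hj : j ≤ n) : 0 ≤ θ t j := by
  set Z : ℝ → ℝ := fun t => ip n h (fun j => min (θ t j) 0) (fun j => min (θ t j) 0) with hZ
  have hd : ∀ t, HasDerivAt Z (-(2 * κ t) *
      ip n h (bwd n h fun j => min (θ t j) 0) (bwd n h (θ t))) t := fun t => by
    have h1 : HasDerivAt Z (h * ∑ j ∈ Finset.range (n + 1), 2 * min (θ t j) 0 *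
        (κ t * (fwd h (bwd n h (θ t)) j - g (θ t j) * fwd h (v t) j))) t := by
      refine HasDerivAt.const_mul h (HasDerivAt.fun_sum fun j hj => ?_)
      exact (hasDerivAt_min_zero_sq _).comp t
        (S.dθ t j (by simpa [Nat.lt_succ_iff] using hj))
    refine h1.congr_deriv ?_
    have h2 := ip_fwd (n := n) (h := h) (fun j => min (θ t j) 0) (bwd n h (θ t)) (by simp)
      (by simp)
    have h3 : ∑ j ∈ Finset.range (n + 1), 2 * min (θ t j) 0 *
        (κ t * (fwd h (bwd n h (θ t)) j - g (θ t j) * fwd h (v t) j))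
        = 2 * κ t * ∑ j ∈ Finset.range (n + 1), min (θ t j) 0 * fwd h (bwd n h (θ t)) j := by
      rw [Finset.mul_sum]
      refine Finset.sum_congr rfl fun j _ => ?_
      rcases le_total (θ t j) 0 with h | h
      · rw [hg _ h]; ring
      · rw [min_eq_right h]; ring
    rw [h3, mul_left_comm]
    change 2 * κ t * ip n h (fun j => min (θ t j) 0) (fwd h (bwd n h (θ t))) = _
    rw [h2]
    ring
  have hanti : Antitone Z := by
    refine antitone_of_hasDerivAt_nonpos hd fun t => ?_
    rw [neg_mul]
    refine neg_nonpos.2 (mul_nonneg (mul_nonneg zero_le_two (S.κ_nonneg t)) ?_)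
    refine mul_nonneg hh.le (Finset.sum_nonneg fun j _ => ?_)
    unfold bwd
    rw [div_mul_div_comm]
    refine div_nonneg ?_ (mul_self_nonneg _)
    rcases le_total (θ t (min j n)) (θ t (j - 1)) with h | h
    · exact mul_nonneg_of_nonpos_of_nonpos (sub_nonpos.2 (min_le_min_right _ h))
        (sub_nonpos.2 h)
    · exact mul_nonneg (sub_nonneg.2 (min_le_min_right _ h)) (sub_nonneg.2 h)
  have hZ0 : Z 0 = 0 := by
    simp only [hZ, ip]
    rw [Finset.sum_eq_zero, mul_zero]
    intro j hj
    rw [min_eq_right (S.θ_init j (by simpa [Nat.lt_succ_iff] using hj)), mul_zero]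
  have hZt : Z t ≤ 0 := hZ0 ▸ hanti ht
  have h1 := (sq_le_ip hh (fun j => min (θ t j) 0) hj).trans hZt
  have h2 : min (θ t j) 0 ^ 2 ≤ 0 := nonpos_of_mul_nonpos_right h1 hh
  have h3 : min (θ t j) 0 = 0 := by nlinarith [sq_nonneg (min (θ t j) 0)]
  exact min_eq_right_iff.1 h3

end

section

lemma ip_one_nonneg {n : ℕ} {h : ℝ} (hh : 0 < h) {θ : ℕ → ℝ} (hθ : ∀ j ≤ n, 0 ≤ θ j) :
    0 ≤ ip n h θ (fun _ => 1) :=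
  mul_nonneg hh.le (Finset.sum_nonneg fun j hj => by
    simpa using hθ j (by simpa [Nat.lt_succ_iff] using hj))

lemma le_ip_one {n : ℕ} {h : ℝ} (hh : 0 < h) {θ : ℕ → ℝ} (hθ : ∀ j ≤ n, 0 ≤ θ j) {j : ℕ}
    (hj : j ≤ n) : h * θ j ≤ ip n h θ (fun _ => 1) := by
  unfold ip
  gcongr
  simp only [mul_one]
  exact Finset.single_le_sum (f := θ) (fun i hi => hθ i (by simpa [Nat.lt_succ_iff] using hi))
    (by simpa [Nat.lt_succ_iff] using hj)

section System
variable (n : ℕ) (h : ℝ) (g : ℝ → ℝ)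

/-- The three node functions stored in a state vector. -/
def node (y : Fin 3 × Fin (n + 2) → ℝ) (i : Fin 3) (j : ℕ) : ℝ :=
  y (i, ⟨min j (n + 1), by omega⟩)

/-- Right-hand side of the semi-discrete system. -/
def field (y : Fin 3 × Fin (n + 2) → ℝ) (c : Fin 3 × Fin (n + 2)) : ℝ :=
  ![node n y 1 c.2,
    bwd n h (fwd h (node n y 0)) c.2 - bwd n h (fun i => g (node n y 2 i)) c.2,
    if (c.2 : ℕ) ≤ n then
      fwd h (bwd n h (node n y 2)) c.2 - g (node n y 2 c.2) * fwd h (node n y 1) c.2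
    else 0] c.1

variable {n h g}

lemma LipBdd.fwd {E : Type*} [NormedAddCommGroup E] {S : Set E} {w : E → ℕ → ℝ}
    (hw : ∀ j, LipBdd S (fun y => w y j)) (j : ℕ) :
    LipBdd S (fun y => Thermo.fwd h (w y) j) :=
  ((hw _).sub (hw _)).div_const h

lemma LipBdd.bwd {E : Type*} [NormedAddCommGroup E] {S : Set E} {w : E → ℕ → ℝ}
    (hw : ∀ j, LipBdd S (fun y => w y j)) (j : ℕ) :
    LipBdd S (fun y => Thermo.bwd n h (w y) j) :=
  ((hw _).sub (hw _)).div_const h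

lemma lipBdd_node {R : ℝ} (hR : 0 < R) (i : Fin 3) (j : ℕ) :
    LipBdd {x : Fin 3 × Fin (n + 2) → ℝ | ‖x‖ ≤ 2 * R} (fun y => node n y i j) := by
  refine ⟨2 * R + 1, by positivity, fun x hx => ?_, fun x _ y _ => ?_⟩
  · have := norm_le_pi_norm x (i, ⟨min j (n + 1), by omega⟩)
    have hx' : ‖x‖ ≤ 2 * R := hx
    exact this.trans (by linarith)
  · have := norm_le_pi_norm (x - y) (i, ⟨min j (n + 1), by omega⟩)
    refine this.trans ?_
    nlinarith [norm_nonneg (x - y)]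

lemma lipBdd_field {R M : ℝ} (hR : 0 < R) (hM : 0 ≤ M)
    (hg : ∀ x y, |g x - g y| ≤ M * |x - y|) (c : Fin 3 × Fin (n + 2)) :
    LipBdd {x : Fin 3 × Fin (n + 2) → ℝ | ‖x‖ ≤ 2 * R} (fun y => field n h g y c) := by
  obtain ⟨i, j⟩ := c
  have hn : ∀ i j, LipBdd {x : Fin 3 × Fin (n + 2) → ℝ | ‖x‖ ≤ 2 * R}
    (fun y => node n y i j) := lipBdd_node hR
  have hgn := fun j => (hn 2 j).comp_lipschitz hM hg
  fin_cases i
  · exact hn 1 j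
  · exact (LipBdd.bwd (LipBdd.fwd (hn 0)) _).sub (LipBdd.bwd hgn _)
  · by_cases hj : (j : ℕ) ≤ n
    · simpa [field, hj] using (LipBdd.fwd (h := h) (LipBdd.bwd (n := n) (h := h) (hn 2)) j).sub
        ((hgn j).mul (LipBdd.fwd (h := h) (hn 1) j))
    · simpa [field, hj] using LipBdd.const 0

lemma node_eq (y : Fin 3 × Fin (n + 2) → ℝ) (i : Fin 3) {j : ℕ} (hj : j ≤ n + 1) :
    node n y i j = y (i, ⟨j, by omega⟩) := by
  simp only [node, min_eq_left hj]

/-- Global solvability of the semi-discrete system. -/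
lemma exists_semiSol {M : ℝ} (hh : 0 < h) (hM : 0 ≤ M) (hg : ∀ x y, |g x - g y| ≤ M * |x - y|)
    (hg0 : ∀ x ≤ 0, g x = 0) {U V W : ℕ → ℝ} (hU : U 0 = 0) (hU' : U (n + 1) = 0)
    (hV : V 0 = 0) (hV' : V (n + 1) = 0) (hW : ∀ j ≤ n, 0 ≤ W j) :
    ∃ (κ : ℝ → ℝ) (u v θ : ℝ → ℕ → ℝ), SemiSol n h g κ u v θ ∧ (∀ t, 0 ≤ t → κ t = 1) ∧
      (∀ j ≤ n + 1, u 0 j = U j) ∧ (∀ j ≤ n + 1, v 0 j = V j) ∧ (∀ j ≤ n, θ 0 j = W j) := by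
  set E0 := energy n h U V W with hE0
  have hE0' : 0 ≤ E0 := by
    have h1 := ip_self_nonneg (n := n) hh V
    have h2 := ip_self_nonneg (n := n) hh (fwd h U)
    have h3 := ip_one_nonneg hh hW
    rw [hE0, energy]
    positivity
  set R : ℝ := 1 + (E0 / h + 2 * E0 / h + (n + 1) * h * (2 * E0)) with hRdef
  have p1 : 0 ≤ E0 / h := by positivity
  have p2 : 0 ≤ 2 * E0 / h := by positivity
  have p3 : 0 ≤ (n + 1) * h * (2 * E0) := by positivity
  have hR : 0 < R := by rw [hRdef]; positivity
  set F : (Fin 3 × Fin (n + 2) → ℝ) → Fin 3 × Fin (n + 2) → ℝ :=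
    fun y c => cutoff R y * field n h g y c with hF
  obtain ⟨K, B, hK, hB⟩ := exists_lipschitzWith_of_lipBdd (F := F)
    (fun c => (lipBdd_field hR hM hg c).cutoff_mul hR)
  set x₀ : Fin 3 × Fin (n + 2) → ℝ := fun c =>
    ![U c.2, V c.2, if (c.2 : ℕ) ≤ n then W c.2 else 0] c.1 with hx₀
  obtain ⟨α, hα0, hα⟩ := exists_global_integral_curve hK hB x₀
  have hαc : ∀ t c, HasDerivAt (fun s => α s c) (cutoff R (α t) * field n h g (α t) c) t :=
    fun t c => hasDerivAt_pi.1 (hα t) c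
  have iu : ∀ j ≤ n + 1, node n (α 0) 0 j = U j := fun j hj => by
    rw [node_eq _ _ hj, hα0]; simp [hx₀]
  have iv : ∀ j ≤ n + 1, node n (α 0) 1 j = V j := fun j hj => by
    rw [node_eq _ _ hj, hα0]; simp [hx₀]
  have iθ : ∀ j ≤ n, node n (α 0) 2 j = W j := fun j hj => by
    rw [node_eq _ _ (by omega), hα0]; simp [hx₀, hj]
  have S : SemiSol n h g (fun t => cutoff R (α t)) (fun t => node n (α t) 0)
      (fun t => node n (α t) 1) (fun t => node n (α t) 2) :=
    { κ_nonneg := fun t => cutoff_nonneg _ _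
      du := fun t j hj => by
        have := hαc t (0, ⟨j, by omega⟩)
        simp only [node_eq _ _ hj]
        simpa [field, node_eq _ _ hj] using this
      dv := fun t j hj => by
        have := hαc t (1, ⟨j, by omega⟩)
        simp only [node_eq _ _ hj]
        simpa [field] using this
      dθ := fun t j hj => by
        have := hαc t (2, ⟨j, by omega⟩)
        simp only [node_eq _ _ (show j ≤ n + 1 by omega)]
        simpa [field, hj, node_eq _ _ (show j ≤ n + 1 by omega)] using this
      u_first := by rw [iu 0 (by omega), hU]
      u_last := by rw [iu _ le_rfl, hU']
      v_first := by rw [iv 0 (by omega), hV]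
      v_last := by rw [iv _ le_rfl, hV']
      θ_init := fun j hj => by rw [iθ j hj]; exact hW j hj }
  have hEt : ∀ t, energy n h (node n (α t) 0) (node n (α t) 1) (node n (α t) 2) = E0 := by
    intro t
    rw [S.energy_eq t, hE0]
    unfold energy
    have hfu : ∀ j ≤ n, fwd h (node n (α 0) 0) j = fwd h U j := fun j hj => by
      simp [fwd, iu j (by omega), iu (j + 1) (by omega)]
    have hv : ∀ j ≤ n, node n (α 0) 1 j = V j := fun j hj => iv j (by omega)
    rw [ip_congr hv hv, ip_congr hfu hfu,
      ip_congr (p' := W) (fun j hj => iθ j hj) (fun _ _ => rfl)]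
  have hbd : ∀ t, 0 ≤ t → ‖α t‖ ≤ R := by
    intro t ht
    have hθ := fun j hj => S.θ_nonneg hh hg0 ht (j := j) hj
    have q1 := ip_self_nonneg (n := n) hh (node n (α t) 1)
    have q2 := ip_self_nonneg (n := n) hh (fwd h (node n (α t) 0))
    have q3 := ip_one_nonneg hh hθ
    have hE := hEt t
    unfold energy at hE
    have sq_bd : ∀ x c : ℝ, x ^ 2 ≤ c → |x| ≤ 1 + c := fun x c hx => by
      rw [abs_le]; constructor <;> nlinarith [sq_nonneg (x - 1), sq_nonneg (x + 1)]
    rw [pi_norm_le_iff_of_nonneg hR.le]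
    rintro ⟨i, ⟨j, hj⟩⟩
    have hj1 : j ≤ n + 1 := by omega
    rw [Real.norm_eq_abs]
    fin_cases i
    · have a1 := sq_le_fwd (n := n) hh (node n (α t) 0) (S.u_bdry t).1 hj1
      rw [node_eq _ _ hj1] at a1
      have a2 : (n + 1) * h * ip n h (fwd h (node n (α t) 0)) (fwd h (node n (α t) 0))
          ≤ (n + 1) * h * (2 * E0) := by gcongr; linarith
      exact (sq_bd _ _ (a1.trans a2)).trans (by rw [hRdef]; linarith)
    · rcases Nat.lt_or_ge n j with hjn | hjn
      · have := (S.v_bdry t).2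
        rw [node_eq _ _ le_rfl] at this
        obtain rfl : j = n + 1 := by omega
        change |α t (1, _)| ≤ R
        rw [this, abs_zero]; exact hR.le
      · have a1 := sq_le_ip hh (node n (α t) 1) hjn
        rw [node_eq _ _ hj1] at a1
        have a2 : α t (1, ⟨j, hj⟩) ^ 2 ≤ 2 * E0 / h := by
          rw [le_div_iff₀ hh]; linarith
        exact (sq_bd _ _ a2).trans (by rw [hRdef]; linarith)
    · rcases Nat.lt_or_ge n j with hjn | hjn
      · have a1 : ∀ s, HasDerivAt (fun s => α s (2, ⟨j, hj⟩)) 0 s := fun s => by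
          simpa [field, not_le.2 hjn] using hαc s (2, ⟨j, hj⟩)
        have a2 := const_of_hasDerivAt_zero a1 t
        have a3 : α 0 (2, ⟨j, hj⟩) = 0 := by rw [hα0]; simp [hx₀, not_le.2 hjn]
        change |α t (2, _)| ≤ R
        rw [a2, a3, abs_zero]; exact hR.le
      · have a1 := le_ip_one hh hθ hjn
        have a0 := hθ j hjn
        simp only [node_eq _ _ hj1] at a0 a1
        change |α t (2, _)| ≤ R
        rw [abs_of_nonneg a0]
        have a2 : α t (2, ⟨j, hj⟩) ≤ E0 / h := by
          rw [le_div_iff₀ hh]; linarith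
        exact a2.trans (by rw [hRdef]; linarith)
  exact ⟨_, _, _, _, S, fun t ht => cutoff_eq_one hR (hbd t ht), iu, iv, iθ⟩

end System

end

section

/-- Nonlinearities with slope `g'` that are Lipschitz, vanish on the nonpositive reals and satisfy a
second-order Taylor estimate on the nonnegative reals. -/
structure Nonlin (M : ℝ) (g g' : ℝ → ℝ) : Prop where
  M_nonneg : 0 ≤ M
  lip : ∀ x y, |g x - g y| ≤ M * |x - y|
  zero : ∀ x ≤ 0, g x = 0
  slope : ∀ x, 0 ≤ x → |g' x| ≤ M
  taylor : ∀ x y, 0 ≤ x → 0 ≤ y → |g y - g x - g' x * (y - x)| ≤ M * (y - x) ^ 2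

lemma Nonlin.abs_le {M : ℝ} {g g' : ℝ → ℝ} (N : Nonlin M g g') {x : ℝ} (hx : 0 ≤ x) :
    |g x| ≤ M * x := by
  have := N.lip x 0
  rwa [N.zero 0 le_rfl, sub_zero, sub_zero, abs_of_nonneg hx] at this

/-- Solutions of the semi-discrete thermoelastic system for nonnegative times. -/
structure DSol (n : ℕ) (h : ℝ) (g : ℝ → ℝ) (u v θ : ℝ → ℕ → ℝ) : Prop where
  du : ∀ t, 0 ≤ t → ∀ j ≤ n + 1, HasDerivAt (fun s => u s j) (v t j) t
  dv : ∀ t, 0 ≤ t → ∀ j ≤ n + 1, HasDerivAt (fun s => v s j)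
    (bwd n h (fwd h (u t)) j - bwd n h (fun i => g (θ t i)) j) t
  dθ : ∀ t, 0 ≤ t → ∀ j ≤ n, HasDerivAt (fun s => θ s j)
    (fwd h (bwd n h (θ t)) j - g (θ t j) * fwd h (v t) j) t
  ub : ∀ t, 0 ≤ t → u t 0 = 0 ∧ u t (n + 1) = 0
  vb : ∀ t, 0 ≤ t → v t 0 = 0 ∧ v t (n + 1) = 0
  nonneg : ∀ t, 0 ≤ t → ∀ j ≤ n, 0 ≤ θ t j
  energy_eq : ∀ t, 0 ≤ t → energy n h (u t) (v t) (θ t) = energy n h (u 0) (v 0) (θ 0)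

lemma exists_dSol {n : ℕ} {h : ℝ} {M : ℝ} {g g' : ℝ → ℝ} (hh : 0 < h) (N : Nonlin M g g')
    {U V W : ℕ → ℝ} (hU : U 0 = 0) (hU' : U (n + 1) = 0)
    (hV : V 0 = 0) (hV' : V (n + 1) = 0) (hW : ∀ j ≤ n, 0 ≤ W j) :
    ∃ u v θ : ℝ → ℕ → ℝ, DSol n h g u v θ ∧
      (∀ j ≤ n + 1, u 0 j = U j) ∧ (∀ j ≤ n + 1, v 0 j = V j) ∧ (∀ j ≤ n, θ 0 j = W j) := by
  obtain ⟨κ, u, v, θ, S, hκ, iu, iv, iθ⟩ :=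
    exists_semiSol hh N.M_nonneg N.lip N.zero hU hU' hV hV' hW
  refine ⟨u, v, θ, ⟨fun t ht j hj => ?_, fun t ht j hj => ?_, fun t ht j hj => ?_,
    fun t _ => S.u_bdry t, fun t _ => S.v_bdry t, fun t ht j hj => S.θ_nonneg hh N.zero ht hj,
    fun t _ => S.energy_eq t⟩, iu, iv, iθ⟩
  · simpa [hκ t ht] using S.du t j hj
  · simpa [hκ t ht] using S.dv t j hj
  · simpa [hκ t ht] using S.dθ t j hj

variable {n : ℕ} {h : ℝ}

/-- Discrete Gagliardo–Nirenberg inequality for nonnegative functions of bounded mass. -/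
lemma sup_le_of_mass (hh : 0 < h) {θ : ℕ → ℝ} (hθ : ∀ j ≤ n, 0 ≤ θ j) {E δ : ℝ} (hE : 0 ≤ E)
    (hmass : ip n h θ (fun _ => 1) ≤ E) (hδ : 0 < δ) {j : ℕ} (hj : j ≤ n) :
    θ j ≤ δ * √(ip n h (bwd n h θ) (bwd n h θ))
      + (2 * E / ((n + 1) * h) + 9 * E / δ ^ 2) := by
  obtain ⟨i, hi, hmax⟩ := Finset.exists_max_image (Finset.range (n + 1)) θ ⟨0, by simp⟩
  have hi' : i ≤ n := by simpa [Nat.lt_succ_iff] using hi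
  refine (hmax j (by simpa [Nat.lt_succ_iff] using hj)).trans ?_
  set m := θ i with hm
  set L : ℝ := (n + 1) * h with hL
  have hLpos : 0 < L := by positivity
  set s := √(ip n h (bwd n h θ) (bwd n h θ)) with hs
  have hs0 : 0 ≤ s := Real.sqrt_nonneg _
  have hC : 0 ≤ 2 * E / L + 9 * E / δ ^ 2 := by positivity
  rcases le_or_gt m (δ * s) with hc | hc
  · linarith
  have hm0 : 0 < m := lt_of_le_of_lt (by positivity) hc
  have hP : ip n h θ θ ≤ m * E := by
    have : ip n h θ θ ≤ ip n h (fun j => m * θ j) (fun _ => 1) := by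
      refine ip_mono hh fun j hj => ?_
      rw [mul_one]
      exact mul_le_mul_of_nonneg_right (hmax j (by simpa [Nat.lt_succ_iff] using hj)) (hθ j hj)
    rw [ip_const_mul_left] at this
    exact this.trans (mul_le_mul_of_nonneg_left hmass hm0.le)
  have hag := agmon hh θ hi'
  rw [← hL, ← hs, ← hm] at hag
  have h1 : m ^ 2 ≤ m * E / L + 3 * √(m * E) * s := by
    refine hag.trans ?_
    gcongr
  have h2 : s ≤ m / δ := by rw [le_div_iff₀ hδ]; linarith
  have h3 : m ^ 2 ≤ m * E / L + 3 * √(m * E) * (m / δ) := by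
    refine h1.trans ?_
    gcongr
  have h4 : m ≤ E / L + 3 * √(m * E) / δ := by
    have : m * m ≤ m * (E / L + 3 * √(m * E) / δ) := by
      have e : m * (E / L + 3 * √(m * E) / δ) = m * E / L + 3 * √(m * E) * (m / δ) := by ring
      rw [e, ← pow_two]; exact h3
    exact le_of_mul_le_mul_left this hm0
  have h5 : 3 * √(m * E) / δ ≤ m / 2 + 9 * E / δ ^ 2 / 2 := by
    rw [Real.sqrt_mul hm0.le]
    have a1 := Real.sq_sqrt hm0.le
    have a2 := Real.sq_sqrt hE
    have a3 := sq_nonneg (√m - 3 * √E / δ)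
    have a4 : (√m - 3 * √E / δ) ^ 2 = √m ^ 2 - 2 * (3 * (√m * √E) / δ) + 9 * √E ^ 2 / δ ^ 2 := by
      field_simp
      ring
    rw [a4, a1, a2] at a3
    linarith
  have h6 : 2 * E / L = 2 * (E / L) := by ring
  have h7 : 0 ≤ δ * s := by positivity
  linarith

lemma ip_mul_le (hh : 0 < h) {p q r : ℕ → ℝ} {m : ℝ} (hm : 0 ≤ m)
    (hp : ∀ j ≤ n, |p j| ≤ m * |q j|) :
    |ip n h p r| ≤ m * (√(ip n h q q) * √(ip n h r r)) := by
  refine (abs_ip_le_ip_abs hh p r).trans ?_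
  have : ip n h (fun j => |p j|) (fun j => |r j|)
      ≤ ip n h (fun j => m * |q j|) (fun j => |r j|) :=
    ip_mono hh fun j hj => mul_le_mul_of_nonneg_right (hp j hj) (abs_nonneg _)
  refine this.trans ?_
  rw [ip_const_mul_left]
  exact mul_le_mul_of_nonneg_left (ip_abs_le hh q r) hm

/-- Dissipation estimate for the squared norm of the temperature. -/
lemma DSol.deriv_sq_le (hh : 0 < h) {M : ℝ} {g g' : ℝ → ℝ} (N : Nonlin M g g')
    {u v θ : ℝ → ℕ → ℝ} (S : DSol n h g u v θ) {E : ℝ}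
    (hE : energy n h (u 0) (v 0) (θ 0) ≤ E) {L : ℝ} (hL : (n + 1) * h = L) {t : ℝ} (ht : 0 ≤ t) :
    ∃ d, HasDerivAt (fun s => ip n h (θ s) (θ s)) d t ∧
      d ≤ - ip n h (bwd n h (θ t)) (bwd n h (θ t))
        + (4 * M * √(2 * E) * (2 * E / L + 9 * E / (1 / (2 * (4 * M * √(2 * E) + 1))) ^ 2)) ^ 2
          / 2 := by
  have hd := hasDerivAt_ip (n := n) (h := h) (S.dθ t ht) (S.dθ t ht)
  refine ⟨_, hd, ?_⟩
  set q := bwd n h (θ t) with hq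
  set G := ip n h q q with hG
  have hG0 : 0 ≤ G := ip_self_nonneg hh q
  have hθ := S.nonneg t ht
  have hv := S.vb t ht
  have hen := (S.energy_eq t ht).trans_le hE
  unfold energy at hen
  have n1 := ip_self_nonneg (n := n) hh (v t)
  have n2 := ip_self_nonneg (n := n) hh (fwd h (u t))
  have n3 := ip_one_nonneg hh hθ
  have hE0 : 0 ≤ E := by linarith
  set β := 4 * M * √(2 * E) with hβ
  have hM := N.M_nonneg
  have hβ0 : 0 ≤ β := by positivity
  set δ := 1 / (2 * (β + 1)) with hδ
  have hδ0 : 0 < δ := by positivity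
  set C := 2 * E / L + 9 * E / δ ^ 2 with hC
  have hL0 : 0 < L := by rw [← hL]; positivity
  have hC0 : 0 ≤ C := by positivity
  have hsup : ∀ j ≤ n, θ t j ≤ δ * √G + C := fun j hj => by
    have := sup_le_of_mass hh hθ hE0 (by linarith) hδ0 hj
    rwa [hL] at this
  set m := δ * √G + C with hm
  have hm0 : 0 ≤ m := by positivity
  have e1 := ip_fwd (n := n) (h := h) (θ t) q (by simp [hq]) (by simp [hq])
  have e2 := ip_fwd (n := n) (h := h) (fun j => θ t j * g (θ t j)) (v t) hv.1 hv.2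
  have e3 : ip n h (θ t) (fun j => g (θ t j) * fwd h (v t) j)
      = ip n h (fun j => θ t j * g (θ t j)) (fwd h (v t)) := by
    unfold ip; simp only [mul_assoc]
  rw [ip_comm, ip_sub_right, e3, e1, e2, ← hG]
  have hb : ∀ j ≤ n, |bwd n h (fun j => θ t j * g (θ t j)) j| ≤ (2 * M * m) * |q j| := by
    intro j hj
    rw [hq, bwd_of_le hj, bwd_of_le hj, abs_div, abs_div, ← mul_div_assoc]
    have hj1 : j - 1 ≤ n := by omega
    have : θ t j * g (θ t j) - θ t (j - 1) * g (θ t (j - 1))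
        = θ t j * (g (θ t j) - g (θ t (j - 1))) + (θ t j - θ t (j - 1)) * g (θ t (j - 1)) := by
      ring
    rw [this]
    gcongr
    refine (abs_add_le _ _).trans ?_
    rw [abs_mul, abs_mul, abs_of_nonneg (hθ j hj)]
    have a1 : θ t j * |g (θ t j) - g (θ t (j - 1))| ≤ m * (M * |θ t j - θ t (j - 1)|) :=
      mul_le_mul (hsup j hj) (N.lip _ _) (abs_nonneg _) hm0
    have a2 : |g (θ t (j - 1))| ≤ M * m := (N.abs_le (hθ _ hj1)).trans (by
      gcongr; exact hsup _ hj1)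
    have a3 := mul_le_mul_of_nonneg_left a2 (abs_nonneg (θ t j - θ t (j - 1)))
    nlinarith
  have hI := (le_abs_self _).trans (ip_mul_le (r := v t) hh (by positivity) hb)
  have hV : √(ip n h (v t) (v t)) ≤ √(2 * E) := Real.sqrt_le_sqrt (by linarith)
  have hsq := Real.sq_sqrt hG0
  rw [← hG] at hI
  set s := √G with hs
  have hs0 : 0 ≤ s := Real.sqrt_nonneg _
  have hI2 : ip n h (bwd n h fun j => θ t j * g (θ t j)) (v t) ≤ 2 * M * m * (s * √(2 * E)) := by
    refine hI.trans ?_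
    gcongr
  have hI3 : 2 * (2 * M * m * (s * √(2 * E))) = β * δ * G + β * C * s := by
    rw [hm, hβ, ← hsq]; ring
  have hβδ : β * δ ≤ 1 / 2 := by
    rw [hδ, mul_one_div, div_le_iff₀ (by positivity)]; linarith
  have y1 : β * δ * G ≤ 1 / 2 * G := by gcongr
  have y2 : β * C * s ≤ G / 2 + (β * C) ^ 2 / 2 := by
    rw [← hsq]; nlinarith [sq_nonneg (β * C - s)]
  linarith

end

section

/-- Second-order discrete energy. -/
def energy2 (n : ℕ) (h : ℝ) (u v θ : ℕ → ℝ) : ℝ :=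
  ip n h (fwd h v) (fwd h v) / 2 + ip n h (bwd n h (fwd h u)) (bwd n h (fwd h u)) / 2
    + ip n h (bwd n h θ) (bwd n h θ) / 2

variable {n : ℕ} {h : ℝ}

lemma energy2_nonneg (hh : 0 < h) (u v θ : ℕ → ℝ) : 0 ≤ energy2 n h u v θ := by
  have h1 := ip_self_nonneg (n := n) hh (fwd h v)
  have h2 := ip_self_nonneg (n := n) hh (bwd n h (fwd h u))
  have h3 := ip_self_nonneg (n := n) hh (bwd n h θ)
  unfold energy2
  positivity

lemma fwd_bwd_eq {j : ℕ} (hj : j ≤ n) (w : ℕ → ℝ) :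
    fwd h (bwd n h w) j = (w (min (j + 1) n) - 2 * w j + w (j - 1)) / h / h := by
  unfold fwd bwd
  rw [min_eq_left hj, Nat.add_sub_cancel]
  ring

/-- Pointwise bound of the second difference of `g ∘ θ`. -/
lemma Nonlin.abs_fwd_bwd_le {M : ℝ} {g g' : ℝ → ℝ} (N : Nonlin M g g') (hh : 0 < h)
    {θ : ℕ → ℝ} (hθ : ∀ j ≤ n, 0 ≤ θ j) {j : ℕ} (hj : j ≤ n) :
    |fwd h (bwd n h fun i => g (θ i)) j|
      ≤ M * |fwd h (bwd n h θ) j| + M * (bwd n h θ (j + 1) ^ 2 + bwd n h θ j ^ 2) := by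
  have hz := hθ (min (j + 1) n) (min_le_right _ _)
  have hx := hθ (j - 1) (by omega)
  have hy := hθ j hj
  rw [fwd_bwd_eq hj, fwd_bwd_eq hj]
  have e1 : bwd n h θ (j + 1) = (θ (min (j + 1) n) - θ j) / h := by
    simp [bwd]
  have e2 : bwd n h θ j = (θ (j - 1) - θ j) / h * (-1) := by
    rw [bwd_of_le hj]; ring
  rw [e1, e2]
  set x := θ (j - 1)
  set y := θ j
  set z := θ (min (j + 1) n)
  have t1 := N.taylor y z hy hz
  have t2 := N.taylor y x hy hx
  have s := N.slope y hy
  have key : |g z - 2 * g y + g x| ≤ M * |z - 2 * y + x| + M * ((z - y) ^ 2 + (x - y) ^ 2) := by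
    have : g z - 2 * g y + g x = g' y * (z - 2 * y + x)
        + ((g z - g y - g' y * (z - y)) + (g x - g y - g' y * (x - y))) := by ring
    rw [this]
    refine (abs_add_le _ _).trans (add_le_add ?_ ((abs_add_le _ _).trans (by linarith)))
    rw [abs_mul]
    gcongr
  rw [div_div, div_div, abs_div, abs_div, abs_of_pos (mul_pos hh hh)]
  have hh2 : 0 < h * h := mul_pos hh hh
  have : M * (|z - 2 * y + x| / (h * h)) + M * (((z - y) / h) ^ 2 + ((x - y) / h * (-1)) ^ 2)
      = (M * |z - 2 * y + x| + M * ((z - y) ^ 2 + (x - y) ^ 2)) / (h * h) := by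
    field_simp
  rw [this]
  gcongr

lemma ip_mul_bound_left (hh : 0 < h) {p r : ℕ → ℝ} {m : ℝ} (hm : 0 ≤ m)
    (hp : ∀ j ≤ n, |p j| ≤ m) (q : ℕ → ℝ) :
    |ip n h (fun j => p j * q j) r| ≤ m * (√(ip n h q q) * √(ip n h r r)) :=
  ip_mul_le hh hm fun j hj => by
    rw [abs_mul]; exact mul_le_mul_of_nonneg_right (hp j hj) (abs_nonneg _)

lemma young_aux {M C L G K W : ℝ} (hL : 0 ≤ L) (hG : 0 ≤ G) (hK : 0 ≤ K) (hW : 0 ≤ W) :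
    M * (√K * √W) + 2 * (M * (√L * √W * (√K * √G))) + M * (√G + C) * (√K * √W) - W
      ≤ (3 / 2 * M ^ 2 * (1 + 2 * C ^ 2) + 3 / 2 * M ^ 2 * (4 * L + 2) * G) * (K / 2) := by
  have sK := Real.sq_sqrt hK
  have sW := Real.sq_sqrt hW
  have sG := Real.sq_sqrt hG
  have sL := Real.sq_sqrt hL
  generalize √K = k at *
  generalize √W = ω at *
  generalize √G = γ at *
  generalize √L = l at *
  subst sK sW sG sL
  set X := M * (1 + 2 * l * γ + (γ + C)) with hX
  have i1 : M * (k * ω) + 2 * (M * (l * ω * (k * γ))) + M * (γ + C) * (k * ω) = X * k * ω := by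
    rw [hX]; ring
  rw [i1]
  have i2 : X ^ 2 ≤ 3 * M ^ 2 * (1 + 4 * l ^ 2 * γ ^ 2 + (2 * γ ^ 2 + 2 * C ^ 2)) := by
    have r1 : (1 + 2 * l * γ + (γ + C)) ^ 2
        ≤ 3 * (1 + 4 * l ^ 2 * γ ^ 2 + (2 * γ ^ 2 + 2 * C ^ 2)) := by
      nlinarith [sq_nonneg (1 - 2 * l * γ), sq_nonneg (1 - (γ + C)),
        sq_nonneg (2 * l * γ - (γ + C)), sq_nonneg (γ - C)]
    have := mul_le_mul_of_nonneg_left r1 (sq_nonneg M)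
    rw [hX, mul_pow]
    linarith
  have i3 : X * k * ω - ω ^ 2 ≤ X ^ 2 * k ^ 2 / 4 := by nlinarith [sq_nonneg (X * k / 2 - ω)]
  have i4 := mul_le_mul_of_nonneg_right i2 (sq_nonneg k)
  linarith

/-- Growth estimate for the second-order energy. -/
lemma DSol.deriv_energy2_le (hh : 0 < h) {M : ℝ} {g g' : ℝ → ℝ} (N : Nonlin M g g')
    {u v θ : ℝ → ℕ → ℝ} (S : DSol n h g u v θ) {E : ℝ}
    (hE : energy n h (u 0) (v 0) (θ 0) ≤ E) {L : ℝ} (hL : (n + 1) * h = L) {t : ℝ} (ht : 0 ≤ t) :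
    ∃ d, HasDerivAt (fun s => energy2 n h (u s) (v s) (θ s)) d t ∧
      d ≤ (3 / 2 * M ^ 2 * (1 + 2 * (2 * E / L + 9 * E) ^ 2)
        + 3 / 2 * M ^ 2 * (4 * L + 2) * ip n h (bwd n h (θ t)) (bwd n h (θ t)))
        * energy2 n h (u t) (v t) (θ t) := by
  set p := bwd n h (fun i => g (θ t i)) with hp
  set q := bwd n h (θ t) with hq
  set w := fwd h (v t) with hw
  set z := bwd n h (fwd h (u t)) with hz
  have d1 : ∀ j ≤ n, HasDerivAt (fun s => fwd h (v s) j) (fwd h (fun i => z i - p i) j) t :=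
    fun j hj => hasDerivAt_fwd (w' := fun i => z i - p i) (S.dv t ht j (by omega))
      (S.dv t ht (j + 1) (by omega))
  have d2 : ∀ j ≤ n, HasDerivAt (fun s => bwd n h (fwd h (u s)) j) (bwd n h w j) t :=
    fun j hj => hasDerivAt_bwd (fun i hi => hasDerivAt_fwd (S.du t ht i (by omega))
      (S.du t ht (i + 1) (by omega))) (by omega)
  have d3 : ∀ j ≤ n, HasDerivAt (fun s => bwd n h (θ s) j)
      (bwd n h (fun i => fwd h q i - g (θ t i) * w i) j) t :=
    fun j hj => hasDerivAt_bwd (S.dθ t ht) (by omega)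
  have D := (((hasDerivAt_ip (n := n) (h := h) d1 d1).div_const 2).add
    ((hasDerivAt_ip (n := n) (h := h) d2 d2).div_const 2)).add
    ((hasDerivAt_ip (n := n) (h := h) d3 d3).div_const 2)
  refine ⟨_, D, ?_⟩
  have z0 : z 0 - p 0 = 0 := by simp [hz, hp]
  have zn : z (n + 1) - p (n + 1) = 0 := by simp [hz, hp]
  have b1 := ip_fwd (n := n) (h := h) w (fun i => z i - p i) z0 zn
  have b2 := ip_fwd (n := n) (h := h) w p (by simp [hp]) (by simp [hp])
  have b3 := ip_fwd (n := n) (h := h) (fun i => fwd h q i - g (θ t i) * w i) q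
    (by simp [hq]) (by simp [hq])
  rw [ip_sub_right] at b1
  rw [ip_sub_left] at b3
  rw [ip_comm _ (fwd h (v t)), ip_comm _ (bwd n h (fwd h (u t))), ip_comm (bwd n h (θ t)),
    ← hw, ← hz, b1]
  change _ / 2 + _ / 2 + (ip n h (bwd n h fun i => fwd h q i - g (θ t i) * w i) q
    + ip n h (bwd n h fun i => fwd h q i - g (θ t i) * w i) q) / 2 ≤ _
  have b4 : ip n h z (bwd n h w) = ip n h (bwd n h w) z := ip_comm _ _
  have hθ := S.nonneg t ht
  have hen := (S.energy_eq t ht).trans_le hE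
  unfold energy at hen
  have n1 := ip_self_nonneg (n := n) hh (v t)
  have n2 := ip_self_nonneg (n := n) hh (fwd h (u t))
  have n3 := ip_one_nonneg hh hθ
  have hE0 : 0 ≤ E := by linarith
  have hM := N.M_nonneg
  have hL0 : 0 < L := by rw [← hL]; positivity
  set C := 2 * E / L + 9 * E with hC
  have hC0 : 0 ≤ C := by positivity
  set G := ip n h q q with hG
  have hG0 : 0 ≤ G := ip_self_nonneg hh q
  set W := ip n h (fwd h q) (fwd h q) with hW
  have hW0 : 0 ≤ W := ip_self_nonneg hh _
  set K := ip n h w w with hK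
  have hK0 : 0 ≤ K := ip_self_nonneg hh _
  have hsup : ∀ j ≤ n, θ t j ≤ √G + C := fun j hj => by
    have := sup_le_of_mass hh hθ hE0 (by linarith) one_pos hj
    rw [hL] at this
    simpa [hC] using this
  set m := √G + C with hm
  have hm0 : 0 ≤ m := by positivity
  have T2 : |ip n h (fun i => g (θ t i) * w i) (fwd h q)| ≤ M * m * (√K * √W) := by
    refine ip_mul_bound_left hh (by positivity) (fun j hj => ?_) w
    exact (N.abs_le (hθ j hj)).trans (mul_le_mul_of_nonneg_left (hsup j hj) hM)
  have hqs : ∀ j ≤ n + 1, |q j| ≤ √(L * W) := fun j hj => by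
    refine Real.abs_le_sqrt ?_
    have := sq_le_fwd (n := n) hh q (by simp [hq]) hj
    rwa [hL] at this
  set Q := √(L * W) with hQ
  have hQ0 : 0 ≤ Q := Real.sqrt_nonneg _
  have T1 : |ip n h w (fwd h p)| ≤ M * (√K * √W) + 2 * (M * (Q * (√K * √G))) := by
    refine (abs_ip_le_ip_abs hh _ _).trans ?_
    have c1 : ip n h (fun j => |w j|) (fun j => |fwd h p j|)
        ≤ ip n h (fun j => |w j|) (fun j => M * |fwd h q j|
          + (M * (Q * |q (j + 1)|) + M * (Q * |q j|))) := by
      refine ip_mono hh fun j hj => mul_le_mul_of_nonneg_left ?_ (abs_nonneg _)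
      have := N.abs_fwd_bwd_le hh hθ hj
      refine this.trans ?_
      rw [← hq]
      have a1 := mul_le_mul_of_nonneg_right (hqs j (by omega)) (abs_nonneg (q j))
      have a2 := mul_le_mul_of_nonneg_right (hqs (j + 1) (by omega)) (abs_nonneg (q (j + 1)))
      rw [abs_mul_abs_self] at a1 a2
      have a3 : q (j + 1) ^ 2 + q j ^ 2 ≤ Q * |q (j + 1)| + Q * |q j| := by nlinarith
      have a4 := mul_le_mul_of_nonneg_left a3 hM
      linarith
    refine c1.trans ?_
    rw [ip_add_right, ip_add_right]
    simp only [ip_const_mul_right]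
    have f1 := ip_abs_le (n := n) hh w (fwd h q)
    have f2 := ip_abs_le (n := n) hh w (fun j => q (j + 1))
    have f3 := ip_abs_le (n := n) hh w q
    have f4 : √(ip n h (fun j => q (j + 1)) (fun j => q (j + 1))) ≤ √G :=
      Real.sqrt_le_sqrt (ip_shift_le hh q (by simp [hq]))
    have f5 := f2.trans (mul_le_mul_of_nonneg_left f4 (Real.sqrt_nonneg _))
    have g1 := mul_le_mul_of_nonneg_left f1 hM
    have g2 := mul_le_mul_of_nonneg_left (mul_le_mul_of_nonneg_left f5 hQ0) hM
    have g3 := mul_le_mul_of_nonneg_left (mul_le_mul_of_nonneg_left f3 hQ0) hM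
    linarith
  have hen2 : K ≤ 2 * energy2 n h (u t) (v t) (θ t) := by
    have k2 := ip_self_nonneg (n := n) hh (bwd n h (fwd h (u t)))
    have k3 := ip_self_nonneg (n := n) hh (bwd n h (θ t))
    unfold energy2
    linarith
  have hQs : Q = √L * √W := Real.sqrt_mul hL0.le W
  have A1 := abs_le.1 T1
  have A2 := abs_le.1 T2
  have main : M * (√K * √W) + 2 * (M * (Q * (√K * √G))) + M * m * (√K * √W) - W
      ≤ (3 / 2 * M ^ 2 * (1 + 2 * C ^ 2) + 3 / 2 * M ^ 2 * (4 * L + 2) * G) * (K / 2) := by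
    rw [hQs, hm]
    exact young_aux hL0.le hG0 hK0 hW0
  have hcoef : 0 ≤ 3 / 2 * M ^ 2 * (1 + 2 * C ^ 2) + 3 / 2 * M ^ 2 * (4 * L + 2) * G := by
    positivity
  have fin := mul_le_mul_of_nonneg_left (show K / 2 ≤ energy2 n h (u t) (v t) (θ t) by linarith)
    hcoef
  rw [b4]
  rw [b2] at A1
  rw [ip_comm] at b3
  have b5 : ip n h (fun i => g (θ t i) * w i) (fwd h q) = ip n h (fwd h q) fun i => g (θ t i) * w i :=
    ip_comm _ _
  linarith [A1.1, A1.2, A2.1, A2.2]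

end

section

variable {n : ℕ} {h : ℝ}

lemma ip_sub_self_le (hh : 0 < h) (p q : ℕ → ℝ) :
    ip n h (fun j => p j - q j) (fun j => p j - q j) ≤ 2 * ip n h p p + 2 * ip n h q q := by
  have := ip_self_nonneg (n := n) hh (fun j => p j + q j)
  simp only [ip_sub_left, ip_sub_right, ip_add_left, ip_add_right] at *
  have := ip_comm (n := n) (h := h) p q
  linarith

lemma bwd_sub (p q : ℕ → ℝ) :
    bwd n h (fun j => p j - q j) = fun j => bwd n h p j - bwd n h q j := by
  funext j
  unfold bwd
  ring

lemma ip_bwd_le_fwd (hh : 0 < h) (p : ℕ → ℝ) :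
    ip n h (bwd n h p) (bwd n h p) ≤ ip n h (fwd h p) (fwd h p) := by
  unfold ip
  refine mul_le_mul_of_nonneg_left ?_ hh.le
  rw [Finset.sum_range_succ', Finset.sum_range_succ, bwd_zero, mul_zero]
  have : ∑ k ∈ Finset.range n, bwd n h p (k + 1) * bwd n h p (k + 1)
      = ∑ k ∈ Finset.range n, fwd h p k * fwd h p k := by
    refine Finset.sum_congr rfl fun k hk => ?_
    rw [bwd_of_le (by simpa using hk)]
    rfl
  rw [this]
  have := mul_self_nonneg (fwd h p n)
  linarith

/-- Uniform bounds of a time dependent cell function on `[0, T]`: a sup bound, a gradient bound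
and a Hölder bound in time. -/
structure UnifBdd (n : ℕ) (h T C : ℝ) (w : ℝ → ℕ → ℝ) : Prop where
  sup : ∀ t ∈ Icc 0 T, ∀ j ≤ n, |w t j| ≤ C
  grad : ∀ t ∈ Icc 0 T, ip n h (bwd n h (w t)) (bwd n h (w t)) ≤ C
  time : ∀ s ∈ Icc 0 T, ∀ t ∈ Icc 0 T, ∀ j ≤ n, (w t j - w s j) ^ 2 ≤ C * √|t - s|

lemma unifBdd_of_deriv (hh : 0 < h) {L T A B K : ℝ} (hL : (n + 1) * h = L) (hA : 0 ≤ A)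
    (hB : 0 ≤ B) (hK : 0 ≤ K) {w w' : ℝ → ℕ → ℝ}
    (hsup : ∀ t ∈ Icc 0 T, ∀ j ≤ n, |w t j| ≤ A)
    (hgrad : ∀ t ∈ Icc 0 T, ip n h (bwd n h (w t)) (bwd n h (w t)) ≤ B)
    (hd : ∀ t ∈ Icc 0 T, ∀ j ≤ n, HasDerivAt (fun s => w s j) (w' t j) t)
    (hw : ∀ τ ∈ Icc 0 T, ∀ s ∈ Icc 0 T, ∀ t ∈ Icc 0 T,
      |ip n h (w' τ) (fun j => w t j - w s j)| ≤ K) :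
    UnifBdd n h T (A + B + (K * √T / L + 3 * √K * √(4 * B))) w := by
  have hL0 : 0 < L := by rw [← hL]; positivity
  have hR : 0 ≤ K * √T / L + 3 * √K * √(4 * B) := by positivity
  refine ⟨fun t ht j hj => by linarith [hsup t ht j hj], fun t ht => by linarith [hgrad t ht],
    fun s hs t ht j hj => ?_⟩
  have key : ip n h (fun j => w t j - w s j) (fun j => w t j - w s j) ≤ K * |t - s| := by
    have hder : ∀ τ ∈ Icc 0 T, HasDerivWithinAt (fun r => ip n h (w r) (fun j => w t j - w s j))
        (ip n h (w' τ) (fun j => w t j - w s j)) (Icc 0 T) τ := fun τ hτ => by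
      have := hasDerivAt_ip (n := n) (h := h) (p := w) (q := fun _ j => w t j - w s j)
        (p' := w' τ) (q' := fun _ => 0) (t := τ) (hd τ hτ) (fun j _ => hasDerivAt_const _ _)
      have h0 : ip n h (w τ) (fun _ => 0) = 0 := by simp [ip]
      rw [h0, add_zero] at this
      exact this.hasDerivWithinAt
    have := (convex_Icc (0 : ℝ) T).norm_image_sub_le_of_norm_hasDerivWithin_le hder
      (fun τ hτ => hw τ hτ s hs t ht) hs ht
    rw [Real.norm_eq_abs, ← ip_sub_left] at this
    exact (le_abs_self _).trans this
  have hag := agmon hh (fun j => w t j - w s j) hj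
  rw [hL, bwd_sub] at hag
  have hg : ip n h (fun j => bwd n h (w t) j - bwd n h (w s) j)
      (fun j => bwd n h (w t) j - bwd n h (w s) j) ≤ 4 * B :=
    (ip_sub_self_le hh _ _).trans (by linarith [hgrad t ht, hgrad s hs])
  have hts : |t - s| ≤ √T * √|t - s| := by
    have h1 : |t - s| ≤ T := by
      rw [abs_le]; constructor <;> linarith [ht.1, ht.2, hs.1, hs.2]
    calc |t - s| = √|t - s| * √|t - s| := (Real.mul_self_sqrt (abs_nonneg _)).symm
      _ ≤ _ := mul_le_mul_of_nonneg_right (Real.sqrt_le_sqrt h1) (Real.sqrt_nonneg _)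
  refine hag.trans ?_
  have hsK : √(ip n h (fun j => w t j - w s j) (fun j => w t j - w s j)) ≤ √K * √|t - s| := by
    rw [← Real.sqrt_mul hK]; exact Real.sqrt_le_sqrt key
  have e1 : ip n h (fun j => w t j - w s j) (fun j => w t j - w s j) / L
      ≤ K * √T / L * √|t - s| := by
    rw [div_mul_eq_mul_div]
    refine div_le_div_of_nonneg_right (key.trans ?_) hL0.le
    rw [mul_assoc]
    exact mul_le_mul_of_nonneg_left hts hK
  have e2 : 3 * √(ip n h (fun j => w t j - w s j) (fun j => w t j - w s j)) *
      √(ip n h (fun j => bwd n h (w t) j - bwd n h (w s) j)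
        (fun j => bwd n h (w t) j - bwd n h (w s) j)) ≤ 3 * √K * √(4 * B) * √|t - s| := by
    have := mul_le_mul hsK (Real.sqrt_le_sqrt hg) (Real.sqrt_nonneg _) (by positivity)
    linarith
  have e3 : 0 ≤ (A + B) * √|t - s| := by positivity
  linarith

/-- Gronwall argument for the second-order energy. -/
lemma DSol.energy2_le (hh : 0 < h) {M : ℝ} {g g' : ℝ → ℝ} (N : Nonlin M g g')
    {u v θ : ℝ → ℕ → ℝ} (S : DSol n h g u v θ) {E Y : ℝ}
    (hE : energy n h (u 0) (v 0) (θ 0) ≤ E) (hY : energy2 n h (u 0) (v 0) (θ 0) ≤ Y)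
    {L : ℝ} (hL : (n + 1) * h = L) {t T : ℝ} (ht : 0 ≤ t) (htT : t ≤ T) :
    energy2 n h (u t) (v t) (θ t) ≤ Y *
      Real.exp (3 / 2 * M ^ 2 * (4 * L + 2) * (L * (√(2 * Y) + 2 * E / L + 9 * E) ^ 2) +
      (3 / 2 * M ^ 2 * (1 + 2 * (2 * E / L + 9 * E) ^ 2) + 3 / 2 * M ^ 2 * (4 * L + 2) *
        ((4 * M * √(2 * E) * (2 * E / L + 9 * E / (1 / (2 * (4 * M * √(2 * E) + 1))) ^ 2)) ^ 2
          / 2)) * T) := by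
  have hL0 : 0 < L := by rw [← hL]; positivity
  set c1 := 3 / 2 * M ^ 2 * (1 + 2 * (2 * E / L + 9 * E) ^ 2) with hc1
  set c2 := 3 / 2 * M ^ 2 * (4 * L + 2) with hc2
  set c3 := (4 * M * √(2 * E) * (2 * E / L + 9 * E / (1 / (2 * (4 * M * √(2 * E) + 1))) ^ 2)) ^ 2
    / 2 with hc3
  have c1p : 0 ≤ c1 := by positivity
  have c2p : 0 ≤ c2 := by positivity
  have c3p : 0 ≤ c3 := by positivity
  set D := fun s => ip n h (θ s) (θ s) with hD
  set Z := fun s => energy2 n h (u s) (v s) (θ s) with hZ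
  have hder : ∀ s, 0 ≤ s → ∃ d, HasDerivAt
      (fun s => Z s * Real.exp (c2 * D s - (c1 + c2 * c3) * s)) d s ∧ d ≤ 0 := by
    intro s hs
    obtain ⟨d1, hd1, hd1'⟩ := S.deriv_energy2_le hh N hE hL hs
    obtain ⟨d2, hd2, hd2'⟩ := S.deriv_sq_le hh N hE hL hs
    rw [← hc3] at hd2'
    rw [← hc1, ← hc2] at hd1'
    have hx := hd1.mul (((hd2.const_mul c2).sub ((hasDerivAt_id s).const_mul (c1 + c2 * c3))).exp)
    refine ⟨_, hx, ?_⟩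
    have hZ0 : 0 ≤ energy2 n h (u s) (v s) (θ s) := energy2_nonneg hh _ _ _
    have a1 := mul_le_mul_of_nonneg_left hd2' c2p
    have a2 := mul_le_mul_of_nonneg_left a1 hZ0
    simp only [Pi.sub_apply, id]
    set e := Real.exp (c2 * ip n h (θ s) (θ s) - (c1 + c2 * c3) * s)
    have he : 0 ≤ e := (Real.exp_pos _).le
    have : d1 * e + energy2 n h (u s) (v s) (θ s) * (e * (c2 * d2 - (c1 + c2 * c3) * 1))
      = (d1 + energy2 n h (u s) (v s) (θ s) * (c2 * d2 - (c1 + c2 * c3))) * e := by ring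
    refine this.trans_le (mul_nonpos_of_nonpos_of_nonneg ?_ he)
    linarith
  have hanti : AntitoneOn (fun s => Z s * Real.exp (c2 * D s - (c1 + c2 * c3) * s)) (Ici 0) := by
    refine antitoneOn_of_deriv_nonpos (convex_Ici 0) (fun s hs => ?_) (fun s hs => ?_)
      (fun s hs => ?_)
    · obtain ⟨d, hd, -⟩ := hder s hs
      exact hd.continuousAt.continuousWithinAt
    · rw [interior_Ici] at hs
      obtain ⟨d, hd, -⟩ := hder s (le_of_lt hs)
      exact hd.differentiableAt.differentiableWithinAt
    · rw [interior_Ici] at hs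
      obtain ⟨d, hd, hd'⟩ := hder s (le_of_lt hs)
      rwa [hd.deriv]
  have h0 := hanti (mem_Ici.2 le_rfl) (mem_Ici.2 ht) ht
  simp only [mul_zero, sub_zero] at h0
  have hZ0 : 0 ≤ Z 0 := energy2_nonneg hh _ _ _
  have hZt : 0 ≤ Z t := energy2_nonneg hh _ _ _
  have hDt : 0 ≤ D t := ip_self_nonneg hh _
  have hD0 : D 0 ≤ L * (√(2 * Y) + 2 * E / L + 9 * E) ^ 2 := by
    have hen := (S.energy_eq 0 le_rfl).trans_le hE
    unfold energy at hen
    have n1 := ip_self_nonneg (n := n) hh (v 0)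
    have n2 := ip_self_nonneg (n := n) hh (fwd h (u 0))
    have n3 := ip_one_nonneg hh (S.nonneg 0 le_rfl)
    have hE0 : 0 ≤ E := by linarith
    have hq : ip n h (bwd n h (θ 0)) (bwd n h (θ 0)) ≤ 2 * Y := by
      unfold energy2 at hY
      have k1 := ip_self_nonneg (n := n) hh (fwd h (v 0))
      have k2 := ip_self_nonneg (n := n) hh (bwd n h (fwd h (u 0)))
      linarith
    have := ip_self_le_of_abs_le (n := n) hh (p := θ 0) (C := √(2 * Y) + 2 * E / L + 9 * E)
      fun j hj => by
        rw [abs_of_nonneg (S.nonneg 0 le_rfl j hj)]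
        have := sup_le_of_mass hh (S.nonneg 0 le_rfl) hE0 (by linarith) one_pos hj
        rw [hL] at this
        have h4 := Real.sqrt_le_sqrt hq
        norm_num at this
        linarith
    rwa [hL] at this
  have hY0 : 0 ≤ Y := hZ0.trans hY
  have : Z t * Real.exp (-((c1 + c2 * c3) * T)) ≤ Y * Real.exp (c2 *
      (L * (√(2 * Y) + 2 * E / L + 9 * E) ^ 2)) := by
    calc _ ≤ Z t * Real.exp (c2 * D t - (c1 + c2 * c3) * t) := by
          refine mul_le_mul_of_nonneg_left (Real.exp_le_exp.2 ?_) hZt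
          have b1 : 0 ≤ c2 * D t := by positivity
          have b2 : (c1 + c2 * c3) * t ≤ (c1 + c2 * c3) * T :=
            mul_le_mul_of_nonneg_left htT (by positivity)
          linarith
      _ ≤ _ := h0
      _ ≤ _ := mul_le_mul hY (Real.exp_le_exp.2 (mul_le_mul_of_nonneg_left hD0 c2p))
          (Real.exp_pos _).le hY0
  rw [Real.exp_add, ← mul_assoc]
  have e1 := mul_le_mul_of_nonneg_right this (Real.exp_pos ((c1 + c2 * c3) * T)).le
  rwa [mul_assoc (Z t), ← Real.exp_add, neg_add_cancel, Real.exp_zero, mul_one] at e1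

end

section

variable {n : ℕ} {h : ℝ}

lemma abs_ip_le_of_le (hh : 0 < h) {p q : ℕ → ℝ} {A B : ℝ} (hp : ip n h p p ≤ A)
    (hq : ip n h q q ≤ B) : |ip n h p q| ≤ √A * √B :=
  (abs_ip_le hh p q).trans (mul_le_mul (Real.sqrt_le_sqrt hp) (Real.sqrt_le_sqrt hq)
    (Real.sqrt_nonneg _) (Real.sqrt_nonneg _))

lemma ip_sub_self_le_of_abs_le (hh : 0 < h) {w w' : ℕ → ℝ} {A L : ℝ} (hL : (n + 1) * h = L)
    (hw : ∀ j ≤ n, |w j| ≤ A) (hw' : ∀ j ≤ n, |w' j| ≤ A) :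
    ip n h (fun j => w j - w' j) (fun j => w j - w' j) ≤ 4 * (L * A ^ 2) := by
  have h1 := ip_self_le_of_abs_le hh hw
  have h2 := ip_self_le_of_abs_le hh hw'
  rw [hL] at h1 h2
  linarith [ip_sub_self_le (n := n) hh w w']

lemma Nonlin.ip_bwd_le {M : ℝ} {g g' : ℝ → ℝ} (N : Nonlin M g g') (hh : 0 < h) (w : ℕ → ℝ) :
    ip n h (bwd n h fun i => g (w i)) (bwd n h fun i => g (w i))
      ≤ M ^ 2 * ip n h (bwd n h w) (bwd n h w) := by
  have : ip n h (bwd n h fun i => g (w i)) (bwd n h fun i => g (w i))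
      ≤ ip n h (fun j => M * bwd n h w j) (fun j => M * bwd n h w j) := by
    refine ip_mono hh fun j _ => ?_
    have h1 : |bwd n h (fun i => g (w i)) j| ≤ |M * bwd n h w j| := by
      unfold bwd
      rw [← mul_div_assoc, abs_div, abs_div, abs_mul, abs_of_nonneg N.M_nonneg]
      exact div_le_div_of_nonneg_right (N.lip _ _) (abs_nonneg _)
    have := sq_le_sq.2 h1
    nlinarith
  refine this.trans_eq ?_
  rw [ip_const_mul_left, ip_const_mul_right]
  ring

/-- A priori bounds that are uniform in the mesh size. -/
lemma uniform_bounds {M L E Y T : ℝ} (hM : 0 ≤ M) (hL0 : 0 < L) (hE0 : 0 ≤ E) (hY0 : 0 ≤ Y) :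
    ∃ C, 0 ≤ C ∧ ∀ (n : ℕ) (h : ℝ) (g g' : ℝ → ℝ) (u v θ : ℝ → ℕ → ℝ), 0 < h →
      (n + 1) * h = L → Nonlin M g g' → DSol n h g u v θ →
      energy n h (u 0) (v 0) (θ 0) ≤ E → energy2 n h (u 0) (v 0) (θ 0) ≤ Y →
      UnifBdd n h T C u ∧ UnifBdd n h T C v ∧ UnifBdd n h T C (fun t => fwd h (u t)) ∧
        UnifBdd n h T C θ := by
  obtain ⟨B, hB⟩ : ∃ B, B = 2 * (Y *
      Real.exp (3 / 2 * M ^ 2 * (4 * L + 2) * (L * (√(2 * Y) + 2 * E / L + 9 * E) ^ 2) +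
      (3 / 2 * M ^ 2 * (1 + 2 * (2 * E / L + 9 * E) ^ 2) + 3 / 2 * M ^ 2 * (4 * L + 2) *
        ((4 * M * √(2 * E) * (2 * E / L + 9 * E / (1 / (2 * (4 * M * √(2 * E) + 1))) ^ 2)) ^ 2
          / 2)) * T)) := ⟨_, rfl⟩
  have hB0 : 0 ≤ B := by rw [hB]; positivity
  obtain ⟨A, hA0, hA1, hA2, hA3, hA4⟩ : ∃ A, 0 ≤ A ∧ √(L * (2 * E)) ≤ A ∧ √(L * B) ≤ A ∧
      √(2 * E / L + 3 * √(2 * E) * √B) ≤ A ∧ √B + 2 * E / L + 9 * E ≤ A := by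
    refine ⟨√(L * (2 * E)) + √(L * B) + √(2 * E / L + 3 * √(2 * E) * √B)
      + (√B + 2 * E / L + 9 * E), ?_, ?_, ?_, ?_, ?_⟩
    · positivity
    all_goals
      have h1 := Real.sqrt_nonneg (L * (2 * E))
      have h2 := Real.sqrt_nonneg (L * B)
      have h3 := Real.sqrt_nonneg (2 * E / L + 3 * √(2 * E) * √B)
      have h4 : 0 ≤ √B + 2 * E / L + 9 * E := by positivity
      linarith
  set B' := B + 2 * E with hB'
  have hB'0 : 0 ≤ B' := by positivity
  set P := √(4 * (L * A ^ 2)) with hP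
  have hP0 : 0 ≤ P := Real.sqrt_nonneg _
  set K := √(L * A ^ 2) * P + (√B * P + √(M ^ 2 * B) * P)
    + (√(4 * B) * √B + M * A * (√B * P)) + √B * P with hK
  have k1 : 0 ≤ √(L * A ^ 2) * P := by positivity
  have k2 : 0 ≤ √B * P + √(M ^ 2 * B) * P := by positivity
  have k3 : 0 ≤ √(4 * B) * √B + M * A * (√B * P) := by positivity
  have k4 : 0 ≤ √B * P := by positivity
  have hK0 : 0 ≤ K := by positivity
  refine ⟨A + B' + (K * √T / L + 3 * √K * √(4 * B')), by positivity, ?_⟩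
  intro n h g g' u v θ hh hL N S hE hY
  have hY2 : ∀ t ∈ Icc 0 T, 2 * energy2 n h (u t) (v t) (θ t) ≤ B := fun t ht => by
    rw [hB]
    linarith [S.energy2_le hh N hE hY hL ht.1 ht.2]
  have fv : ∀ t ∈ Icc 0 T, ip n h (fwd h (v t)) (fwd h (v t)) ≤ B ∧
      ip n h (bwd n h (fwd h (u t))) (bwd n h (fwd h (u t))) ≤ B ∧
      ip n h (bwd n h (θ t)) (bwd n h (θ t)) ≤ B := fun t ht => by
    have := hY2 t ht
    have h1 := ip_self_nonneg (n := n) hh (fwd h (v t))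
    have h2 := ip_self_nonneg (n := n) hh (bwd n h (fwd h (u t)))
    have h3 := ip_self_nonneg (n := n) hh (bwd n h (θ t))
    unfold energy2 at this
    refine ⟨?_, ?_, ?_⟩ <;> linarith
  have en : ∀ t ∈ Icc 0 T, ip n h (v t) (v t) ≤ 2 * E ∧
      ip n h (fwd h (u t)) (fwd h (u t)) ≤ 2 * E ∧ ip n h (θ t) (fun _ => 1) ≤ E :=
      fun t ht => by
    have hen := (S.energy_eq t ht.1).trans_le hE
    unfold energy at hen
    have n1 := ip_self_nonneg (n := n) hh (v t)
    have n2 := ip_self_nonneg (n := n) hh (fwd h (u t))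
    have n3 := ip_one_nonneg hh (S.nonneg t ht.1)
    refine ⟨?_, ?_, ?_⟩ <;> linarith
  have su : ∀ t ∈ Icc 0 T, ∀ j ≤ n, |u t j| ≤ A := fun t ht j hj => by
    have := sq_le_fwd (n := n) hh (u t) (S.ub t ht.1).1 (show j ≤ n + 1 by omega)
    rw [hL] at this
    exact (Real.abs_le_sqrt (this.trans (mul_le_mul_of_nonneg_left (en t ht).2.1 hL0.le))).trans hA1
  have sv : ∀ t ∈ Icc 0 T, ∀ j ≤ n, |v t j| ≤ A := fun t ht j hj => by
    have := sq_le_fwd (n := n) hh (v t) (S.vb t ht.1).1 (show j ≤ n + 1 by omega)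
    rw [hL] at this
    exact (Real.abs_le_sqrt (this.trans (mul_le_mul_of_nonneg_left (fv t ht).1 hL0.le))).trans hA2
  have sf : ∀ t ∈ Icc 0 T, ∀ j ≤ n, |fwd h (u t) j| ≤ A := fun t ht j hj => by
    have := agmon hh (fwd h (u t)) hj
    rw [hL] at this
    refine (Real.abs_le_sqrt (this.trans (add_le_add (div_le_div_of_nonneg_right (en t ht).2.1
      hL0.le) ?_))).trans hA3
    exact mul_le_mul (mul_le_mul_of_nonneg_left (Real.sqrt_le_sqrt (en t ht).2.1) (by norm_num))
      (Real.sqrt_le_sqrt (fv t ht).2.1) (Real.sqrt_nonneg _) (by positivity)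
  have sθ : ∀ t ∈ Icc 0 T, ∀ j ≤ n, |θ t j| ≤ A := fun t ht j hj => by
    rw [abs_of_nonneg (S.nonneg t ht.1 j hj)]
    have := sup_le_of_mass hh (S.nonneg t ht.1) hE0 (en t ht).2.2 one_pos hj
    rw [hL] at this
    have h4 := Real.sqrt_le_sqrt (fv t ht).2.2
    norm_num at this
    linarith
  have hBB : B ≤ B' := by linarith
  refine ⟨?_, ?_, ?_, ?_⟩
  · refine unifBdd_of_deriv hh hL hA0 hB'0 hK0 (w' := v) su (fun t ht => ?_)
      (fun t ht j hj => S.du t ht.1 j (by omega)) (fun τ hτ s hs t ht => ?_)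
    · linarith [ip_bwd_le_fwd (n := n) hh (u t), (en t ht).2.1]
    · have h1 := ip_self_le_of_abs_le hh (sv τ hτ)
      rw [hL] at h1
      have := abs_ip_le_of_le hh h1 (ip_sub_self_le_of_abs_le hh hL (su t ht) (su s hs))
      linarith
  · refine unifBdd_of_deriv hh hL hA0 hB'0 hK0 (w' := fun t j =>
      bwd n h (fwd h (u t)) j - bwd n h (fun i => g (θ t i)) j) sv (fun t ht => ?_)
      (fun t ht j hj => S.dv t ht.1 j (by omega)) (fun τ hτ s hs t ht => ?_)
    · linarith [ip_bwd_le_fwd (n := n) hh (v t), (fv t ht).1]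
    · rw [ip_sub_left]
      have h2 := ip_sub_self_le_of_abs_le hh hL (sv t ht) (sv s hs)
      have h3 := abs_ip_le_of_le hh (fv τ hτ).2.1 h2
      have h4 := abs_ip_le_of_le hh ((N.ip_bwd_le hh (θ τ)).trans
        (mul_le_mul_of_nonneg_left (fv τ hτ).2.2 (sq_nonneg M))) h2
      have h5 := abs_sub (ip n h (bwd n h (fwd h (u τ))) (fun j => v t j - v s j))
        (ip n h (bwd n h fun i => g (θ τ i)) (fun j => v t j - v s j))
      linarith
  · refine unifBdd_of_deriv hh hL hA0 hB'0 hK0 (w' := fun t => fwd h (v t)) sf (fun t ht => ?_)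
      (fun t ht j hj => hasDerivAt_fwd (S.du t ht.1 j (by omega)) (S.du t ht.1 (j + 1) (by omega)))
      (fun τ hτ s hs t ht => ?_)
    · linarith [(fv t ht).2.1]
    · have h2 := ip_sub_self_le_of_abs_le hh hL (sf t ht) (sf s hs)
      have h3 := abs_ip_le_of_le hh (fv τ hτ).1 h2
      linarith
  · refine unifBdd_of_deriv hh hL hA0 hB'0 hK0 (w' := fun t j =>
      fwd h (bwd n h (θ t)) j - g (θ t j) * fwd h (v t) j) sθ (fun t ht => ?_)
      (fun t ht j hj => S.dθ t ht.1 j hj) (fun τ hτ s hs t ht => ?_)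
    · linarith [(fv t ht).2.2]
    · rw [ip_sub_left]
      have h2 := ip_sub_self_le_of_abs_le hh hL (sθ t ht) (sθ s hs)
      have h3 : |ip n h (fwd h (bwd n h (θ τ))) (fun j => θ t j - θ s j)| ≤ √(4 * B) * √B := by
        rw [ip_comm, ip_fwd _ _ (by simp) (by simp), abs_neg, bwd_sub]
        refine abs_ip_le_of_le hh ?_ (fv τ hτ).2.2
        exact (ip_sub_self_le hh _ _).trans (by linarith [(fv t ht).2.2, (fv s hs).2.2])
      have h4 : |ip n h (fun j => g (θ τ j) * fwd h (v τ) j) (fun j => θ t j - θ s j)|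
          ≤ M * A * (√B * P) := by
        refine (ip_mul_le hh (q := fwd h (v τ)) (m := M * A) (by positivity)
          fun j hj => ?_).trans (mul_le_mul_of_nonneg_left (mul_le_mul
            (Real.sqrt_le_sqrt (fv τ hτ).1) (Real.sqrt_le_sqrt h2) (Real.sqrt_nonneg _)
            (Real.sqrt_nonneg _)) (by positivity))
        rw [abs_mul]
        refine mul_le_mul_of_nonneg_right ?_ (abs_nonneg _)
        have hp := S.nonneg τ hτ.1 j hj
        refine (N.abs_le hp).trans (mul_le_mul_of_nonneg_left ?_ hM)
        exact (le_abs_self _).trans (sθ τ hτ j hj)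
      have h5 := abs_sub (ip n h (fwd h (bwd n h (θ τ))) (fun j => θ t j - θ s j))
        (ip n h (fun j => g (θ τ j) * fwd h (v τ) j) (fun j => θ t j - θ s j))
      linarith

end

section

variable {n : ℕ} {h : ℝ}

lemma exists_bound_of_compact_support {w : ℝ → ℝ} (hw : Continuous w) {K : Set ℝ}
    (hK : IsCompact K) (h0 : ∀ x, x ∉ K → w x = 0) : ∃ C, 0 ≤ C ∧ ∀ x, |w x| ≤ C := by
  obtain ⟨C, hC⟩ := hK.exists_bound_of_continuousOn hw.continuousOn
  refine ⟨max C 0, le_max_right _ _, fun x => ?_⟩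
  by_cases hx : x ∈ K
  · exact (hC x hx).trans (le_max_left _ _)
  · rw [h0 x hx, abs_zero]; exact le_max_right _ _

lemma deriv_eq_zero_of_notMem {w : ℝ → ℝ} {K : Set ℝ} (hK : IsCompact K)
    (h0 : ∀ x, x ∉ K → w x = 0) : ∀ x, x ∉ K → deriv w x = 0 := by
  intro x hx
  have : w =ᶠ[nhds x] fun _ => 0 := by
    filter_upwards [hK.isClosed.isOpen_compl.mem_nhds hx] with y hy using h0 y hy
  rw [this.deriv_eq, deriv_const]

lemma abs_sub_le_of_abs_deriv_le {w : ℝ → ℝ} (hw : Differentiable ℝ w) {C : ℝ}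
    (hC : ∀ x, |deriv w x| ≤ C) (x y : ℝ) : |w y - w x| ≤ C * |y - x| :=
  convex_univ.norm_image_sub_le_of_norm_deriv_le (fun z _ => hw z) (fun z _ => hC z)
    (mem_univ x) (mem_univ y)

/-- The derivative bounds carried by the smooth data. -/
lemma smooth_bounds {a b : ℝ} {v0 u0 Θ0 : ℝ → ℝ} (D : SmoothData a b v0 u0 Θ0) :
    ∃ C, 0 ≤ C ∧ (∀ x, |v0 x| ≤ C) ∧ (∀ x ∈ Icc a b, |Θ0 x| ≤ C) ∧
      (∀ x y, |v0 y - v0 x| ≤ C * |y - x|) ∧ (∀ x y, |u0 y - u0 x| ≤ C * |y - x|) ∧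
      (∀ x y, |Θ0 y - Θ0 x| ≤ C * |y - x|) ∧
      (∀ x k, |(u0 (x + k) - u0 x) - (u0 x - u0 (x - k))| ≤ C * |k| * |k|) := by
  obtain ⟨K1, hK1, -, hv⟩ := D.v0_supp
  obtain ⟨K2, hK2, -, hu⟩ := D.u0_supp
  obtain ⟨K3, hK3, -, hθ⟩ := D.Θ0x_supp
  have du : ContDiff ℝ (⊤ : ℕ∞) (deriv u0) :=
    (contDiff_infty_iff_deriv.1 D.u0_smooth).2
  have ddu : ContDiff ℝ (⊤ : ℕ∞) (deriv (deriv u0)) := (contDiff_infty_iff_deriv.1 du).2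
  have dv : ContDiff ℝ (⊤ : ℕ∞) (deriv v0) := (contDiff_infty_iff_deriv.1 D.v0_smooth).2
  have dθ : ContDiff ℝ (⊤ : ℕ∞) (deriv Θ0) := (contDiff_infty_iff_deriv.1 D.Θ0_smooth).2
  obtain ⟨C1, c1, h1⟩ := exists_bound_of_compact_support D.v0_smooth.continuous hK1 hv
  obtain ⟨C2, h2⟩ := isCompact_Icc.exists_bound_of_continuousOn
    (D.Θ0_smooth.continuous.continuousOn (s := Icc a b))
  obtain ⟨C3, c3, h3⟩ := exists_bound_of_compact_support dv.continuous hK1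
    (deriv_eq_zero_of_notMem hK1 hv)
  obtain ⟨C4, c4, h4⟩ := exists_bound_of_compact_support du.continuous hK2
    (deriv_eq_zero_of_notMem hK2 hu)
  obtain ⟨C5, c5, h5⟩ := exists_bound_of_compact_support dθ.continuous hK3 hθ
  obtain ⟨C6, c6, h6⟩ := exists_bound_of_compact_support ddu.continuous hK2
    (deriv_eq_zero_of_notMem hK2 (deriv_eq_zero_of_notMem hK2 hu))
  have hC2 := le_abs_self C2
  have hC2' := abs_nonneg C2
  have dfu : Differentiable ℝ u0 := D.u0_smooth.differentiable (by simp)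
  have dfdu : Differentiable ℝ (deriv u0) := du.differentiable (by simp)
  refine ⟨C1 + |C2| + C3 + C4 + C5 + C6, by positivity, fun x => ?_, fun x hx => ?_,
    abs_sub_le_of_abs_deriv_le (D.v0_smooth.differentiable (by simp)) fun x => ?_,
    abs_sub_le_of_abs_deriv_le dfu fun x => ?_,
    abs_sub_le_of_abs_deriv_le (D.Θ0_smooth.differentiable (by simp)) fun x => ?_,
    fun x k => ?_⟩
  · linarith [h1 x]
  · have := h2 x hx
    rw [Real.norm_eq_abs] at this
    linarith
  · linarith [h3 x]
  · linarith [h4 x]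
  · linarith [h5 x]
  · have e1 : ∀ y, HasDerivAt (fun y => u0 (y + k) - u0 y) (deriv u0 (y + k) - deriv u0 y) y :=
      fun y => ((dfu (y + k)).hasDerivAt.comp_add_const y k).sub (dfu y).hasDerivAt
    have e2 := abs_sub_le_of_abs_deriv_le (w := fun y => u0 (y + k) - u0 y)
      (fun y => (e1 y).differentiableAt) (C := C6 * |k|) (fun y => by
        rw [(e1 y).deriv]
        have := abs_sub_le_of_abs_deriv_le dfdu h6 y (y + k)
        rwa [add_sub_cancel_left] at this) (x - k) x
    simp only [sub_add_cancel, sub_sub_cancel] at e2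
    refine e2.trans (mul_le_mul_of_nonneg_right (mul_le_mul_of_nonneg_right ?_ (abs_nonneg k))
      (abs_nonneg k))
    linarith

lemma init_energy_le (hh : 0 < h) {L C : ℝ} (hL : (n + 1) * h = L) {u v θ : ℕ → ℝ}
    (h1 : ∀ j ≤ n, |v j| ≤ C) (h2 : ∀ j ≤ n, |fwd h u j| ≤ C) (h3 : ∀ j ≤ n, |θ j| ≤ C)
    (h4 : ∀ j ≤ n, |fwd h v j| ≤ C) (h5 : ∀ j ≤ n, |bwd n h (fwd h u) j| ≤ C)
    (h6 : ∀ j ≤ n, |bwd n h θ j| ≤ C) :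
    energy n h u v θ ≤ L * C ^ 2 + L * C ∧ energy2 n h u v θ ≤ 3 / 2 * (L * C ^ 2) := by
  have a1 := ip_self_le_of_abs_le hh h1
  have a2 := ip_self_le_of_abs_le hh h2
  have a4 := ip_self_le_of_abs_le hh h4
  have a5 := ip_self_le_of_abs_le hh h5
  have a6 := ip_self_le_of_abs_le hh h6
  have a3 : ip n h θ (fun _ => 1) ≤ L * C := by
    have := ip_mono (n := n) hh (p := θ) (q := fun _ => 1) (p' := fun _ => C) (q' := fun _ => 1)
      fun j hj => by simpa using (le_abs_self _).trans (h3 j hj)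
    refine this.trans_eq ?_
    simp [ip, ← hL]
    ring
  rw [hL] at a1 a2 a4 a5 a6
  unfold energy energy2
  constructor <;> linarith

/-- Uniform energy bounds of the discretised data. -/
lemma init_bounds {a b : ℝ} (hab : a < b) {v0 u0 Θ0 : ℝ → ℝ} (D : SmoothData a b v0 u0 Θ0) :
    ∃ E Y, 0 ≤ E ∧ 0 ≤ Y ∧ ∀ (n : ℕ) (h : ℝ), 0 < h → (n + 1) * h = b - a → ∀ u v θ : ℕ → ℝ,
      (∀ j ≤ n + 1, u j = u0 (a + j * h)) → (∀ j ≤ n + 1, v j = v0 (a + j * h)) →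
      (∀ j ≤ n, θ j = Θ0 (a + j * h)) → energy n h u v θ ≤ E ∧ energy2 n h u v θ ≤ Y := by
  obtain ⟨C, hC, b1, b2, b3, b4, b5, b6⟩ := smooth_bounds D
  have hL0 : 0 ≤ b - a := by linarith
  refine ⟨(b - a) * C ^ 2 + (b - a) * C, 3 / 2 * ((b - a) * C ^ 2), by positivity, by positivity,
    fun n h hh hL u v θ hu hv hθ => init_energy_le hh hL (fun j hj => ?_) (fun j hj => ?_)
    (fun j hj => ?_) (fun j hj => ?_) (fun j hj => ?_) (fun j hj => ?_)⟩
  · rw [hv j (by omega)]; exact b1 _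
  · rw [fwd, hu j (by omega), hu (j + 1) (by omega), abs_div, abs_of_pos hh, div_le_iff₀ hh]
    refine (b4 _ _).trans_eq ?_
    push_cast
    rw [show a + (j + 1) * h - (a + j * h) = h by ring, abs_of_pos hh]
  · rw [hθ j hj]
    refine b2 _ ⟨by have : 0 ≤ (j : ℝ) * h := by positivity
                    linarith, ?_⟩
    have : (j : ℝ) * h ≤ (n + 1) * h :=
      mul_le_mul_of_nonneg_right (by exact_mod_cast (by omega : j ≤ n + 1)) hh.le
    linarith
  · rw [fwd, hv j (by omega), hv (j + 1) (by omega), abs_div, abs_of_pos hh, div_le_iff₀ hh]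
    refine (b3 _ _).trans_eq ?_
    push_cast
    rw [show a + (j + 1) * h - (a + j * h) = h by ring, abs_of_pos hh]
  · rcases j with - | j
    · simpa using hC
    rw [bwd_of_le hj, Nat.add_sub_cancel]
    unfold fwd
    rw [hu j (by omega), hu (j + 1) (by omega), hu (j + 1 + 1) (by omega), ← sub_div, div_div,
      abs_div, abs_of_pos (mul_pos hh hh), div_le_iff₀ (mul_pos hh hh)]
    have := b6 (a + (j + 1) * h) h
    rw [abs_of_pos hh, mul_assoc, show a + (j + 1) * h + h = a + (j + 1 + 1) * h by ring,
      show a + (j + 1) * h - h = a + j * h by ring] at this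
    push_cast
    exact this
  · rcases j with - | j
    · simpa using hC
    rw [bwd_of_le hj, Nat.add_sub_cancel, hθ j (by omega), hθ (j + 1) (by omega), abs_div,
      abs_of_pos hh, div_le_iff₀ hh]
    refine (b5 _ _).trans_eq ?_
    push_cast
    rw [show a + (j + 1) * h - (a + j * h) = h by ring, abs_of_pos hh]

/-- The nonlinearity of the problem, extended by zero to the negative reals. -/
lemma HypF.nonlin {f f' f'' : ℝ → ℝ} (H : HypF f f' f'') :
    ∃ M, Nonlin M (fun x => f (max x 0)) f' := by
  obtain ⟨M, hM⟩ := H.bdd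
  have hM0 : 0 ≤ M := (abs_nonneg _).trans (hM 0 (mem_Ici.2 le_rfl)).1
  refine ⟨M, hM0, fun x y => ?_, fun x hx => ?_, fun x hx => (hM x hx).1, fun x y hx hy => ?_⟩
  · have := (convex_Ici (0 : ℝ)).norm_image_sub_le_of_norm_hasDerivWithin_le H.hasDeriv₁
      (fun x hx => (hM x hx).1) (mem_Ici.2 (le_max_right y 0)) (mem_Ici.2 (le_max_right x 0))
    refine this.trans (mul_le_mul_of_nonneg_left ?_ hM0)
    exact (abs_max_sub_max_le_abs x y 0)
  · simp only [max_eq_right hx, H.zero]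
  · simp only [max_eq_left hx, max_eq_left hy]
    have hsub : uIcc x y ⊆ Ici 0 := fun z hz => by
      have := hz.1
      exact (le_min hx hy).trans this
    have lip : ∀ z ∈ uIcc x y, |f' z - f' x| ≤ M * |y - x| := fun z hz => by
      have := (convex_Ici (0 : ℝ)).norm_image_sub_le_of_norm_hasDerivWithin_le H.hasDeriv₂
        (fun x hx => (hM x hx).2) (mem_Ici.2 hx) (hsub hz)
      refine this.trans (mul_le_mul_of_nonneg_left ?_ hM0)
      rw [Real.norm_eq_abs]
      exact abs_sub_left_of_mem_uIcc hz
    have := (convex_uIcc x y).norm_image_sub_le_of_norm_hasDerivWithin_le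
      (f := fun z => f z - f' x * z) (f' := fun z => f' z - f' x)
      (fun z hz => ((H.hasDeriv₁ z (hsub hz)).mono hsub).sub (by
        simpa using (hasDerivWithinAt_id z (uIcc x y)).const_mul (f' x)))
      lip left_mem_uIcc right_mem_uIcc
    rw [Real.norm_eq_abs, Real.norm_eq_abs, mul_assoc, abs_mul_abs_self] at this
    rw [pow_two]
    convert this using 2
    ring

end

section

/-- Arzelà–Ascoli for asymptotically equicontinuous sequences of real functions. -/
lemma exists_subseq_tendsto {X ι : Type*} [PseudoMetricSpace X] [TopologicalSpace.SeparableSpace X]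
    [Nonempty X] [Countable ι] (F : ι → ℕ → X → ℝ)
    (hb : ∀ i x, ∃ C, ∀ k, |F i k x| ≤ C)
    (he : ∀ i x, ∀ ε > 0, ∃ δ > 0, ∃ K, ∀ k ≥ K, ∀ y, dist y x < δ → |F i k y - F i k x| < ε) :
    ∃ σ : ℕ → ℕ, StrictMono σ ∧ ∃ G : ι → X → ℝ, (∀ i, Continuous (G i)) ∧
      ∀ i x, Tendsto (fun k => F i (σ k) x) atTop (nhds (G i x)) := by
  choose C hC using hb
  let D := TopologicalSpace.denseSeq X
  have hD : DenseRange D := TopologicalSpace.denseRange_denseSeq X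
  have hcomp : IsCompact (Set.pi univ fun p : ι × ℕ => Icc (-C p.1 (D p.2)) (C p.1 (D p.2))) :=
    isCompact_univ_pi fun _ => isCompact_Icc
  obtain ⟨z, -, σ, hσ, hz⟩ := hcomp.tendsto_subseq
    (x := fun k (p : ι × ℕ) => F p.1 k (D p.2)) fun k p _ => abs_le.1 (hC _ _ _)
  rw [tendsto_pi_nhds] at hz
  have hlim : ∀ i x, ∃ g, Tendsto (fun k => F i (σ k) x) atTop (nhds g) := by
    intro i x
    refine cauchySeq_tendsto_of_complete (Metric.cauchySeq_iff.2 fun ε hε => ?_)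
    obtain ⟨δ, hδ, K, hK⟩ := he i x (ε / 4) (by positivity)
    obtain ⟨m, hm⟩ := hD.exists_dist_lt x hδ
    have hc := (hz (i, m)).cauchySeq
    obtain ⟨K', hK'⟩ := Metric.cauchySeq_iff.1 hc (ε / 4) (by positivity)
    refine ⟨max K K', fun p hp q hq => ?_⟩
    have h1 := hK (σ p) ((le_max_left _ _).trans (hp.le.trans (hσ.id_le p))) (D m)
      (by rwa [dist_comm])
    have h2 := hK (σ q) ((le_max_left _ _).trans (hq.le.trans (hσ.id_le q))) (D m)
      (by rwa [dist_comm])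
    have h3 := hK' p ((le_max_right _ _).trans hp) q ((le_max_right _ _).trans hq)
    simp only [comp_apply, Real.dist_eq] at h3 ⊢
    rw [abs_lt] at *
    constructor <;> linarith [h1.1, h1.2, h2.1, h2.2, h3.1, h3.2]
  choose G hG using hlim
  refine ⟨σ, hσ, G, fun i => ?_, hG⟩
  refine Metric.continuous_iff.2 fun x ε hε => ?_
  obtain ⟨δ, hδ, K, hK⟩ := he i x (ε / 2) (by positivity)
  refine ⟨δ, hδ, fun y hy => ?_⟩
  have : |G i y - G i x| ≤ ε / 2 := by
    refine le_of_tendsto ((hG i y).sub (hG i x)).abs ?_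
    filter_upwards [eventually_ge_atTop K] with k hk
    exact (hK (σ k) (hk.trans (hσ.id_le k)) y hy).le
  rw [Real.dist_eq]
  linarith

/-- Index of the mesh cell containing `x`. -/
def cell (n : ℕ) (a h x : ℝ) : ℕ := min ⌊(x - a) / h⌋₊ n

variable {n : ℕ} {a h : ℝ}

lemma cell_le (x : ℝ) : cell n a h x ≤ n := min_le_right _ _

lemma measurable_cell : Measurable (cell n a h) := by
  unfold cell
  exact (Nat.measurable_floor.comp ((measurable_id.sub_const a).div_const h)).min measurable_const

lemma cell_eq (hh : 0 < h) {j : ℕ} (hj : j ≤ n) {x : ℝ} (h1 : a + j * h ≤ x)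
    (h2 : x < a + (j + 1) * h) : cell n a h x = j := by
  have : ⌊(x - a) / h⌋₊ = j := by
    rw [Nat.floor_eq_iff (div_nonneg (by have : 0 ≤ (j : ℝ) * h := by positivity
                                         linarith) hh.le), le_div_iff₀ hh, div_lt_iff₀ hh]
    constructor <;> linarith
  rw [cell, this, min_eq_left hj]

lemma abs_cell_sub_le (hh : 0 < h) {x : ℝ} (h1 : a ≤ x) (h2 : x ≤ a + (n + 1) * h) :
    a + cell n a h x * h ≤ x ∧ x ≤ a + (cell n a h x + 1) * h := by
  rcases h2.lt_or_eq with h2 | h2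
  · have hf : ⌊(x - a) / h⌋₊ ≤ n := by
      rw [← Nat.lt_succ_iff, Nat.floor_lt (div_nonneg (by linarith) hh.le), div_lt_iff₀ hh]
      push_cast
      linarith
    rw [cell, min_eq_left hf]
    have e1 := Nat.floor_le (div_nonneg (sub_nonneg.2 h1) hh.le)
    have e2 := (Nat.lt_floor_add_one ((x - a) / h)).le
    rw [le_div_iff₀ hh] at e1
    rw [div_le_iff₀ hh] at e2
    constructor <;> linarith
  · have : (x - a) / h = ((n + 1 : ℕ) : ℝ) := by
      rw [h2]
      push_cast
      field_simp
      ring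
    rw [cell, this, Nat.floor_natCast, min_eq_right (by omega)]
    subst h2
    refine ⟨?_, le_rfl⟩
    nlinarith

lemma cell_sub_le (hh : 0 < h) {x y : ℝ} (hxy : x ≤ y) :
    cell n a h x ≤ cell n a h y ∧
      h * ((cell n a h y : ℝ) - cell n a h x) ≤ y - x + h := by
  have mono : ⌊(x - a) / h⌋₊ ≤ ⌊(y - a) / h⌋₊ :=
    Nat.floor_le_floor (div_le_div_of_nonneg_right (by linarith) hh.le)
  refine ⟨min_le_min_right _ mono, ?_⟩
  have hxf := (Nat.lt_floor_add_one ((x - a) / h)).le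
  have hyx : (y - a) / h = (x - a) / h + (y - x) / h := by ring
  have key : (⌊(y - a) / h⌋₊ : ℝ) ≤ ⌊(x - a) / h⌋₊ + ((y - x) / h + 1) := by
    have h0 : 0 ≤ (y - x) / h := div_nonneg (by linarith) hh.le
    rcases le_or_gt 0 ((y - a) / h) with hy | hy
    · linarith [Nat.floor_le hy]
    · rw [Nat.floor_of_nonpos hy.le]
      push_cast
      positivity
  have key2 : (cell n a h y : ℝ) - cell n a h x ≤ (y - x) / h + 1 := by
    unfold cell
    have h0 : 0 ≤ (y - x) / h := div_nonneg (by linarith) hh.le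
    rcases le_total ⌊(x - a) / h⌋₊ n with hx | hx
    · rw [min_eq_left hx]
      have : ((min ⌊(y - a) / h⌋₊ n : ℕ) : ℝ) ≤ ⌊(y - a) / h⌋₊ := by
        exact_mod_cast min_le_left _ _
      linarith
    · rw [min_eq_right hx, min_eq_right (hx.trans mono)]
      linarith
  have := mul_le_mul_of_nonneg_left key2 hh.le
  have e : h * ((y - x) / h + 1) = y - x + h := by field_simp
  linarith

lemma measurable_comp_cell (p : ℕ → ℝ) : Measurable (fun x => p (cell n a h x)) :=
  (measurable_from_nat (f := p)).comp measurable_cell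

lemma abs_comp_cell_le (p : ℕ → ℝ) (x : ℝ) :
    |p (cell n a h x)| ≤ ∑ j ∈ Finset.range (n + 1), |p j| :=
  Finset.single_le_sum (f := fun j => |p j|) (fun _ _ => abs_nonneg _)
    (Finset.mem_range.2 (Nat.lt_succ_of_le (cell_le x)))

lemma intervalIntegrable_comp_cell (p : ℕ → ℝ) (x y : ℝ) :
    IntervalIntegrable (fun x => p (cell n a h x)) volume x y := by
  rw [intervalIntegrable_iff]
  refine Measure.integrableOn_of_bounded (M := ∑ j ∈ Finset.range (n + 1), |p j|) (by simp)
    (measurable_comp_cell p).aestronglyMeasurable (Eventually.of_forall fun x => ?_)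
  exact abs_comp_cell_le p x

lemma integral_comp_cell (hh : 0 < h) (p : ℕ → ℝ) {k : ℕ} (hk : k ≤ n + 1) :
    ∫ x in a..a + k * h, p (cell n a h x) = h * ∑ j ∈ Finset.range k, p j := by
  induction k with
  | zero => simp
  | succ k ih =>
    rw [Finset.sum_range_succ, mul_add, ← ih (by omega),
      ← intervalIntegral.integral_add_adjacent_intervals (b := a + k * h)
        (intervalIntegrable_comp_cell _ _ _) (intervalIntegrable_comp_cell _ _ _)]
    congr 1
    have : ∫ x in a + k * h..a + (k + 1 : ℕ) * h, p (cell n a h x)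
        = ∫ _ in a + k * h..a + (k + 1 : ℕ) * h, p k := by
      refine intervalIntegral.integral_congr_Ioo_of_le (by push_cast; nlinarith) fun x hx => ?_
      push_cast at hx
      simp only [cell_eq hh (show k ≤ n by omega) hx.1.le hx.2]
    rw [this, intervalIntegral.integral_const, smul_eq_mul]
    push_cast
    ring

lemma ip_eq_integral (hh : 0 < h) {b : ℝ} (hL : (n + 1) * h = b - a) (p q : ℕ → ℝ) :
    ip n h p q = ∫ x in Ioo a b, p (cell n a h x) * q (cell n a h x) := by
  have := integral_comp_cell (n := n) (a := a) hh (fun j => p j * q j) le_rfl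
  push_cast at this
  rw [hL, add_sub_cancel] at this
  have hab : a ≤ b := by
    have : 0 ≤ (n + 1) * h := by positivity
    linarith
  rw [ip, ← this, intervalIntegral.integral_of_le hab, integral_Ioc_eq_integral_Ioo]

end

section

lemma exists_weak_subseq {E : Type*} [NormedAddCommGroup E] [InnerProductSpace ℝ E]
    [CompleteSpace E] [TopologicalSpace.SeparableSpace E] {x : ℕ → E} {r : ℝ}
    (hx : ∀ k, ‖x k‖ ≤ r) : ∃ y : E, ‖y‖ ≤ r ∧ ∃ σ : ℕ → ℕ, StrictMono σ ∧
      ∀ z, Tendsto (fun k => inner ℝ (x (σ k)) z) atTop (nhds (inner ℝ y z)) := by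
  have hc := WeakDual.isSeqCompact_closedBall ℝ E (0 : StrongDual ℝ E) r
  obtain ⟨ℓ, hℓ, σ, hσ, hlim⟩ := hc
    (x := fun k => StrongDual.toWeakDual (InnerProductSpace.toDual ℝ E (x k))) fun k => by
      simpa using hx k
  refine ⟨(InnerProductSpace.toDual ℝ E).symm (WeakDual.toStrongDual ℓ), by simpa using hℓ,
    σ, hσ, fun z => ?_⟩
  have := ((WeakDual.eval_continuous z).tendsto ℓ).comp hlim
  rw [InnerProductSpace.toDual_symm_apply]
  exact this

lemma inner_toLp {μ : Measure ℝ} {f g : ℝ → ℝ} (hf : MemLp f 2 μ) (hg : MemLp g 2 μ) :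
    inner ℝ (hf.toLp f) (hg.toLp g) = ∫ x, f x * g x ∂μ := by
  rw [L2.inner_def]
  refine integral_congr_ae ?_
  filter_upwards [hf.coeFn_toLp, hg.coeFn_toLp] with x h1 h2
  rw [h1, h2]
  simp [mul_comm]

lemma norm_toLp_sq {μ : Measure ℝ} {f : ℝ → ℝ} (hf : MemLp f 2 μ) :
    ‖hf.toLp f‖ ^ 2 = ∫ x, f x ^ 2 ∂μ := by
  rw [← real_inner_self_eq_norm_sq, inner_toLp]
  simp only [pow_two]

lemma memLp_of_abs_le {μ : Measure ℝ} [IsFiniteMeasure μ] {f : ℝ → ℝ} {C : ℝ}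
    (hm : AEStronglyMeasurable f μ) (hC : ∀ᵐ x ∂μ, |f x| ≤ C) : MemLp f 2 μ :=
  MemLp.of_bound hm C hC

/-- A bounded sequence in `L²` whose primitives converge pointwise converges weakly to the
derivative of the limit of the primitives. -/
lemma weak_limit {a b : ℝ} (hab : a < b) {g : ℕ → ℝ → ℝ} {C : ℝ}
    (hm : ∀ k, Measurable (g k)) (hbd : ∀ k, ∃ B, ∀ x, |g k x| ≤ B)
    (hC : ∀ k, ∫ x in Ioo a b, g k x ^ 2 ≤ C) {P : ℝ → ℝ}
    (hP : ∀ x ∈ Icc a b, Tendsto (fun k => ∫ y in a..x, g k y) atTop (nhds (P x - P a))) :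
    MemLp (deriv P) 2 (volume.restrict (Ioo a b)) ∧ (∫ x in Ioo a b, deriv P x ^ 2 ≤ C) ∧
      ∀ (H : ℕ → ℝ → ℝ) (H₀ : ℝ → ℝ) (B : ℝ), (∀ k, Measurable (H k)) →
        (∀ k x, x ∈ Ioo a b → |H k x| ≤ B) →
        (∀ x ∈ Ioo a b, Tendsto (fun k => H k x) atTop (nhds (H₀ x))) →
        Tendsto (fun k => ∫ x in Ioo a b, g k x * H k x) atTop
          (nhds (∫ x in Ioo a b, deriv P x * H₀ x)) := by
  set μ := volume.restrict (Ioo a b) with hμ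
  have gL : ∀ k, MemLp (g k) 2 μ := fun k => by
    obtain ⟨B, hB⟩ := hbd k
    exact memLp_of_abs_le (hm k).aestronglyMeasurable (Eventually.of_forall hB)
  set γ : ℕ → Lp ℝ 2 μ := fun k => (gL k).toLp (g k) with hγ
  have hγC : ∀ k, ‖γ k‖ ≤ √C := fun k => by
    refine Real.le_sqrt_of_sq_le ?_
    rw [hγ, norm_toLp_sq]
    exact hC k
  have : Fact ((2 : ENNReal) ≠ ⊤) := ⟨by norm_num⟩
  have sub : ∀ ns : ℕ → ℕ, Tendsto ns atTop atTop → ∃ y : Lp ℝ 2 μ, ‖y‖ ≤ √C ∧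
      (y =ᵐ[μ] deriv P) ∧ ∃ σ : ℕ → ℕ, StrictMono σ ∧
        ∀ z, Tendsto (fun k => inner ℝ (γ (ns (σ k))) z) atTop (nhds (inner ℝ y z)) := by
    intro ns hns
    obtain ⟨y, hy, σ, hσ, hlim⟩ := exists_weak_subseq (x := fun k => γ (ns k))
      (fun k => hγC (ns k))
    refine ⟨y, hy, ?_, σ, hσ, hlim⟩
    have yint : IntervalIntegrable y volume a b := by
      rw [intervalIntegrable_iff_integrableOn_Ioo_of_le hab.le]
      exact (Lp.memLp y).integrable one_le_two
    have prim : ∀ x ∈ Ioo a b, ∫ s in a..x, y s = P x - P a := by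
      intro x hx
      have hI : MemLp (indicator (Ioo a x) fun _ => (1 : ℝ)) 2 μ :=
        memLp_of_abs_le ((measurable_const.indicator measurableSet_Ioo).aestronglyMeasurable)
          (C := 1) (Eventually.of_forall fun s => by
            by_cases hs : s ∈ Ioo a x <;> simp [hs])
      have key : ∀ f : ℝ → ℝ, ∫ s, f s * indicator (Ioo a x) (fun _ => (1 : ℝ)) s ∂μ
          = ∫ s in a..x, f s := by
        intro f
        have : (fun s => f s * indicator (Ioo a x) (fun _ => (1 : ℝ)) s)
            = indicator (Ioo a x) f := by
          funext s
          by_cases hs : s ∈ Ioo a x <;> simp [hs]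
        rw [this, integral_indicator measurableSet_Ioo, hμ,
          Measure.restrict_restrict measurableSet_Ioo,
          inter_eq_self_of_subset_left (Ioo_subset_Ioo_right hx.2.le),
          intervalIntegral.integral_of_le hx.1.le, integral_Ioc_eq_integral_Ioo]
      have h1 := hlim (hI.toLp _)
      have h2 : inner ℝ y (hI.toLp _) = ∫ s in a..x, y s := by
        rw [← key, ← inner_toLp (Lp.memLp y) hI, Lp.toLp_coeFn]
      have h3 : ∀ k, inner ℝ (γ (ns (σ k))) (hI.toLp _) = ∫ s in a..x, g (ns (σ k)) s := fun k => by
        rw [hγ, inner_toLp, key]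
      simp only [h2, h3] at h1
      exact tendsto_nhds_unique h1
        ((hP x ⟨hx.1.le, hx.2.le⟩).comp (hns.comp hσ.tendsto_atTop))
    refine (ae_restrict_iff' measurableSet_Ioo).2 ?_
    filter_upwards [yint.ae_hasDerivAt_integral] with x hx hxab
    have h1 := hx (by rw [uIcc_of_le hab.le]; exact ⟨hxab.1.le, hxab.2.le⟩) a left_mem_uIcc
    have h2 : HasDerivAt P (y x) x := by
      refine ((h1.add_const (P a))).congr_of_eventuallyEq ?_
      filter_upwards [isOpen_Ioo.mem_nhds hxab] with s hs
      rw [prim s hs]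
      ring
    exact h2.deriv.symm
  obtain ⟨y, hy, hyP, -⟩ := sub id tendsto_id
  have PL : MemLp (deriv P) 2 μ := (memLp_congr_ae hyP).1 (Lp.memLp y)
  have uniq : ∀ y : Lp ℝ 2 μ, (y =ᵐ[μ] deriv P) → y = PL.toLp _ := fun y hy =>
    Lp.ext (hy.trans PL.coeFn_toLp.symm)
  refine ⟨PL, ?_, ?_⟩
  · have h0 : 0 ≤ C := (integral_nonneg fun x => sq_nonneg _).trans (hC 0)
    rw [← norm_toLp_sq PL, ← uniq y hyP]
    exact (pow_le_pow_left₀ (norm_nonneg _) hy 2).trans_eq (Real.sq_sqrt h0)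
  · intro H H₀ B hHm hHB hHlim
    have HL : ∀ k, MemLp (H k) 2 μ := fun k => memLp_of_abs_le (hHm k).aestronglyMeasurable (C := B)
      ((ae_restrict_iff' measurableSet_Ioo).2 (Eventually.of_forall fun x hx => hHB k x hx))
    have H₀m : AEStronglyMeasurable H₀ μ := aestronglyMeasurable_of_tendsto_ae atTop
      (fun k => (hHm k).aestronglyMeasurable)
      ((ae_restrict_iff' measurableSet_Ioo).2 (Eventually.of_forall hHlim))
    have H₀B : ∀ x ∈ Ioo a b, |H₀ x| ≤ B := fun x hx =>
      le_of_tendsto (hHlim x hx).abs (Eventually.of_forall fun k => hHB k x hx)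
    have H₀L : MemLp H₀ 2 μ := memLp_of_abs_le H₀m (C := B)
      ((ae_restrict_iff' measurableSet_Ioo).2 (Eventually.of_forall H₀B))
    have hstrong : Tendsto (fun k => ‖(HL k).toLp _ - H₀L.toLp _‖) atTop (nhds 0) := by
      have hsq : ∀ k, ‖(HL k).toLp _ - H₀L.toLp _‖ ^ 2 = ∫ x, (H k x - H₀ x) ^ 2 ∂μ := fun k => by
        rw [← MemLp.toLp_sub, norm_toLp_sq]
        rfl
      have : Tendsto (fun k => ∫ x, (H k x - H₀ x) ^ 2 ∂μ) atTop (nhds (∫ _, (0 : ℝ) ∂μ)) := by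
        refine tendsto_integral_of_dominated_convergence (fun _ => (2 * B) ^ 2)
          (fun k => (((hHm k).aestronglyMeasurable).sub H₀m).pow 2) (integrable_const _)
          (fun k => ?_) ?_
        · refine (ae_restrict_iff' measurableSet_Ioo).2 (Eventually.of_forall fun x hx => ?_)
          rw [Real.norm_eq_abs, abs_pow]
          refine pow_le_pow_left₀ (abs_nonneg _) ?_ 2
          linarith [abs_sub (H k x) (H₀ x), hHB k x hx, H₀B x hx]
        · refine (ae_restrict_iff' measurableSet_Ioo).2 (Eventually.of_forall fun x hx => ?_)
          have := ((hHlim x hx).sub_const (H₀ x)).pow 2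
          simpa using this
      rw [integral_zero] at this
      have h2 := this.sqrt
      rw [Real.sqrt_zero] at h2
      refine h2.congr fun k => ?_
      rw [← hsq, Real.sqrt_sq (norm_nonneg _)]
    refine tendsto_of_subseq_tendsto fun ns hns => ?_
    obtain ⟨y, -, hyP, σ, hσ, hlim⟩ := sub ns hns
    refine ⟨σ, ?_⟩
    rw [uniq y hyP] at hlim
    have h1 := hlim (H₀L.toLp _)
    rw [inner_toLp] at h1
    have h2 : Tendsto (fun k => inner ℝ (γ (ns (σ k)))
        ((HL (ns (σ k))).toLp _ - H₀L.toLp _)) atTop (nhds 0) := by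
      have h3 := ((hstrong.comp (hns.comp hσ.tendsto_atTop)).const_mul (√C))
      rw [mul_zero] at h3
      refine squeeze_zero_norm (fun k => ?_) h3
      exact (norm_inner_le_norm _ _).trans (mul_le_mul_of_nonneg_right (hγC _) (norm_nonneg _))
    have h4 := h1.add h2
    rw [add_zero] at h4
    refine h4.congr fun k => ?_
    rw [← inner_add_right, add_sub_cancel, hγ, inner_toLp]

end

section

/-- Width of the `n + 1` equal cells of `(a, b)`. -/
def mesh (a b : ℝ) (n : ℕ) : ℝ := (b - a) / (n + 1)

lemma mesh_pos {a b : ℝ} (hab : a < b) (n : ℕ) : 0 < mesh a b n :=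
  div_pos (sub_pos.2 hab) (by positivity)

lemma mul_mesh (a b : ℝ) (n : ℕ) : (n + 1) * mesh a b n = b - a := by
  unfold mesh
  field_simp

lemma tendsto_mesh (a b : ℝ) : Tendsto (mesh a b) atTop (nhds 0) :=
  tendsto_const_nhds.div_atTop
    (tendsto_atTop_add_const_right _ _ tendsto_natCast_atTop_atTop)

lemma node_mem {a b : ℝ} (hab : a < b) {n j : ℕ} (hj : j ≤ n + 1) :
    a + j * mesh a b n ∈ Icc a b := by
  have h1 := mesh_pos hab n
  have h2 := mul_mesh a b n
  have h3 : (j : ℝ) ≤ n + 1 := by exact_mod_cast hj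
  have h4 : 0 ≤ (j : ℝ) * mesh a b n := by positivity
  have h5 := mul_le_mul_of_nonneg_right h3 h1.le
  constructor <;> linarith

/-- Bounded cell functions converging pointwise. -/
structure CellLim (a b : ℝ) (N : ℕ → ℕ) (C : ℝ) (p : ℕ → ℕ → ℝ) (P : ℝ → ℝ) : Prop where
  bdd : ∀ k, ∀ j ≤ N k, |p k j| ≤ C
  lim : ∀ x ∈ Ioo a b,
    Tendsto (fun k => p k (cell (N k) a (mesh a b (N k)) x)) atTop (nhds (P x))

/-- Cell functions bounded in `L²` and converging weakly. -/
structure WeakCell (a b : ℝ) (N : ℕ → ℕ) (C : ℝ) (q : ℕ → ℕ → ℝ) (Q : ℝ → ℝ) : Prop where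
  bdd : ∀ k, ip (N k) (mesh a b (N k)) (q k) (q k) ≤ C
  lim : ∀ C' p P, CellLim a b N C' p P →
    Tendsto (fun k => ip (N k) (mesh a b (N k)) (q k) (p k)) atTop
      (nhds (∫ x in Ioo a b, Q x * P x))

variable {a b : ℝ} {N : ℕ → ℕ} {C C' : ℝ} {p p' q : ℕ → ℕ → ℝ} {P P' Q : ℝ → ℝ}

lemma CellLim.nonneg (H : CellLim a b N C p P) : 0 ≤ C :=
  (abs_nonneg _).trans (H.bdd 0 0 (Nat.zero_le _))

lemma CellLim.mul (H : CellLim a b N C p P) (H' : CellLim a b N C' p' P') :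
    CellLim a b N (C * C') (fun k j => p k j * p' k j) (fun x => P x * P' x) :=
  ⟨fun k j hj => by
    rw [abs_mul]
    exact mul_le_mul (H.bdd k j hj) (H'.bdd k j hj) (abs_nonneg _) H.nonneg,
    fun x hx => (H.lim x hx).mul (H'.lim x hx)⟩

lemma CellLim.abs_ip_le (hab : a < b) (H : CellLim a b N C p P) (H' : CellLim a b N C' p' P')
    (k : ℕ) : |ip (N k) (mesh a b (N k)) (p k) (p' k)| ≤ (b - a) * (C * C') := by
  have hh := mesh_pos hab (N k)
  refine (abs_ip_le_ip_abs hh _ _).trans ?_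
  refine (ip_mono (p' := fun _ => C) (q' := fun _ => C') hh fun j hj =>
    mul_le_mul (H.bdd k j hj) (H'.bdd k j hj) (abs_nonneg _) H.nonneg).trans_eq ?_
  rw [← mul_mesh a b (N k)]
  simp [ip]
  ring

lemma WeakCell.abs_ip_le (hab : a < b) (H : WeakCell a b N C q Q) (H' : CellLim a b N C' p P)
    (k : ℕ) : |ip (N k) (mesh a b (N k)) (q k) (p k)| ≤ √C * √((b - a) * C' ^ 2) := by
  have hh := mesh_pos hab (N k)
  refine abs_ip_le_of_le hh (H.bdd k) ?_
  have := ip_self_le_of_abs_le hh (H'.bdd k)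
  rwa [mul_mesh] at this

lemma CellLim.ip_tendsto (hab : a < b) (H : CellLim a b N C p P) (H' : CellLim a b N C' p' P') :
    Tendsto (fun k => ip (N k) (mesh a b (N k)) (p k) (p' k)) atTop
      (nhds (∫ x in Ioo a b, P x * P' x)) := by
  have HH := H.mul H'
  simp only [ip_eq_integral (mesh_pos hab _) (mul_mesh a b _)]
  refine tendsto_integral_of_dominated_convergence (fun _ => C * C')
    (fun k => (measurable_comp_cell (fun j => p k j * p' k j)).aestronglyMeasurable)
    (integrable_const _) (fun k => Eventually.of_forall fun x => HH.bdd k _ (cell_le x)) ?_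
  exact (ae_restrict_iff' measurableSet_Ioo).2 (Eventually.of_forall HH.lim)

lemma tendsto_node (hab : a < b) (hN : Tendsto N atTop atTop) {x : ℝ} (hx : x ∈ Icc a b) :
    Tendsto (fun k => a + cell (N k) a (mesh a b (N k)) x * mesh a b (N k)) atTop (nhds x) := by
  have h1 := ((tendsto_mesh a b).comp hN).const_sub x
  rw [sub_zero] at h1
  have hb : ∀ k, a + cell (N k) a (mesh a b (N k)) x * mesh a b (N k) ≤ x ∧
      x ≤ a + (cell (N k) a (mesh a b (N k)) x + 1) * mesh a b (N k) := fun k =>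
    abs_cell_sub_le (mesh_pos hab _) hx.1 (by rw [mul_mesh]; linarith [hx.2])
  refine tendsto_of_tendsto_of_tendsto_of_le_of_le h1 tendsto_const_nhds (fun k => ?_)
    fun k => (hb k).1
  have := (hb k).2
  simp only [comp_apply]
  linarith

lemma tendsto_node_succ (hab : a < b) (hN : Tendsto N atTop atTop) {x : ℝ} (hx : x ∈ Icc a b) :
    Tendsto (fun k => a + ((cell (N k) a (mesh a b (N k)) x + 1 : ℕ) : ℝ) * mesh a b (N k)) atTop
      (nhds x) := by
  have := (tendsto_node hab hN hx).add ((tendsto_mesh a b).comp hN)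
  rw [add_zero] at this
  refine this.congr fun k => ?_
  simp only [comp_apply]
  push_cast
  ring

lemma eventually_one_le_cell (hab : a < b) (hN : Tendsto N atTop atTop) {x : ℝ}
    (hx : x ∈ Ioo a b) : ∀ᶠ k in atTop, 1 ≤ cell (N k) a (mesh a b (N k)) x := by
  have h1 := tendsto_node hab hN ⟨hx.1.le, hx.2.le⟩
  filter_upwards [h1.eventually (lt_mem_nhds hx.1)] with k hk
  rcases Nat.eq_zero_or_pos (cell (N k) a (mesh a b (N k)) x) with h | h
  · rw [h] at hk
    simp at hk
  · exact h

lemma tendsto_node_pred (hab : a < b) (hN : Tendsto N atTop atTop) {x : ℝ} (hx : x ∈ Ioo a b) :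
    Tendsto (fun k => a + ((cell (N k) a (mesh a b (N k)) x - 1 : ℕ) : ℝ) * mesh a b (N k)) atTop
      (nhds x) := by
  have := (tendsto_node hab hN ⟨hx.1.le, hx.2.le⟩).sub ((tendsto_mesh a b).comp hN)
  rw [sub_zero] at this
  refine this.congr' ?_
  filter_upwards [eventually_one_le_cell hab hN hx] with k hk
  simp only [comp_apply]
  push_cast [hk]
  ring

lemma cellLim_of_continuous (hab : a < b) (hN : Tendsto N atTop atTop) {ψ : ℝ → ℝ}
    (hψ : Continuous ψ) (hC : ∀ x ∈ Icc a b, |ψ x| ≤ C) :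
    CellLim a b N C (fun k j => ψ (a + j * mesh a b (N k))) ψ :=
  ⟨fun _ _ hj => hC _ (node_mem hab (hj.trans (Nat.le_succ _))), fun _ hx =>
    (hψ.tendsto _).comp (tendsto_node hab hN ⟨hx.1.le, hx.2.le⟩)⟩

lemma cellLim_pred_of_continuous (hab : a < b) (hN : Tendsto N atTop atTop) {ψ : ℝ → ℝ}
    (hψ : Continuous ψ) (hC : ∀ x ∈ Icc a b, |ψ x| ≤ C) :
    CellLim a b N C (fun k j => ψ (a + (j - 1 : ℕ) * mesh a b (N k))) ψ :=
  ⟨fun _ _ hj => hC _ (node_mem hab (by omega)), fun _ hx =>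
    (hψ.tendsto _).comp (tendsto_node_pred hab hN hx)⟩

lemma tendsto_slope_of_contDiff {ψ : ℝ → ℝ} (hψ : ContDiff ℝ 1 ψ) {x : ℝ} {y z : ℕ → ℝ}
    (hy : Tendsto y atTop (nhds x)) (hz : Tendsto z atTop (nhds x)) (hyz : ∀ k, y k ≠ z k) :
    Tendsto (fun k => (ψ (y k) - ψ (z k)) / (y k - z k)) atTop (nhds (deriv ψ x)) := by
  have hs : HasStrictDerivAt ψ (deriv ψ x) x := hψ.contDiffAt.hasStrictDerivAt one_ne_zero
  have := (hs.isLittleO).comp_tendsto (hy.prodMk_nhds hz)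
  have h2 := this.tendsto_div_nhds_zero
  have h3 := h2.add_const (deriv ψ x)
  rw [zero_add] at h3
  refine h3.congr fun k => ?_
  have h4 : y k - z k ≠ 0 := sub_ne_zero.2 (hyz k)
  simp only [comp_apply, ContinuousLinearMap.toSpanSingleton_apply, smul_eq_mul]
  field_simp
  ring

lemma abs_sub_le_of_mem (hψ : Differentiable ℝ P) (hC : ∀ x ∈ Icc a b, |deriv P x| ≤ C)
    {x y : ℝ} (hx : x ∈ Icc a b) (hy : y ∈ Icc a b) : |P y - P x| ≤ C * |y - x| :=
  (convex_Icc a b).norm_image_sub_le_of_norm_deriv_le (fun z _ => hψ z) hC hx hy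

lemma cellLim_fwd (hab : a < b) (hN : Tendsto N atTop atTop) {ψ : ℝ → ℝ}
    (hψ : ContDiff ℝ 1 ψ) (hC : ∀ x ∈ Icc a b, |deriv ψ x| ≤ C) :
    CellLim a b N C (fun k => fwd (mesh a b (N k)) fun j => ψ (a + j * mesh a b (N k)))
      (deriv ψ) := by
  refine ⟨fun k j hj => ?_, fun x hx => ?_⟩
  · have hh := mesh_pos hab (N k)
    rw [fwd, abs_div, abs_of_pos hh, div_le_iff₀ hh]
    refine (abs_sub_le_of_mem (hψ.differentiable one_ne_zero) hC
      (node_mem hab (show j ≤ N k + 1 by omega))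
      (node_mem hab (show j + 1 ≤ N k + 1 by omega))).trans_eq ?_
    push_cast
    rw [show a + (j + 1) * mesh a b (N k) - (a + j * mesh a b (N k)) = mesh a b (N k) by ring,
      abs_of_pos hh]
  · have hx' : x ∈ Icc a b := ⟨hx.1.le, hx.2.le⟩
    refine (tendsto_slope_of_contDiff hψ (tendsto_node_succ hab hN hx') (tendsto_node hab hN hx')
      fun k => ?_).congr fun k => ?_
    · have := mesh_pos hab (N k)
      push_cast
      intro h
      linarith
    · rw [fwd]
      congr 1
      push_cast
      ring

lemma cellLim_bwd (hab : a < b) (hN : Tendsto N atTop atTop) {ψ : ℝ → ℝ}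
    (hψ : ContDiff ℝ 1 ψ) (hC : ∀ x ∈ Icc a b, |deriv ψ x| ≤ C) :
    CellLim a b N C (fun k => bwd (N k) (mesh a b (N k)) fun j => ψ (a + j * mesh a b (N k)))
      (deriv ψ) := by
  have hC0 : 0 ≤ C := (abs_nonneg _).trans (hC a (left_mem_Icc.2 hab.le))
  have F := cellLim_fwd hab hN hψ hC
  refine ⟨fun k j hj => ?_, fun x hx => ?_⟩
  · rcases j with - | j
    · simpa using hC0
    · rw [bwd_of_le hj]
      exact F.bdd k j (by omega)
  · have hx' : x ∈ Icc a b := ⟨hx.1.le, hx.2.le⟩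
    have h1 := (tendsto_node hab hN hx').add ((tendsto_mesh a b).comp hN)
    rw [add_zero] at h1
    have h2 := (tendsto_node hab hN hx').sub ((tendsto_mesh a b).comp hN)
    rw [sub_zero] at h2
    refine (tendsto_slope_of_contDiff hψ (tendsto_node hab hN hx') h2 fun k => ?_).congr' ?_
    · have := mesh_pos hab (N k)
      simp only [comp_apply]
      intro h
      linarith
    · filter_upwards [eventually_one_le_cell hab hN hx] with k hk
      rw [bwd_of_le (cell_le x)]
      simp only [comp_apply]
      push_cast [hk]
      congr 1
      · congr 2
        ring
      · ring

/-- Cell functions with bounded gradients: weak convergence of the difference quotients. -/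
lemma weakCell_bwd (hab : a < b) (hN : Tendsto N atTop atTop)
    (hC : ∀ k, ip (N k) (mesh a b (N k)) (bwd (N k) (mesh a b (N k)) (p k))
      (bwd (N k) (mesh a b (N k)) (p k)) ≤ C)
    (hP : ∀ x ∈ Icc a b,
      Tendsto (fun k => p k (cell (N k) a (mesh a b (N k)) x)) atTop (nhds (P x))) :
    MemLp (deriv P) 2 (volume.restrict (Ioo a b)) ∧ (∫ x in Ioo a b, deriv P x ^ 2 ≤ C) ∧
      WeakCell a b N C (fun k => bwd (N k) (mesh a b (N k)) (p k)) (deriv P) := by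
  have hC0 : 0 ≤ C := (ip_self_nonneg (mesh_pos hab _) _).trans (hC 0)
  set q : ℕ → ℕ → ℝ := fun k => bwd (N k) (mesh a b (N k)) (p k) with hq
  have key : ∀ x ∈ Icc a b, Tendsto (fun k => ∫ y in a..x, q k (cell (N k) a (mesh a b (N k)) y))
      atTop (nhds (P x - P a)) := by
    intro x hx
    have hd := (hP x hx).sub (hP a (left_mem_Icc.2 hab.le))
    have hE : Tendsto (fun k => √(mesh a b (N k)) * √C) atTop (nhds 0) := by
      have := (((tendsto_mesh a b).comp hN).sqrt).mul_const (√C)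
      rwa [Real.sqrt_zero, zero_mul] at this
    refine tendsto_of_tendsto_of_dist hd (squeeze_zero (fun _ => dist_nonneg) (fun k => ?_) hE)
    set h := mesh a b (N k) with hh'
    have hh : 0 < h := mesh_pos hab _
    set c := cell (N k) a h x with hc
    have hcn : c ≤ N k := cell_le x
    have hca : cell (N k) a h a = 0 := cell_eq hh (Nat.zero_le _) (by simp) (by simpa using hh)
    have hxc := abs_cell_sub_le (n := N k) (a := a) hh hx.1
      (by rw [hh', mul_mesh]; linarith [hx.2])
    rw [← hc] at hxc
    have full := integral_comp_cell (n := N k) (a := a) hh (q k) (k := c + 1) (by omega)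
    have tele : h * ∑ j ∈ Finset.range (c + 1), q k j = p k c - p k 0 := by
      rw [Finset.sum_range_succ']
      have : ∑ j ∈ Finset.range c, q k (j + 1) = ∑ j ∈ Finset.range c, (p k (j + 1) - p k j) / h :=
        Finset.sum_congr rfl fun j hj => by
          rw [Finset.mem_range] at hj
          rw [hq]
          simp only
          rw [bwd_of_le (by omega)]
          rfl
      rw [this, ← Finset.sum_div, Finset.sum_range_sub, hq]
      simp only [bwd_zero, add_zero]
      field_simp
    have rest : |∫ y in x..a + ((c + 1 : ℕ) : ℝ) * h, q k (cell (N k) a h y)| ≤ h * |q k c| := by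
      have hx2 : x ≤ a + ((c + 1 : ℕ) : ℝ) * h := by push_cast; exact hxc.2
      have e : ∫ y in x..a + ((c + 1 : ℕ) : ℝ) * h, q k (cell (N k) a h y)
          = ∫ _ in x..a + ((c + 1 : ℕ) : ℝ) * h, q k c := by
        refine intervalIntegral.integral_congr_Ioo_of_le hx2 fun y hy => ?_
        push_cast at hy
        simp only [cell_eq hh hcn (hxc.1.trans hy.1.le) hy.2]
      rw [e, intervalIntegral.integral_const, smul_eq_mul, abs_mul,
        abs_of_nonneg (sub_nonneg.2 hx2)]
      refine mul_le_mul_of_nonneg_right ?_ (abs_nonneg _)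
      push_cast
      linarith [hxc.1]
    have hsplit := intervalIntegral.integral_add_adjacent_intervals (a := a) (b := x)
      (c := a + ((c + 1 : ℕ) : ℝ) * h) (intervalIntegrable_comp_cell (n := N k) (a := a) (h := h)
        (q k) _ _) (intervalIntegrable_comp_cell (n := N k) (a := a) (h := h) (q k) _ _)
    rw [hca, Real.dist_eq]
    have heq : p k c - p k 0 - ∫ y in a..x, q k (cell (N k) a h y)
        = ∫ y in x..a + ((c + 1 : ℕ) : ℝ) * h, q k (cell (N k) a h y) := by
      rw [← tele, ← full, ← hsplit]
      ring
    rw [heq]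
    refine rest.trans ?_
    have s1 := (sq_le_ip hh (q k) hcn).trans (hC k)
    have : h * |q k c| = √h * √(h * q k c ^ 2) := by
      rw [Real.sqrt_mul hh.le, Real.sqrt_sq_eq_abs, ← mul_assoc, Real.mul_self_sqrt hh.le]
    rw [this]
    exact mul_le_mul_of_nonneg_left (Real.sqrt_le_sqrt s1) (Real.sqrt_nonneg _)
  obtain ⟨w1, w2, w3⟩ := weak_limit hab (C := C) (P := P)
    (g := fun k x => q k (cell (N k) a (mesh a b (N k)) x))
    (fun k => measurable_comp_cell (q k)) (fun k => ⟨_, abs_comp_cell_le (q k)⟩)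
    (fun k => by
      have := hC k
      rw [ip_eq_integral (mesh_pos hab _) (mul_mesh a b _)] at this
      simpa only [pow_two] using this) key
  refine ⟨w1, w2, hC, fun C' r R hr => ?_⟩
  simp only [ip_eq_integral (mesh_pos hab _) (mul_mesh a b _)]
  exact w3 (fun k x => r k (cell (N k) a (mesh a b (N k)) x)) R C'
    (fun k => measurable_comp_cell (r k)) (fun k x _ => hr.bdd k _ (cell_le x)) hr.lim

end

section

variable {a b : ℝ}

/-- Cell values at a nonnegative time, with time frozen before zero. -/
def cellVal (a b : ℝ) (w : ℕ → ℝ → ℕ → ℝ) (n : ℕ) (z : ℝ × ℝ) : ℝ :=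
  w n (max z.2 0) (cell n a (mesh a b n) z.1)

lemma cellVal_bdd {w : ℕ → ℝ → ℕ → ℝ}
    (H : ∀ T, ∃ C, 0 ≤ C ∧ ∀ n, UnifBdd n (mesh a b n) T C (w n)) (z : ℝ × ℝ) :
    ∃ C, ∀ n, |cellVal a b w n z| ≤ C := by
  obtain ⟨C, -, hC⟩ := H (max z.2 0)
  exact ⟨C, fun n => (hC n).sup _ ⟨le_max_right _ _, le_rfl⟩ _ (cell_le _)⟩

lemma sq_sub_cell_le (hab : a < b) {n : ℕ} {C : ℝ} {w : ℕ → ℝ}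
    (hw : ip n (mesh a b n) (bwd n (mesh a b n) w) (bwd n (mesh a b n) w) ≤ C) (x y : ℝ) :
    (w (cell n a (mesh a b n) y) - w (cell n a (mesh a b n) x)) ^ 2 ≤
      C * (|y - x| + mesh a b n) := by
  have hh := mesh_pos hab n
  wlog hxy : x ≤ y generalizing x y
  · rw [← neg_sub, neg_sq, ← neg_sub x y, abs_neg]
    exact this y x (le_of_not_ge hxy)
  have h1 := cell_sub_le (n := n) (a := a) hh hxy
  refine (abs_sub_sq_le hh w h1.1 (cell_le y)).trans ?_
  rw [mul_comm C, abs_of_nonneg (sub_nonneg.2 hxy)]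
  refine mul_le_mul h1.2 hw (ip_self_nonneg hh _) ?_
  linarith

lemma cellVal_equi (hab : a < b) {w : ℕ → ℝ → ℕ → ℝ}
    (H : ∀ T, ∃ C, 0 ≤ C ∧ ∀ n, UnifBdd n (mesh a b n) T C (w n)) (z : ℝ × ℝ) (ε : ℝ)
    (hε : 0 < ε) : ∃ δ > 0, ∃ K, ∀ n ≥ K, ∀ y, dist y z < δ →
      |cellVal a b w n y - cellVal a b w n z| < ε := by
  obtain ⟨C, hC0, hC⟩ := H (max z.2 0 + 1)
  obtain ⟨η, hη⟩ : ∃ η, η = ε ^ 2 / (8 * (C + 1)) := ⟨_, rfl⟩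
  have hη0 : 0 < η := by rw [hη]; positivity
  have hηε : 8 * (C + 1) * η = ε ^ 2 := by rw [hη]; field_simp
  obtain ⟨K, hK⟩ := eventually_atTop.1 ((tendsto_mesh a b).eventually (gt_mem_nhds hη0))
  refine ⟨min 1 (min η (η ^ 2)), by positivity, K, fun n hn y hy => ?_⟩
  have hh := hK n hn
  rw [lt_min_iff, lt_min_iff] at hy
  have hy1 : |y.1 - z.1| ≤ dist y z := by
    rw [← Real.dist_eq]; exact le_max_left _ _
  have hy2 : |max y.2 0 - max z.2 0| ≤ dist y z :=
    (abs_max_sub_max_le_abs _ _ _).trans (by rw [← Real.dist_eq]; exact le_max_right _ _)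
  have hz : max z.2 0 ∈ Icc 0 (max z.2 0 + 1) := ⟨le_max_right _ _, by linarith⟩
  have hyt : max y.2 0 ∈ Icc 0 (max z.2 0 + 1) :=
    ⟨le_max_right _ _, by linarith [le_abs_self (max y.2 0 - max z.2 0)]⟩
  have e1 := sq_sub_cell_le hab ((hC n).grad _ hyt) z.1 y.1
  have e2 := (hC n).time _ hz _ hyt _ (cell_le (h := mesh a b n) (a := a) z.1)
  have e3 : √|max y.2 0 - max z.2 0| ≤ η :=
    Real.sqrt_le_iff.2 ⟨hη0.le, hy2.trans hy.2.2.le⟩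
  have e4 : C * (|y.1 - z.1| + mesh a b n) ≤ C * (2 * η) :=
    mul_le_mul_of_nonneg_left (by linarith) hC0
  have e5 : C * √|max y.2 0 - max z.2 0| ≤ C * η := mul_le_mul_of_nonneg_left e3 hC0
  refine abs_lt_of_sq_lt_sq ?_ hε.le
  unfold cellVal
  generalize w n (max y.2 0) (cell n a (mesh a b n) y.1) = A at *
  generalize w n (max y.2 0) (cell n a (mesh a b n) z.1) = B at *
  generalize w n (max z.2 0) (cell n a (mesh a b n) z.1) = D at *
  nlinarith [sq_nonneg (A - B - (B - D))]

/-- Convergence of semi-discrete solutions to continuous limits. -/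
structure Approx (a b : ℝ) (f v0 u0 Θ0 : ℝ → ℝ) (N : ℕ → ℕ) (u v θ : ℕ → ℝ → ℕ → ℝ)
    (U V W Θ : ℝ → ℝ → ℝ) : Prop where
  top : Tendsto N atTop atTop
  sol : ∀ k, DSol (N k) (mesh a b (N k)) (fun x => f (max x 0)) (u k) (v k) (θ k)
  u_zero : ∀ k, ∀ j ≤ N k + 1, u k 0 j = u0 (a + j * mesh a b (N k))
  v_zero : ∀ k, ∀ j ≤ N k + 1, v k 0 j = v0 (a + j * mesh a b (N k))
  θ_zero : ∀ k, ∀ j ≤ N k, θ k 0 j = Θ0 (a + j * mesh a b (N k))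
  bdd : ∀ T, ∃ C, 0 ≤ C ∧ ∀ k, UnifBdd (N k) (mesh a b (N k)) T C (u k) ∧
    UnifBdd (N k) (mesh a b (N k)) T C (v k) ∧
    UnifBdd (N k) (mesh a b (N k)) T C (fun t => fwd (mesh a b (N k)) (u k t)) ∧
    UnifBdd (N k) (mesh a b (N k)) T C (θ k)
  cU : Continuous (uncurry U)
  cV : Continuous (uncurry V)
  cW : Continuous (uncurry W)
  cΘ : Continuous (uncurry Θ)
  lU : ∀ t, 0 ≤ t → ∀ x,
    Tendsto (fun k => u k t (cell (N k) a (mesh a b (N k)) x)) atTop (nhds (U x t))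
  lV : ∀ t, 0 ≤ t → ∀ x,
    Tendsto (fun k => v k t (cell (N k) a (mesh a b (N k)) x)) atTop (nhds (V x t))
  lW : ∀ t, 0 ≤ t → ∀ x, Tendsto
    (fun k => fwd (mesh a b (N k)) (u k t) (cell (N k) a (mesh a b (N k)) x)) atTop (nhds (W x t))
  lΘ : ∀ t, 0 ≤ t → ∀ x,
    Tendsto (fun k => θ k t (cell (N k) a (mesh a b (N k)) x)) atTop (nhds (Θ x t))

lemma exists_approx (hab : a < b) {f f' f'' : ℝ → ℝ} (hf : HypF f f' f'')
    {v0 u0 Θ0 : ℝ → ℝ} (D : SmoothData a b v0 u0 Θ0) :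
    ∃ N u v θ U V W Θ, Approx a b f v0 u0 Θ0 N u v θ U V W Θ := by
  obtain ⟨M, hM⟩ := HypF.nonlin hf
  have bdry : ∀ {w : ℝ → ℝ}, (∃ K : Set ℝ, IsCompact K ∧ K ⊆ Ioo a b ∧ ∀ x, x ∉ K → w x = 0) →
      w a = 0 ∧ w b = 0 := fun ⟨K, _, h1, h2⟩ =>
    ⟨h2 _ fun h => lt_irrefl _ (h1 h).1, h2 _ fun h => lt_irrefl _ (h1 h).2⟩
  have hend : ∀ n : ℕ, a + ((n + 1 : ℕ) : ℝ) * mesh a b n = b := fun n => by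
    push_cast
    rw [mul_mesh]
    ring
  have ex : ∀ n : ℕ, ∃ u v θ : ℝ → ℕ → ℝ,
      DSol n (mesh a b n) (fun x => f (max x 0)) u v θ ∧
      (∀ j ≤ n + 1, u 0 j = u0 (a + j * mesh a b n)) ∧
      (∀ j ≤ n + 1, v 0 j = v0 (a + j * mesh a b n)) ∧
      (∀ j ≤ n, θ 0 j = Θ0 (a + j * mesh a b n)) := fun n =>
    exists_dSol (mesh_pos hab n) hM (by simpa using (bdry D.u0_supp).1)
      (by rw [hend]; exact (bdry D.u0_supp).2) (by simpa using (bdry D.v0_supp).1)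
      (by rw [hend]; exact (bdry D.v0_supp).2)
      fun j hj => (D.Θ0_pos _ (node_mem hab (by omega))).le
  choose u v θ hs hu hv hθ using ex
  obtain ⟨E, Y, hE, hY, hEY⟩ := init_bounds hab D
  have hB : ∀ T, ∃ C, 0 ≤ C ∧ ∀ n, UnifBdd n (mesh a b n) T C (u n) ∧
      UnifBdd n (mesh a b n) T C (v n) ∧
      UnifBdd n (mesh a b n) T C (fun t => fwd (mesh a b n) (u n t)) ∧
      UnifBdd n (mesh a b n) T C (θ n) := fun T => by
    obtain ⟨C, hC, H⟩ := uniform_bounds (T := T) hM.M_nonneg (sub_pos.2 hab) hE hY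
    refine ⟨C, hC, fun n => ?_⟩
    have := hEY n _ (mesh_pos hab n) (mul_mesh a b n) _ _ _ (hu n) (hv n) (hθ n)
    exact H n _ _ f' _ _ _ (mesh_pos hab n) (mul_mesh a b n) hM (hs n) this.1 this.2
  let w : Fin 4 → ℕ → ℝ → ℕ → ℝ := ![u, v, fun n t => fwd (mesh a b n) (u n t), θ]
  have hw : ∀ i T, ∃ C, 0 ≤ C ∧ ∀ n, UnifBdd n (mesh a b n) T C (w i n) := fun i T => by
    obtain ⟨C, hC, H⟩ := hB T
    refine ⟨C, hC, fun n => ?_⟩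
    fin_cases i
    exacts [(H n).1, (H n).2.1, (H n).2.2.1, (H n).2.2.2]
  obtain ⟨N, hN, G, hG, hl⟩ := exists_subseq_tendsto (fun i => cellVal a b (w i))
    (fun i z => cellVal_bdd (hw i) z) (fun i z ε hε => cellVal_equi hab (hw i) z ε hε)
  have lim : ∀ i t, 0 ≤ t → ∀ x, Tendsto
      (fun k => w i (N k) t (cell (N k) a (mesh a b (N k)) x)) atTop (nhds (G i (x, t))) :=
    fun i t ht x => by
      have := hl i (x, t)
      simpa only [cellVal, max_eq_left ht] using this
  refine ⟨N, fun k => u (N k), fun k => v (N k), fun k => θ (N k), fun x t => G 0 (x, t),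
    fun x t => G 1 (x, t), fun x t => G 2 (x, t), fun x t => G 3 (x, t), hN.tendsto_atTop,
    fun k => hs _, fun k => hu _, fun k => hv _, fun k => hθ _, fun T => ?_, hG 0, hG 1, hG 2,
    hG 3, lim 0, lim 1, lim 2, lim 3⟩
  obtain ⟨C, hC, H⟩ := hB T
  exact ⟨C, hC, fun k => H _⟩

end

section

variable {a b : ℝ} {N : ℕ → ℕ}

lemma HypF.continuous {f f' f'' : ℝ → ℝ} (hf : HypF f f' f'') :
    Continuous (fun x => f (max x 0)) ∧ Continuous (fun x => f' (max x 0)) := by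
  have h1 : ContinuousOn f (Ici 0) := fun x hx => (hf.hasDeriv₁ x hx).continuousWithinAt
  have h2 : ContinuousOn f' (Ici 0) := fun x hx => (hf.hasDeriv₂ x hx).continuousWithinAt
  have h3 : Continuous fun x : ℝ => max x 0 := continuous_id.max continuous_const
  exact ⟨h1.comp_continuous h3 fun x => mem_Ici.2 (le_max_right _ _),
    h2.comp_continuous h3 fun x => mem_Ici.2 (le_max_right _ _)⟩

lemma Nonlin.abs_bwd_sub_le {M : ℝ} {g g' : ℝ → ℝ} (G : Nonlin M g g') {n : ℕ} {h : ℝ}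
    (hh : 0 < h) {w : ℕ → ℝ} (hw : ∀ j ≤ n, 0 ≤ w j) {j : ℕ} (hj : j ≤ n) :
    |bwd n h (fun i => g (w i)) j - g' (w j) * bwd n h w j| ≤ M * h * bwd n h w j ^ 2 := by
  have := G.taylor (w j) (w (j - 1)) (hw j hj) (hw _ (by omega))
  rw [bwd_of_le hj, bwd_of_le hj]
  have e : (g (w j) - g (w (j - 1))) / h - g' (w j) * ((w j - w (j - 1)) / h) =
      -(g (w (j - 1)) - g (w j) - g' (w j) * (w (j - 1) - w j)) / h := by
    field_simp
    ring
  rw [e, abs_div, abs_neg, abs_of_pos hh, div_le_iff₀ hh]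
  refine this.trans_eq ?_
  field_simp
  ring

lemma WeakCell.bwd_comp (hab : a < b) (hN : Tendsto N atTop atTop) {M : ℝ} {g g' : ℝ → ℝ}
    (G : Nonlin M g g') {w : ℕ → ℕ → ℝ} (hw : ∀ k, ∀ j ≤ N k, 0 ≤ w k j) {C C' : ℝ}
    {Q R : ℝ → ℝ} (H : WeakCell a b N C (fun k => bwd (N k) (mesh a b (N k)) (w k)) Q)
    (H' : CellLim a b N C' (fun k j => g' (w k j)) R) :
    WeakCell a b N (M ^ 2 * C) (fun k => bwd (N k) (mesh a b (N k)) fun j => g (w k j))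
      (fun x => R x * Q x) := by
  have hM := G.M_nonneg
  refine ⟨fun k => (G.ip_bwd_le (mesh_pos hab _) _).trans
    (mul_le_mul_of_nonneg_left (H.bdd k) (sq_nonneg M)), fun B p P hp => ?_⟩
  have h1 := H.lim _ _ _ (H'.mul hp)
  have h2 : ∀ k, |ip (N k) (mesh a b (N k))
      (bwd (N k) (mesh a b (N k)) fun j => g (w k j)) (p k) -
      ip (N k) (mesh a b (N k)) (bwd (N k) (mesh a b (N k)) (w k))
        (fun j => g' (w k j) * p k j)| ≤ M * mesh a b (N k) * B * C := fun k => by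
    have hh := mesh_pos hab (N k)
    have e : ip (N k) (mesh a b (N k))
      (bwd (N k) (mesh a b (N k)) fun j => g (w k j)) (p k) -
      ip (N k) (mesh a b (N k)) (bwd (N k) (mesh a b (N k)) (w k))
        (fun j => g' (w k j) * p k j) = ip (N k) (mesh a b (N k))
      (fun j => bwd (N k) (mesh a b (N k)) (fun j => g (w k j)) j -
        g' (w k j) * bwd (N k) (mesh a b (N k)) (w k) j) (p k) := by
      simp only [ip]
      rw [← mul_sub, ← Finset.sum_sub_distrib]
      congr 1
      exact Finset.sum_congr rfl fun j _ => by ring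
    rw [e]
    refine (abs_ip_le_ip_abs hh _ _).trans ?_
    refine (ip_mono (p' := bwd (N k) (mesh a b (N k)) (w k))
      (q' := fun j => M * mesh a b (N k) * B * bwd (N k) (mesh a b (N k)) (w k) j) hh
      fun j hj => (mul_le_mul (G.abs_bwd_sub_le hh (hw k) hj) (hp.bdd k j hj) (abs_nonneg _)
        (by positivity)).trans_eq (by ring)).trans ?_
    have e2 : ip (N k) (mesh a b (N k)) (bwd (N k) (mesh a b (N k)) (w k))
        (fun j => M * mesh a b (N k) * B * bwd (N k) (mesh a b (N k)) (w k) j) =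
        M * mesh a b (N k) * B * ip (N k) (mesh a b (N k)) (bwd (N k) (mesh a b (N k)) (w k))
          (bwd (N k) (mesh a b (N k)) (w k)) := by
      simp only [ip]
      rw [mul_left_comm]
      congr 1
      rw [Finset.mul_sum]
      exact Finset.sum_congr rfl fun j _ => by ring
    rw [e2]
    exact mul_le_mul_of_nonneg_left (H.bdd k)
      (mul_nonneg (mul_nonneg hM hh.le) hp.nonneg)
  have h3 : Tendsto (fun k => M * mesh a b (N k) * B * C) atTop (nhds 0) := by
    have := ((((tendsto_mesh a b).comp hN).const_mul M).mul_const B).mul_const C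
    simpa using this
  have h4 : (fun x => R x * Q x * P x) = fun x => Q x * (R x * P x) := by
    ext x
    ring
  rw [h4]
  refine tendsto_of_tendsto_of_dist h1 (squeeze_zero (fun _ => dist_nonneg) (fun k => ?_) h3)
  rw [Real.dist_eq, abs_sub_comm]
  exact h2 k

variable {f f' f'' v0 u0 Θ0 : ℝ → ℝ} {u v θ : ℕ → ℝ → ℕ → ℝ} {U V W Θ : ℝ → ℝ → ℝ}

lemma Approx.nonneg (H : Approx a b f v0 u0 Θ0 N u v θ U V W Θ) {t : ℝ} (ht : 0 ≤ t) (x : ℝ) :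
    0 ≤ Θ x t :=
  ge_of_tendsto' (H.lΘ t ht x) fun k => (H.sol k).nonneg t ht _ (cell_le x)

/-- Convergence of all slices up to time `T`, with bounds independent of the slice. -/
structure Slices (a b T C M : ℝ) (f f' : ℝ → ℝ) (N : ℕ → ℕ) (u v θ : ℕ → ℝ → ℕ → ℝ)
    (U V W Θ : ℝ → ℝ → ℝ) : Prop where
  su : ∀ t ∈ Icc 0 T, CellLim a b N C (fun k => u k t) (fun x => U x t)
  sv : ∀ t ∈ Icc 0 T, CellLim a b N C (fun k => v k t) (fun x => V x t)
  sw : ∀ t ∈ Icc 0 T,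
    CellLim a b N C (fun k => fwd (mesh a b (N k)) (u k t)) (fun x => W x t)
  sθ : ∀ t ∈ Icc 0 T, CellLim a b N C (fun k => θ k t) (fun x => Θ x t)
  sg : ∀ t ∈ Icc 0 T, CellLim a b N (M * C) (fun k j => f (max (θ k t j) 0)) (fun x => f (Θ x t))
  memLp : ∀ t ∈ Icc 0 T, MemLp (deriv fun x => Θ x t) 2 (volume.restrict (Ioo a b))
  sq_le : ∀ t ∈ Icc 0 T, ∫ x in Ioo a b, deriv (fun x => Θ x t) x ^ 2 ≤ C
  sθx : ∀ t ∈ Icc 0 T, WeakCell a b N C (fun k => bwd (N k) (mesh a b (N k)) (θ k t))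
    (deriv fun x => Θ x t)
  sgx : ∀ t ∈ Icc 0 T, WeakCell a b N (M ^ 2 * C)
    (fun k => bwd (N k) (mesh a b (N k)) fun j => f (max (θ k t j) 0))
    (fun x => f' (Θ x t) * deriv (fun x => Θ x t) x)

lemma Approx.slices (hab : a < b) (hf : HypF f f' f'')
    (H : Approx a b f v0 u0 Θ0 N u v θ U V W Θ) (T : ℝ) :
    ∃ C M, 0 ≤ C ∧ 0 ≤ M ∧ (∀ x, 0 ≤ x → |f' x| ≤ M) ∧
      Slices a b T C M f f' N u v θ U V W Θ := by
  obtain ⟨M, G⟩ := HypF.nonlin hf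
  obtain ⟨C, hC, B⟩ := H.bdd T
  obtain ⟨cf, cf'⟩ := HypF.continuous hf
  have sθ : ∀ t ∈ Icc 0 T, CellLim a b N C (fun k => θ k t) (fun x => Θ x t) := fun t ht =>
    ⟨fun k => (B k).2.2.2.sup t ht, fun x _ => H.lΘ t ht.1 x⟩
  have hW := fun t (ht : t ∈ Icc 0 T) => weakCell_bwd hab H.top
    (fun k => (B k).2.2.2.grad t ht) fun x _ => H.lΘ t ht.1 x
  have sf' : ∀ t ∈ Icc 0 T, CellLim a b N M (fun k j => f' (θ k t j)) (fun x => f' (Θ x t)) :=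
    fun t ht => ⟨fun k j hj => G.slope _ ((H.sol k).nonneg t ht.1 j hj), fun x _ => by
      have := (cf'.tendsto _).comp (H.lΘ t ht.1 x)
      rw [max_eq_left (H.nonneg ht.1 x)] at this
      refine this.congr fun k => ?_
      simp only [comp_apply, max_eq_left ((H.sol k).nonneg t ht.1 _ (cell_le x))]⟩
  refine ⟨C, M, hC, G.M_nonneg, G.slope,
    fun t ht => ⟨fun k => (B k).1.sup t ht, fun x _ => H.lU t ht.1 x⟩,
    fun t ht => ⟨fun k => (B k).2.1.sup t ht, fun x _ => H.lV t ht.1 x⟩,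
    fun t ht => ⟨fun k => (B k).2.2.1.sup t ht, fun x _ => H.lW t ht.1 x⟩, sθ,
    fun t ht => ⟨fun k j hj => ?_, fun x _ => ?_⟩, fun t ht => (hW t ht).1,
    fun t ht => (hW t ht).2.1, fun t ht => (hW t ht).2.2, fun t ht => ?_⟩
  · have h0 := (H.sol k).nonneg t ht.1 j hj
    refine (G.abs_le h0).trans (mul_le_mul_of_nonneg_left ?_ G.M_nonneg)
    exact (le_abs_self _).trans ((sθ t ht).bdd k j hj)
  · have := (cf.tendsto _).comp (H.lΘ t ht.1 x)
    rwa [max_eq_left (H.nonneg ht.1 x)] at this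
  · exact (hW t ht).2.2.bwd_comp hab H.top G (fun k => (H.sol k).nonneg t ht.1) (sf' t ht)

end

section

variable {a b T : ℝ}

section TestFunctions

variable {φ : ℝ → ℝ → ℝ}

lemma hasDerivAt_pdx (h : ContDiff ℝ (⊤ : ℕ∞) (uncurry φ)) (x t : ℝ) :
    HasDerivAt (fun y => φ y t) (fderiv ℝ (uncurry φ) (x, t) (1, 0)) x :=
  ((h.differentiable (by simp)) (x, t)).hasFDerivAt.comp_hasDerivAt (f := fun y => (y, t)) x
    ((hasDerivAt_id x).prodMk (hasDerivAt_const x t))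

lemma hasDerivAt_pdt (h : ContDiff ℝ (⊤ : ℕ∞) (uncurry φ)) (x t : ℝ) :
    HasDerivAt (fun s => φ x s) (pdt φ x t) t :=
  (((h.differentiable (by simp)) (x, t)).hasFDerivAt.comp_hasDerivAt (f := fun s => (x, s)) t
    ((hasDerivAt_const t x).prodMk (hasDerivAt_id t))).differentiableAt.hasDerivAt

lemma contDiff_pdx (h : ContDiff ℝ (⊤ : ℕ∞) (uncurry φ)) :
    ContDiff ℝ (⊤ : ℕ∞) (uncurry (pdx φ)) := by
  have e : uncurry (pdx φ) = fun z => fderiv ℝ (uncurry φ) z (1, 0) := by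
    ext ⟨x, t⟩
    exact (hasDerivAt_pdx h x t).deriv
  rw [e]
  exact (h.fderiv_right (by simp)).clm_apply contDiff_const

lemma contDiff_pdt (h : ContDiff ℝ (⊤ : ℕ∞) (uncurry φ)) :
    ContDiff ℝ (⊤ : ℕ∞) (uncurry (pdt φ)) := by
  have e : uncurry (pdt φ) = fun z => fderiv ℝ (uncurry φ) z (0, 1) := by
    ext ⟨x, t⟩
    exact (((h.differentiable (by simp)) (x, t)).hasFDerivAt.comp_hasDerivAt
      (f := fun s => (x, s)) t ((hasDerivAt_const t x).prodMk (hasDerivAt_id t))).deriv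
  rw [e]
  exact (h.fderiv_right (by simp)).clm_apply contDiff_const

lemma contDiff_slice (h : ContDiff ℝ (⊤ : ℕ∞) (uncurry φ)) (t : ℝ) :
    ContDiff ℝ 1 (fun x => φ x t) :=
  (h.of_le (by exact_mod_cast le_top)).comp (contDiff_id.prodMk contDiff_const)

lemma exists_bound_rect (h : Continuous (uncurry φ)) (a b T : ℝ) :
    ∃ B, ∀ x ∈ Icc a b, ∀ t ∈ Icc 0 T, |φ x t| ≤ B := by
  obtain ⟨B, hB⟩ := (isCompact_Icc.prod isCompact_Icc).exists_bound_of_continuousOn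
    (s := Icc a b ×ˢ Icc 0 T) h.continuousOn
  exact ⟨B, fun x hx t ht => hB (x, t) ⟨hx, ht⟩⟩

lemma integrableOn_rect (h : Continuous (uncurry φ)) :
    IntegrableOn (fun p : ℝ × ℝ => φ p.1 p.2) (Ioo a b ×ˢ Ioo 0 T) :=
  (h.continuousOn.integrableOn_compact (isCompact_Icc.prod isCompact_Icc)).mono_set
    (prod_mono Ioo_subset_Icc_self Ioo_subset_Icc_self)

lemma pdt_eq_zero {T' : ℝ} (h : ∀ x t, T' ≤ t → φ x t = 0) {x t : ℝ} (ht : T' < t) :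
    pdt φ x t = 0 := by
  have : (fun s => φ x s) =ᶠ[nhds t] fun _ => 0 := by
    filter_upwards [lt_mem_nhds ht] with s hs
    exact h x s hs.le
  rw [pdt, this.deriv_eq, deriv_const]

end TestFunctions

lemma intOmT_eq {F : ℝ → ℝ → ℝ} (hT : 0 < T)
    (hF : IntegrableOn (fun p : ℝ × ℝ => F p.1 p.2) (Ioo a b ×ˢ Ioo 0 T)) :
    intOmT a b T F = ∫ t in (0 : ℝ)..T, ∫ x in Ioo a b, F x t := by
  rw [intOmT, Measure.volume_eq_prod, ← Measure.prod_restrict, integral_prod_symm,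
    intervalIntegral.integral_of_le hT.le, integral_Ioc_eq_integral_Ioo]
  rwa [IntegrableOn, Measure.volume_eq_prod, ← Measure.prod_restrict] at hF

/-- Limits of time integrals of slices. -/
lemma tendsto_intOmT {S : ℕ → ℝ → ℝ} {F : ℝ → ℝ → ℝ} {B : ℝ} (hT : 0 < T)
    (hF : IntegrableOn (fun p : ℝ × ℝ => F p.1 p.2) (Ioo a b ×ˢ Ioo 0 T))
    (hc : ∀ k, ContinuousOn (S k) (Icc 0 T)) (hb : ∀ t ∈ Icc 0 T, ∀ k, |S k t| ≤ B)
    (hl : ∀ t ∈ Icc 0 T, Tendsto (fun k => S k t) atTop (nhds (∫ x in Ioo a b, F x t))) :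
    Tendsto (fun k => ∫ t in (0 : ℝ)..T, S k t) atTop (nhds (intOmT a b T F)) := by
  rw [intOmT_eq hT hF]
  have sub : uIoc 0 T ⊆ Icc 0 T := by
    rw [uIoc_of_le hT.le]; exact Ioc_subset_Icc_self
  refine intervalIntegral.tendsto_integral_filter_of_dominated_convergence (fun _ => B)
    (Eventually.of_forall fun k =>
      ((hc k).mono sub).aestronglyMeasurable measurableSet_uIoc)
    (Eventually.of_forall fun k => Eventually.of_forall fun t ht => hb t (sub ht) k)
    intervalIntegrable_const (Eventually.of_forall fun t ht => hl t (sub ht))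

lemma continuousOn_ip {n : ℕ} {h : ℝ} {s : Set ℝ} {p q : ℝ → ℕ → ℝ}
    (hp : ∀ j ≤ n, ContinuousOn (fun t => p t j) s) (hq : ∀ j ≤ n, ContinuousOn (fun t => q t j) s) :
    ContinuousOn (fun t => ip n h (p t) (q t)) s := by
  unfold ip
  refine continuousOn_const.mul (continuousOn_finsetSum _ fun j hj => ?_)
  have : j ≤ n := by simpa [Nat.lt_succ_iff] using hj
  exact (hp j this).mul (hq j this)

end

section

section Discrete

variable {n : ℕ} {h T : ℝ} {g : ℝ → ℝ} {u v θ : ℝ → ℕ → ℝ}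

lemma DSol.continuousOn_u (S : DSol n h g u v θ) {j : ℕ} (hj : j ≤ n + 1) :
    ContinuousOn (fun t => u t j) (Icc 0 T) := fun t ht =>
  (S.du t ht.1 j hj).continuousAt.continuousWithinAt

lemma DSol.continuousOn_v (S : DSol n h g u v θ) {j : ℕ} (hj : j ≤ n + 1) :
    ContinuousOn (fun t => v t j) (Icc 0 T) := fun t ht =>
  (S.dv t ht.1 j hj).continuousAt.continuousWithinAt

lemma DSol.continuousOn_θ (S : DSol n h g u v θ) {j : ℕ} (hj : j ≤ n) :
    ContinuousOn (fun t => θ t j) (Icc 0 T) := fun t ht =>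
  (S.dθ t ht.1 j hj).continuousAt.continuousWithinAt

lemma continuousOn_fwd {w : ℝ → ℕ → ℝ} {s : Set ℝ}
    (hw : ∀ j ≤ n + 1, ContinuousOn (fun t => w t j) s) {j : ℕ} (hj : j ≤ n) :
    ContinuousOn (fun t => fwd h (w t) j) s :=
  ((hw (j + 1) (by omega)).sub (hw j (by omega))).div_const h

lemma continuousOn_bwd {w : ℝ → ℕ → ℝ} {s : Set ℝ}
    (hw : ∀ j ≤ n, ContinuousOn (fun t => w t j) s) (j : ℕ) (hj : j ≤ n) :
    ContinuousOn (fun t => bwd n h (w t) j) s :=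
  ((hw _ (min_le_right _ _)).sub (hw (j - 1) (by omega))).div_const h

lemma integral_eq_sub_of_hasDerivAt_Icc {E E' : ℝ → ℝ} (hT : 0 < T)
    (hE : ∀ t, 0 ≤ t → HasDerivAt E (E' t) t) (hc : ContinuousOn E' (Icc 0 T)) :
    ∫ t in (0 : ℝ)..T, E' t = E T - E 0 :=
  intervalIntegral.integral_eq_sub_of_hasDerivAt
    (fun t ht => hE t (by rw [uIcc_of_le hT.le] at ht; exact ht.1))
    (ContinuousOn.intervalIntegrable (by rwa [uIcc_of_le hT.le]))

variable {φ φt φtt : ℝ → ℕ → ℝ}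

lemma DSol.weak_time (S : DSol n h g u v θ) (hT : 0 < T)
    (h1 : ∀ t, 0 ≤ t → ∀ j ≤ n, HasDerivAt (fun s => φ s j) (φt t j) t)
    (hc : ∀ j ≤ n, ContinuousOn (fun t => φt t j) (Icc 0 T))
    (h0 : ∀ j ≤ n, φ 0 j = 0) (hT' : ∀ j ≤ n, φ T j = 0) :
    (∫ t in (0 : ℝ)..T, ip n h (u t) (φt t)) = - ∫ t in (0 : ℝ)..T, ip n h (v t) (φ t) := by
  have cφ : ∀ j ≤ n, ContinuousOn (fun t => φ t j) (Icc 0 T) := fun j hj t ht =>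
    (h1 t ht.1 j hj).continuousAt.continuousWithinAt
  have c1 : ContinuousOn (fun t => ip n h (v t) (φ t)) (Icc 0 T) :=
    continuousOn_ip (fun j hj => S.continuousOn_v (by omega)) cφ
  have c2 : ContinuousOn (fun t => ip n h (u t) (φt t)) (Icc 0 T) :=
    continuousOn_ip (fun j hj => S.continuousOn_u (by omega)) hc
  have key := integral_eq_sub_of_hasDerivAt_Icc hT (fun t ht =>
    hasDerivAt_ip (fun j hj => S.du t ht j (by omega)) (h1 t ht)) (c1.add c2)
  have z : ∀ p q : ℕ → ℝ, (∀ j ≤ n, q j = 0) → ip n h p q = 0 := fun p q hq => by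
    rw [ip_congr (p' := p) (q' := fun _ => 0) (fun _ _ => rfl) hq]
    simp [ip]
  rw [z _ _ h0, z _ _ hT', intervalIntegral.integral_add
    (ContinuousOn.intervalIntegrable (by rwa [uIcc_of_le hT.le]))
    (ContinuousOn.intervalIntegrable (by rwa [uIcc_of_le hT.le]))] at key
  linarith

lemma DSol.weak_wave (S : DSol n h g u v θ) (hT : 0 < T) (hg : Continuous g)
    (h1 : ∀ t, 0 ≤ t → ∀ j ≤ n + 1, HasDerivAt (fun s => φ s j) (φt t j) t)
    (h2 : ∀ t, 0 ≤ t → ∀ j ≤ n, HasDerivAt (fun s => φt s j) (φtt t j) t)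
    (hc : ∀ j ≤ n, ContinuousOn (fun t => φtt t j) (Icc 0 T))
    (hb : ∀ t, φ t 0 = 0) (hb' : ∀ t, φ t (n + 1) = 0)
    (hT' : ∀ j ≤ n, φ T j = 0) (hT'' : ∀ j ≤ n, φt T j = 0) :
    (∫ t in (0 : ℝ)..T, ip n h (fwd h (u t)) (fwd h (φ t)))
        + (∫ t in (0 : ℝ)..T, ip n h (bwd n h fun j => g (θ t j)) (φ t))
        + (∫ t in (0 : ℝ)..T, ip n h (u t) (φtt t))
      = ip n h (v 0) (φ 0) - ip n h (u 0) (φt 0) := by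
  have cφ : ∀ j ≤ n + 1, ContinuousOn (fun t => φ t j) (Icc 0 T) := fun j hj t ht =>
    (h1 t ht.1 j hj).continuousAt.continuousWithinAt
  have c1 : ContinuousOn (fun t => ip n h (fwd h (u t)) (fwd h (φ t))) (Icc 0 T) :=
    continuousOn_ip (fun j hj => continuousOn_fwd (fun i hi => S.continuousOn_u hi) hj)
      fun j hj => continuousOn_fwd cφ hj
  have c2 : ContinuousOn (fun t => ip n h (bwd n h fun j => g (θ t j)) (φ t)) (Icc 0 T) :=
    continuousOn_ip (continuousOn_bwd fun j hj => hg.comp_continuousOn (S.continuousOn_θ hj))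
      fun j hj => cφ j (by omega)
  have c3 : ContinuousOn (fun t => ip n h (u t) (φtt t)) (Icc 0 T) :=
    continuousOn_ip (fun j hj => S.continuousOn_u (by omega)) hc
  have hd : ∀ t, 0 ≤ t → HasDerivAt
      (fun s => ip n h (u s) (φt s) - ip n h (v s) (φ s))
      (ip n h (fwd h (u t)) (fwd h (φ t)) + ip n h (bwd n h fun j => g (θ t j)) (φ t)
        + ip n h (u t) (φtt t)) t := fun t ht => by
    have d1 := hasDerivAt_ip (h := h) (fun j (hj : j ≤ n) => S.du t ht j (by omega)) (h2 t ht)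
    have d2 := hasDerivAt_ip (h := h) (fun j (hj : j ≤ n) => S.dv t ht j (by omega))
      (fun j hj => h1 t ht j (by omega))
    refine (d1.sub d2).congr_deriv ?_
    rw [ip_sub_left, ip_fwd _ _ (hb t) (hb' t)]
    ring
  have key := integral_eq_sub_of_hasDerivAt_Icc hT hd ((c1.add c2).add c3)
  have z : ∀ p q : ℕ → ℝ, (∀ j ≤ n, q j = 0) → ip n h p q = 0 := fun p q hq => by
    rw [ip_congr (p' := p) (q' := fun _ => 0) (fun _ _ => rfl) hq]
    simp [ip]
  rw [z _ _ hT', z _ _ hT'', intervalIntegral.integral_add, intervalIntegral.integral_add] at key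
  · linarith
  all_goals
    refine ContinuousOn.intervalIntegrable ?_
    rw [uIcc_of_le hT.le]
    first | exact c1 | exact c2 | exact c3 | exact c1.add c2

lemma bwd_mul {p q : ℕ → ℝ} {j : ℕ} (hj : j ≤ n) :
    bwd n h (fun i => p i * q i) j = p j * bwd n h q j + bwd n h p j * q (j - 1) := by
  rw [bwd_of_le hj, bwd_of_le hj, bwd_of_le hj]
  ring

lemma DSol.weak_heat (S : DSol n h g u v θ) (hT : 0 < T) (hg : Continuous g)
    (h1 : ∀ t, 0 ≤ t → ∀ j ≤ n, HasDerivAt (fun s => φ s j) (φt t j) t)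
    (hc : ∀ j ≤ n, ContinuousOn (fun t => φt t j) (Icc 0 T)) (hT' : ∀ j ≤ n, φ T j = 0) :
    (∫ t in (0 : ℝ)..T, ip n h (bwd n h fun j => g (θ t j)) (fun j => v t j * φ t (j - 1)))
        + (∫ t in (0 : ℝ)..T, ip n h (fun j => g (θ t j) * v t j) (bwd n h (φ t)))
        - (∫ t in (0 : ℝ)..T, ip n h (bwd n h (θ t)) (bwd n h (φ t)))
        + (∫ t in (0 : ℝ)..T, ip n h (θ t) (φt t))
      = - ip n h (θ 0) (φ 0) := by
  have cφ : ∀ j ≤ n, ContinuousOn (fun t => φ t j) (Icc 0 T) := fun j hj t ht =>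
    (h1 t ht.1 j hj).continuousAt.continuousWithinAt
  have cg : ∀ j ≤ n, ContinuousOn (fun t => g (θ t j)) (Icc 0 T) := fun j hj =>
    hg.comp_continuousOn (S.continuousOn_θ hj)
  have cv : ∀ j ≤ n, ContinuousOn (fun t => v t j) (Icc 0 T) := fun j hj =>
    S.continuousOn_v (by omega)
  have c1 : ContinuousOn (fun t => ip n h (bwd n h fun j => g (θ t j))
      (fun j => v t j * φ t (j - 1))) (Icc 0 T) :=
    continuousOn_ip (continuousOn_bwd cg) fun j hj => (cv j hj).mul (cφ _ (by omega))
  have c2 : ContinuousOn (fun t => ip n h (fun j => g (θ t j) * v t j) (bwd n h (φ t)))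
      (Icc 0 T) :=
    continuousOn_ip (fun j hj => (cg j hj).mul (cv j hj)) (continuousOn_bwd cφ)
  have c3 : ContinuousOn (fun t => ip n h (bwd n h (θ t)) (bwd n h (φ t))) (Icc 0 T) :=
    continuousOn_ip (continuousOn_bwd fun j hj => S.continuousOn_θ hj) (continuousOn_bwd cφ)
  have c4 : ContinuousOn (fun t => ip n h (θ t) (φt t)) (Icc 0 T) :=
    continuousOn_ip (fun j hj => S.continuousOn_θ hj) hc
  have hd : ∀ t, 0 ≤ t → HasDerivAt (fun s => ip n h (θ s) (φ s))
      (ip n h (bwd n h fun j => g (θ t j)) (fun j => v t j * φ t (j - 1))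
        + ip n h (fun j => g (θ t j) * v t j) (bwd n h (φ t))
        - ip n h (bwd n h (θ t)) (bwd n h (φ t)) + ip n h (θ t) (φt t)) t := fun t ht => by
    refine (hasDerivAt_ip (S.dθ t ht) (h1 t ht)).congr_deriv ?_
    have e1 : ip n h (fwd h (bwd n h (θ t))) (φ t) = - ip n h (bwd n h (θ t)) (bwd n h (φ t)) := by
      rw [ip_comm, ip_fwd _ _ (by simp) (by simp), ip_comm]
    have e2 : ip n h (fun j => g (θ t j) * fwd h (v t) j) (φ t) =
        - (ip n h (bwd n h fun j => g (θ t j)) (fun j => v t j * φ t (j - 1))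
          + ip n h (fun j => g (θ t j) * v t j) (bwd n h (φ t))) := by
      have : ip n h (fun j => g (θ t j) * fwd h (v t) j) (φ t) =
          ip n h (fun j => g (θ t j) * φ t j) (fwd h (v t)) := by
        unfold ip
        congr 1
        exact Finset.sum_congr rfl fun j _ => by ring
      rw [this, ip_fwd _ _ (S.vb t ht).1 (S.vb t ht).2]
      congr 1
      unfold ip
      rw [← mul_add, ← Finset.sum_add_distrib]
      congr 1
      refine Finset.sum_congr rfl fun j hj => ?_
      rw [bwd_mul (by simpa [Nat.lt_succ_iff] using hj)]
      ring
    rw [ip_sub_left, e1, e2]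
    ring
  have key := integral_eq_sub_of_hasDerivAt_Icc hT hd (((c1.add c2).sub c3).add c4)
  have z : ip n h (θ T) (φ T) = 0 := by
    rw [ip_congr (p' := θ T) (q' := fun _ => 0) (fun _ _ => rfl) hT']
    simp [ip]
  rw [z, intervalIntegral.integral_add, intervalIntegral.integral_sub,
    intervalIntegral.integral_add] at key
  · linarith
  all_goals
    refine ContinuousOn.intervalIntegrable ?_
    rw [uIcc_of_le hT.le]
    first | exact c1 | exact c2 | exact c3 | exact c4 | exact c1.add c2 | exact (c1.add c2).sub c3

end Discrete

end

section

variable {a b : ℝ} {N : ℕ → ℕ} {f f' f'' v0 u0 Θ0 : ℝ → ℝ} {u v θ : ℕ → ℝ → ℕ → ℝ}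
  {U V W Θ : ℝ → ℝ → ℝ} {T : ℝ}

lemma isFiniteMeasure_rect (a b T : ℝ) :
    IsFiniteMeasure (volume.restrict (Ioo a b ×ˢ Ioo 0 T) : Measure (ℝ × ℝ)) :=
  isFiniteMeasure_restrict.2 (((Metric.isBounded_Ioo a b).prod
    (Metric.isBounded_Ioo 0 T)).measure_lt_top).ne

lemma measurable_pdx (hΘ : Continuous (uncurry Θ)) :
    Measurable (fun p : ℝ × ℝ => pdx Θ p.1 p.2) :=
  (measurable_deriv_with_param (f := fun t x => Θ x t) (hΘ.comp continuous_swap)).comp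
    measurable_swap

lemma Approx.integrable_sq (hab : a < b) (hf : HypF f f' f'')
    (H : Approx a b f v0 u0 Θ0 N u v θ U V W Θ) :
    IntegrableOn (fun p : ℝ × ℝ => pdx Θ p.1 p.2 ^ 2) (Ioo a b ×ˢ Ioo 0 T) := by
  obtain ⟨C, M, hC, -, -, S⟩ := H.slices hab hf T
  have hm : Measurable (fun p : ℝ × ℝ => pdx Θ p.1 p.2 ^ 2) := (measurable_pdx H.cΘ).pow_const 2
  rw [IntegrableOn, Measure.volume_eq_prod, ← Measure.prod_restrict,
    integrable_prod_iff' hm.aestronglyMeasurable]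
  refine ⟨(ae_restrict_iff' measurableSet_Ioo).2 (Eventually.of_forall fun t ht =>
    (S.memLp t (Ioo_subset_Icc_self ht)).integrable_sq), ?_⟩
  refine Integrable.of_bound
    (hm.aestronglyMeasurable.norm.prod_swap.integral_prod_right') C
    ((ae_restrict_iff' measurableSet_Ioo).2 (Eventually.of_forall fun t ht => ?_))
  have h0 : ∀ x, ‖pdx Θ x t ^ 2‖ = pdx Θ x t ^ 2 := fun x => by
    rw [Real.norm_eq_abs, abs_of_nonneg (sq_nonneg _)]
  simp only [h0]
  rw [Real.norm_eq_abs, abs_of_nonneg (integral_nonneg fun x => sq_nonneg _)]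
  exact S.sq_le t (Ioo_subset_Icc_self ht)

lemma Approx.integrable_mul (hab : a < b) (hf : HypF f f' f'')
    (H : Approx a b f v0 u0 Θ0 N u v θ U V W Θ) {ψ : ℝ → ℝ → ℝ} (hψ : Continuous (uncurry ψ)) :
    IntegrableOn (fun p : ℝ × ℝ => pdx Θ p.1 p.2 * ψ p.1 p.2) (Ioo a b ×ˢ Ioo 0 T) := by
  have := isFiniteMeasure_rect a b T
  obtain ⟨B, hB⟩ := exists_bound_rect hψ a b T
  have h1 : IntegrableOn (fun p : ℝ × ℝ => pdx Θ p.1 p.2) (Ioo a b ×ˢ Ioo 0 T) :=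
    ((memLp_two_iff_integrable_sq (measurable_pdx H.cΘ).aestronglyMeasurable).2
      (H.integrable_sq hab hf)).integrable one_le_two
  refine Integrable.mul_bdd (c := B) h1 hψ.aestronglyMeasurable ?_
  exact (ae_restrict_iff' (measurableSet_Ioo.prod measurableSet_Ioo)).2
    (Eventually.of_forall fun p hp => hB _ (Ioo_subset_Icc_self hp.1) _ (Ioo_subset_Icc_self hp.2))

lemma Approx.integrable_slope_mul (hab : a < b) (hf : HypF f f' f'')
    (H : Approx a b f v0 u0 Θ0 N u v θ U V W Θ) {ψ : ℝ → ℝ → ℝ} (hψ : Continuous (uncurry ψ)) :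
    IntegrableOn (fun p : ℝ × ℝ => f' (Θ p.1 p.2) * pdx Θ p.1 p.2 * ψ p.1 p.2)
      (Ioo a b ×ˢ Ioo 0 T) := by
  have hc : Continuous (uncurry fun x t => f' (max (Θ x t) 0) * ψ x t) :=
    ((HypF.continuous hf).2.comp H.cΘ).mul hψ
  refine (H.integrable_mul hab hf hc).congr_fun (fun p hp => ?_)
    (measurableSet_Ioo.prod measurableSet_Ioo)
  simp only [max_eq_left (H.nonneg hp.2.1.le p.1)]
  ring

lemma Approx.integrable_comp_mul (hf : HypF f f' f'')
    (H : Approx a b f v0 u0 Θ0 N u v θ U V W Θ) {ψ : ℝ → ℝ → ℝ} (hψ : Continuous (uncurry ψ)) :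
    IntegrableOn (fun p : ℝ × ℝ => f (Θ p.1 p.2) * ψ p.1 p.2) (Ioo a b ×ˢ Ioo 0 T) := by
  have hc : Continuous (uncurry fun x t => f (max (Θ x t) 0) * ψ x t) :=
    ((HypF.continuous hf).1.comp H.cΘ).mul hψ
  refine (integrableOn_rect (φ := fun x t => f (max (Θ x t) 0) * ψ x t) hc).congr_fun
    (fun p hp => ?_) (measurableSet_Ioo.prod measurableSet_Ioo)
  simp only [max_eq_left (H.nonneg hp.2.1.le p.1)]

lemma Approx.weakDerivI (hab : a < b) (hf : HypF f f' f'')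
    (H : Approx a b f v0 u0 Θ0 N u v θ U V W Θ) {t : ℝ} (ht : 0 ≤ t) :
    WeakDerivI a b (fun x => Θ x t) (fun x => pdx Θ x t) := by
  intro ψ hψ hs
  obtain ⟨C, M, hC, -, -, S⟩ := H.slices hab hf t
  have htt : t ∈ Icc 0 t := ⟨ht, le_rfl⟩
  have hψ1 : ContDiff ℝ 1 ψ := hψ.of_le (by exact_mod_cast le_top)
  obtain ⟨B, hB⟩ := isCompact_Icc.exists_bound_of_continuousOn (s := Icc a b)
    hψ1.continuous.continuousOn
  obtain ⟨B', hB'⟩ := isCompact_Icc.exists_bound_of_continuousOn (s := Icc a b)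
    (hψ1.continuous_deriv le_rfl).continuousOn
  have za : ψ a = 0 := image_eq_zero_of_notMem_tsupport fun h => lt_irrefl _ (hs h).1
  have zb : ψ b = 0 := image_eq_zero_of_notMem_tsupport fun h => lt_irrefl _ (hs h).2
  have l1 := (S.sθ t htt).ip_tendsto hab (cellLim_fwd hab H.top hψ1 hB')
  have l2 := (S.sθx t htt).lim _ _ _ (cellLim_of_continuous hab H.top hψ1.continuous hB)
  refine tendsto_nhds_unique l1 (l2.neg.congr fun k => (ip_fwd _ _ ?_ ?_).symm)
  · simpa using za
  · push_cast
    rw [mul_mesh]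
    simpa using zb

lemma Approx.weakDerivZ (hab : a < b) (hf : HypF f f' f'')
    (H : Approx a b f v0 u0 Θ0 N u v θ U V W Θ) {t : ℝ} (ht : 0 ≤ t) :
    WeakDerivZ a b (fun x => U x t) (fun x => W x t) := by
  intro ψ hψ
  obtain ⟨C, M, hC, -, -, S⟩ := H.slices hab hf t
  have htt : t ∈ Icc 0 t := ⟨ht, le_rfl⟩
  have hψ1 : ContDiff ℝ 1 ψ := hψ.of_le (by exact_mod_cast le_top)
  obtain ⟨B, hB⟩ := isCompact_Icc.exists_bound_of_continuousOn (s := Icc a b)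
    hψ1.continuous.continuousOn
  obtain ⟨B', hB'⟩ := isCompact_Icc.exists_bound_of_continuousOn (s := Icc a b)
    (hψ1.continuous_deriv le_rfl).continuousOn
  have l1 := (S.su t htt).ip_tendsto hab (cellLim_bwd hab H.top hψ1 hB')
  have l2 := (S.sw t htt).ip_tendsto hab (cellLim_of_continuous hab H.top hψ1.continuous hB)
  refine tendsto_nhds_unique l1 (l2.neg.congr fun k => ?_)
  rw [ip_comm, ip_fwd _ _ ((H.sol k).ub t ht).1 ((H.sol k).ub t ht).2, neg_neg, ip_comm]

end

section

variable {a b : ℝ} {N : ℕ → ℕ} {f f' f'' v0 u0 Θ0 : ℝ → ℝ} {u v θ : ℕ → ℝ → ℕ → ℝ}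
  {U V W Θ : ℝ → ℝ → ℝ} {T : ℝ} {φ : ℝ → ℝ → ℝ}

lemma continuous_slice (h : Continuous (uncurry φ)) (t : ℝ) : Continuous fun x => φ x t :=
  h.comp (continuous_id.prodMk continuous_const)

lemma continuous_time (h : Continuous (uncurry φ)) (x : ℝ) : Continuous fun t => φ x t :=
  h.comp (continuous_const.prodMk continuous_id)

lemma CellLim.of_init (hab : a < b) (hN : Tendsto N atTop atTop) {p : ℕ → ℕ → ℝ} {P ψ : ℝ → ℝ}
    {C : ℝ} (H : CellLim a b N C p P) (hψ : Continuous ψ)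
    (h : ∀ k, ∀ j ≤ N k, p k j = ψ (a + j * mesh a b (N k))) : CellLim a b N C p ψ :=
  ⟨H.bdd, fun x hx => ((hψ.tendsto _).comp (tendsto_node hab hN ⟨hx.1.le, hx.2.le⟩)).congr
    fun k => (h k _ (cell_le x)).symm⟩

lemma Approx.weak_time (hab : a < b) (hf : HypF f f' f'')
    (H : Approx a b f v0 u0 Θ0 N u v θ U V W Θ) (hT : 0 < T) (hφ : TestInt a b T φ) :
    intOmT a b T (fun x t => U x t * pdt φ x t) = - intOmT a b T (fun x t => V x t * φ x t) := by
  obtain ⟨C, M, hC, -, -, S⟩ := H.slices hab hf T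
  have s0 := hφ.smooth.continuous
  have s1 := (contDiff_pdt hφ.smooth).continuous
  obtain ⟨B, hB⟩ := exists_bound_rect s0 a b T
  obtain ⟨B1, hB1⟩ := exists_bound_rect s1 a b T
  have c0 := fun t ht => cellLim_of_continuous hab H.top (continuous_slice s0 t)
    fun x hx => hB x hx t ht
  have c1 := fun t ht => cellLim_of_continuous hab H.top (continuous_slice s1 t)
    fun x hx => hB1 x hx t ht
  have z : ∀ t, t ∉ Ioo 0 T → ∀ x, φ x t = 0 := fun t ht x => by
    obtain ⟨K, -, hK, hz⟩ := hφ.supptime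
    exact hz x t fun h => ht (hK h)
  have l1 := tendsto_intOmT (F := fun x t => U x t * pdt φ x t) hT
    (integrableOn_rect (φ := fun x t => U x t * pdt φ x t) (H.cU.mul s1))
    (fun k => continuousOn_ip (fun j hj => (H.sol k).continuousOn_u (by omega))
      fun j _ => (continuous_time s1 _).continuousOn)
    (fun t ht k => (S.su t ht).abs_ip_le hab (c1 t ht) k)
    (fun t ht => (S.su t ht).ip_tendsto hab (c1 t ht))
  have l2 := tendsto_intOmT (F := fun x t => V x t * φ x t) hT
    (integrableOn_rect (φ := fun x t => V x t * φ x t) (H.cV.mul s0))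
    (fun k => continuousOn_ip (fun j hj => (H.sol k).continuousOn_v (by omega))
      fun j _ => (continuous_time s0 _).continuousOn)
    (fun t ht k => (S.sv t ht).abs_ip_le hab (c0 t ht) k)
    (fun t ht => (S.sv t ht).ip_tendsto hab (c0 t ht))
  refine tendsto_nhds_unique l1 (l2.neg.congr fun k => ?_)
  exact ((H.sol k).weak_time hT (fun t _ j _ => hasDerivAt_pdt hφ.smooth _ t)
    (fun j _ => (continuous_time s1 _).continuousOn) (fun j _ => z 0 (by simp) _)
    (fun j _ => z T (by simp) _)).symm

lemma Approx.weak_wave (hab : a < b) (hf : HypF f f' f'') (hu0 : Continuous u0)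
    (hv0 : Continuous v0) (H : Approx a b f v0 u0 Θ0 N u v θ U V W Θ) (hT : 0 < T)
    (hφ : TestU a b T φ) :
    intOmT a b T (fun x t => U x t * pdt (pdt φ) x t)
        - intOm a b (fun x => v0 x * φ x 0) + intOm a b (fun x => u0 x * pdt φ x 0)
      = - intOmT a b T (fun x t => W x t * pdx φ x t)
        - intOmT a b T (fun x t => f' (Θ x t) * pdx Θ x t * φ x t) := by
  obtain ⟨C, M, hC, -, -, S⟩ := H.slices hab hf T
  have h0 : (0 : ℝ) ∈ Icc 0 T := ⟨le_rfl, hT.le⟩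
  have s0 := hφ.smooth.continuous
  have s1 := (contDiff_pdt hφ.smooth).continuous
  have s2 := (contDiff_pdt (contDiff_pdt hφ.smooth)).continuous
  have sx := (contDiff_pdx hφ.smooth).continuous
  obtain ⟨B, hB⟩ := exists_bound_rect s0 a b T
  obtain ⟨B1, hB1⟩ := exists_bound_rect s1 a b T
  obtain ⟨B2, hB2⟩ := exists_bound_rect s2 a b T
  obtain ⟨Bx, hBx⟩ := exists_bound_rect sx a b T
  have c0 := fun t ht => cellLim_of_continuous hab H.top (continuous_slice s0 t)
    fun x hx => hB x hx t ht
  have c1 := fun t ht => cellLim_of_continuous hab H.top (continuous_slice s1 t)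
    fun x hx => hB1 x hx t ht
  have c2 := fun t ht => cellLim_of_continuous hab H.top (continuous_slice s2 t)
    fun x hx => hB2 x hx t ht
  have cx := fun t ht => cellLim_fwd hab H.top (contDiff_slice hφ.smooth t)
    fun x hx => hBx x hx t ht
  have l1 := tendsto_intOmT (F := fun x t => W x t * pdx φ x t) hT
    (integrableOn_rect (φ := fun x t => W x t * pdx φ x t) (H.cW.mul sx))
    (fun k => continuousOn_ip
      (fun j hj => continuousOn_fwd (fun i hi => (H.sol k).continuousOn_u hi) hj)
      fun j hj => continuousOn_fwd (n := N k) (fun i _ => (continuous_time s0 _).continuousOn) hj)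
    (fun t ht k => (S.sw t ht).abs_ip_le hab (cx t ht) k)
    (fun t ht => (S.sw t ht).ip_tendsto hab (cx t ht))
  have l2 := tendsto_intOmT (F := fun x t => f' (Θ x t) * pdx Θ x t * φ x t) hT
    (H.integrable_slope_mul hab hf s0)
    (fun k => continuousOn_ip (continuousOn_bwd fun j hj =>
      (HypF.continuous hf).1.comp_continuousOn ((H.sol k).continuousOn_θ hj))
      fun j _ => (continuous_time s0 _).continuousOn)
    (fun t ht k => (S.sgx t ht).abs_ip_le hab (c0 t ht) k)
    (fun t ht => (S.sgx t ht).lim _ _ _ (c0 t ht))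
  have l3 := tendsto_intOmT (F := fun x t => U x t * pdt (pdt φ) x t) hT
    (integrableOn_rect (φ := fun x t => U x t * pdt (pdt φ) x t) (H.cU.mul s2))
    (fun k => continuousOn_ip (fun j hj => (H.sol k).continuousOn_u (by omega))
      fun j _ => (continuous_time s2 _).continuousOn)
    (fun t ht k => (S.su t ht).abs_ip_le hab (c2 t ht) k)
    (fun t ht => (S.su t ht).ip_tendsto hab (c2 t ht))
  have l4 := ((S.sv 0 h0).of_init hab H.top hv0 fun k j hj =>
    H.v_zero k j (by omega)).ip_tendsto hab (c0 0 h0)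
  have l5 := ((S.su 0 h0).of_init hab H.top hu0 fun k j hj =>
    H.u_zero k j (by omega)).ip_tendsto hab (c1 0 h0)
  obtain ⟨T', hT', hz⟩ := hφ.suppt
  obtain ⟨K, -, hK, hzK⟩ := hφ.suppx
  have key := tendsto_nhds_unique ((l1.add l2).add l3) ((l4.sub l5).congr fun k => by
    refine ((H.sol k).weak_wave hT (HypF.continuous hf).1
      (fun t _ j _ => hasDerivAt_pdt hφ.smooth _ t)
      (fun t _ j _ => hasDerivAt_pdt (contDiff_pdt hφ.smooth) _ t)
      (fun j _ => (continuous_time s2 _).continuousOn) (fun t => hzK _ _ fun h => ?_)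
      (fun t => hzK _ _ fun h => ?_) (fun j _ => hz _ _ hT'.le)
      (fun j _ => pdt_eq_zero hz hT')).symm
    · have := (hK h).1
      simp at this
    · have := (hK h).2
      push_cast at this
      rw [mul_mesh] at this
      linarith)
  simp only [intOm]
  linarith

lemma Approx.weak_heat (hab : a < b) (hf : HypF f f' f'') (hΘ0 : Continuous Θ0)
    (H : Approx a b f v0 u0 Θ0 N u v θ U V W Θ) (hT : 0 < T) (hφ : TestT T φ) :
    - intOmT a b T (fun x t => Θ x t * pdt φ x t) - intOm a b (fun x => Θ0 x * φ x 0)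
      = - intOmT a b T (fun x t => pdx Θ x t * pdx φ x t)
        + intOmT a b T (fun x t => f' (Θ x t) * pdx Θ x t * V x t * φ x t)
        + intOmT a b T (fun x t => f (Θ x t) * V x t * pdx φ x t) := by
  obtain ⟨C, M, hC, -, -, S⟩ := H.slices hab hf T
  have h0 : (0 : ℝ) ∈ Icc 0 T := ⟨le_rfl, hT.le⟩
  have s0 := hφ.smooth.continuous
  have s1 := (contDiff_pdt hφ.smooth).continuous
  have sx := (contDiff_pdx hφ.smooth).continuous
  obtain ⟨B, hB⟩ := exists_bound_rect s0 a b T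
  obtain ⟨B1, hB1⟩ := exists_bound_rect s1 a b T
  obtain ⟨Bx, hBx⟩ := exists_bound_rect sx a b T
  have c0 := fun t ht => cellLim_of_continuous hab H.top (continuous_slice s0 t)
    fun x hx => hB x hx t ht
  have cp := fun t ht => cellLim_pred_of_continuous hab H.top (continuous_slice s0 t)
    fun x hx => hB x hx t ht
  have c1 := fun t ht => cellLim_of_continuous hab H.top (continuous_slice s1 t)
    fun x hx => hB1 x hx t ht
  have cx := fun t ht => cellLim_bwd hab H.top (contDiff_slice hφ.smooth t)
    fun x hx => hBx x hx t ht
  have kv : ∀ k, ∀ j ≤ N k, ContinuousOn (fun t => v k t j) (Icc 0 T) := fun k j hj =>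
    (H.sol k).continuousOn_v (by omega)
  have kg : ∀ k, ∀ j ≤ N k, ContinuousOn (fun t => f (max (θ k t j) 0)) (Icc 0 T) :=
    fun k j hj => (HypF.continuous hf).1.comp_continuousOn ((H.sol k).continuousOn_θ hj)
  have kx : ∀ k, ∀ j ≤ N k, ContinuousOn (fun t => bwd (N k) (mesh a b (N k))
      (fun j => φ (a + j * mesh a b (N k)) t) j) (Icc 0 T) := fun k =>
    continuousOn_bwd fun j _ => (continuous_time s0 _).continuousOn
  have l1 := tendsto_intOmT (F := fun x t => f' (Θ x t) * pdx Θ x t * (V x t * φ x t)) hT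
    (H.integrable_slope_mul hab hf (ψ := fun x t => V x t * φ x t) (H.cV.mul s0))
    (fun k => continuousOn_ip (continuousOn_bwd (kg k)) fun j hj =>
      show ContinuousOn (fun t => v k t j * φ (a + ((j - 1 : ℕ) : ℝ) * mesh a b (N k)) t) (Icc 0 T) from
        (kv k j hj).mul (continuous_time s0 _).continuousOn)
    (fun t ht k => (S.sgx t ht).abs_ip_le hab ((S.sv t ht).mul (cp t ht)) k)
    (fun t ht => (S.sgx t ht).lim _ _ _ ((S.sv t ht).mul (cp t ht)))
  have hi : IntegrableOn (fun p : ℝ × ℝ => f (Θ p.1 p.2) * V p.1 p.2 * pdx φ p.1 p.2)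
      (Ioo a b ×ˢ Ioo 0 T) := by
    have := H.integrable_comp_mul (T := T) hf (ψ := fun x t => V x t * pdx φ x t) (H.cV.mul sx)
    simpa only [mul_assoc] using this
  have l2 := tendsto_intOmT (F := fun x t => f (Θ x t) * V x t * pdx φ x t) hT
    hi
    (fun k => continuousOn_ip (fun j hj => (kg k j hj).mul (kv k j hj)) (kx k))
    (fun t ht k => ((S.sg t ht).mul (S.sv t ht)).abs_ip_le hab (cx t ht) k)
    (fun t ht => ((S.sg t ht).mul (S.sv t ht)).ip_tendsto hab (cx t ht))
  have l3 := tendsto_intOmT (F := fun x t => pdx Θ x t * pdx φ x t) hT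
    (H.integrable_mul hab hf sx)
    (fun k => continuousOn_ip (continuousOn_bwd fun j hj => (H.sol k).continuousOn_θ hj) (kx k))
    (fun t ht k => (S.sθx t ht).abs_ip_le hab (cx t ht) k)
    (fun t ht => (S.sθx t ht).lim _ _ _ (cx t ht))
  have l4 := tendsto_intOmT (F := fun x t => Θ x t * pdt φ x t) hT
    (integrableOn_rect (φ := fun x t => Θ x t * pdt φ x t) (H.cΘ.mul s1))
    (fun k => continuousOn_ip (fun j hj => (H.sol k).continuousOn_θ hj)
      fun j _ => (continuous_time s1 _).continuousOn)
    (fun t ht k => (S.sθ t ht).abs_ip_le hab (c1 t ht) k)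
    (fun t ht => (S.sθ t ht).ip_tendsto hab (c1 t ht))
  have l5 := ((S.sθ 0 h0).of_init hab H.top hΘ0 H.θ_zero).ip_tendsto hab (c0 0 h0)
  obtain ⟨T', hT', hz⟩ := hφ.suppt
  have key := tendsto_nhds_unique (((l1.add l2).sub l3).add l4) (l5.neg.congr fun k =>
    ((H.sol k).weak_heat (φ := fun t j => φ (a + j * mesh a b (N k)) t)
      (φt := fun t j => pdt φ (a + j * mesh a b (N k)) t) hT (HypF.continuous hf).1
      (fun t _ j _ => hasDerivAt_pdt hφ.smooth _ t)
      (fun j _ => (continuous_time s1 _).continuousOn) (fun j _ => hz _ _ hT'.le)).symm)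
  simp only [intOm]
  simp only [← mul_assoc] at key
  linarith

lemma contL2_of_continuous {w : ℝ → ℝ → ℝ} (hw : Continuous (uncurry w)) (a b T : ℝ) :
    ContL2 a b (Icc 0 T) w := by
  obtain ⟨B, hB⟩ := exists_bound_rect hw a b T
  refine ⟨fun t ht => ⟨(continuous_slice hw t).aestronglyMeasurable,
    (((continuous_slice hw t).pow 2).integrableOn_Icc).mono_set Ioo_subset_Icc_self⟩,
    fun t₀ ht₀ => ?_⟩
  have e : ∫ x in Ioo a b, (w x t₀ - w x t₀) ^ 2 = 0 := by simp
  rw [show nhds (0 : ℝ) = nhds _ from congrArg nhds e.symm]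
  refine tendsto_integral_filter_of_dominated_convergence (fun _ => (B + B) ^ 2)
    (Eventually.of_forall fun t => (((continuous_slice hw t).sub
      (continuous_slice hw t₀)).pow 2).aestronglyMeasurable) ?_ (integrable_const _)
    (Eventually.of_forall fun x => ?_)
  · filter_upwards [self_mem_nhdsWithin] with t ht
    refine (ae_restrict_iff' measurableSet_Ioo).2 (Eventually.of_forall fun x hx => ?_)
    rw [norm_pow]
    refine pow_le_pow_left₀ (norm_nonneg _) ((norm_sub_le _ _).trans ?_) 2
    exact add_le_add (hB x (Ioo_subset_Icc_self hx) t ht) (hB x (Ioo_subset_Icc_self hx) t₀ ht₀)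
  · exact (((((continuous_time hw x).sub continuous_const).pow 2).tendsto t₀)).mono_left
      nhdsWithin_le_nhds

lemma contL1_of_continuous {w : ℝ → ℝ → ℝ} (hw : Continuous (uncurry w)) (a b : ℝ) {T t₀ : ℝ}
    (ht₀ : t₀ ∈ Icc 0 T) : Tendsto (fun t => ∫ x in Ioo a b, |w x t - w x t₀|)
      (nhdsWithin t₀ (Icc 0 T)) (nhds 0) := by
  obtain ⟨B, hB⟩ := exists_bound_rect hw a b T
  have e : ∫ x in Ioo a b, |w x t₀ - w x t₀| = 0 := by simp
  rw [show nhds (0 : ℝ) = nhds _ from congrArg nhds e.symm]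
  refine tendsto_integral_filter_of_dominated_convergence (fun _ => B + B)
    (Eventually.of_forall fun t => ((continuous_slice hw t).sub
      (continuous_slice hw t₀)).abs.aestronglyMeasurable) ?_ (integrable_const _)
    (Eventually.of_forall fun x => ?_)
  · filter_upwards [self_mem_nhdsWithin] with t ht
    refine (ae_restrict_iff' measurableSet_Ioo).2 (Eventually.of_forall fun x hx => ?_)
    rw [Real.norm_eq_abs, abs_abs]
    exact (norm_sub_le (w x t) (w x t₀)).trans
      (add_le_add (hB x (Ioo_subset_Icc_self hx) t ht) (hB x (Ioo_subset_Icc_self hx) t₀ ht₀))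
  · exact (((continuous_time hw x).sub continuous_const).abs.tendsto t₀).mono_left
      nhdsWithin_le_nhds

lemma Approx.isWeakSol (hab : a < b) (hf : HypF f f' f'') (D : SmoothData a b v0 u0 Θ0)
    (H : Approx a b f v0 u0 Θ0 N u v θ U V W Θ) (hT : 0 < T) :
    IsWeakSol a b T f f' u0 v0 Θ0 U V W Θ (pdx Θ) where
  u_sliceL1 t _ := ((continuous_slice H.cU t).integrableOn_Icc).mono_set Ioo_subset_Icc_self
  u_contL1 t₀ ht₀ := contL1_of_continuous H.cU a b ht₀
  u_int := integrableOn_rect H.cU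
  ux_int := integrableOn_rect H.cW
  u_W0 := (ae_restrict_iff' measurableSet_Ioo).2
    (Eventually.of_forall fun t ht => H.weakDerivZ hab hf ht.1.le)
  Θ_int := integrableOn_rect H.cΘ
  Θx_int := by simpa using H.integrable_mul hab hf (ψ := fun _ _ => 1) continuous_const
  Θ_W := (ae_restrict_iff' measurableSet_Ioo).2
    (Eventually.of_forall fun t ht => H.weakDerivI hab hf ht.1.le)
  Θ_nonneg := (ae_restrict_iff' (measurableSet_Ioo.prod measurableSet_Ioo)).2
    (Eventually.of_forall fun p hp => H.nonneg hp.2.1.le p.1)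
  ut_weak φ hφ := H.weak_time hab hf hT hφ
  ut_int := integrableOn_rect H.cV
  g1_int := by simpa using H.integrable_slope_mul hab hf (ψ := fun _ _ => 1) continuous_const
  g2_int := H.integrable_slope_mul hab hf H.cV
  g3_int := H.integrable_comp_mul hf H.cV
  weak_u φ hφ := H.weak_wave hab hf D.u0_smooth.continuous D.v0_smooth.continuous hT hφ
  weak_Θ φ hφ := H.weak_heat hab hf D.Θ0_smooth.continuous hT hφ

lemma Approx.regT (hab : a < b) (hf : HypF f f' f'')
    (H : Approx a b f v0 u0 Θ0 N u v θ U V W Θ) : RegT a b T U V W Θ (pdx Θ) where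
  u_cont := contL2_of_continuous H.cU a b T
  ux_cont := contL2_of_continuous H.cW a b T
  u_W0 _ ht := H.weakDerivZ hab hf ht.1
  ut_cont := contL2_of_continuous H.cV a b T
  Θ_cont := contL2_of_continuous H.cΘ a b T
  Θ_sq_int := integrableOn_rect (φ := fun x t => Θ x t ^ 2) (H.cΘ.pow 2)
  Θx_sq_int := H.integrable_sq hab hf

end

end Thermo

/-- Lemma 4.9: existence of a global weak solution in the regularity
class (R) for smooth initial data. -/
theorem statement18
    (a b : ℝ) (hab : a < b)
    (f f' f'' : ℝ → ℝ) (hf : HypF f f' f'')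
    (v0 u0 Θ0 : ℝ → ℝ) (hdata : SmoothData a b v0 u0 Θ0) :
    ∃ u ut ux Θ Θx : ℝ → ℝ → ℝ,
      (∀ T > (0 : ℝ), IsWeakSol a b T f f' u0 v0 Θ0 u ut ux Θ Θx) ∧
      (∀ T > (0 : ℝ), RegT a b T u ut ux Θ Θx) := by
  obtain ⟨N, u, v, θ, U, V, W, Θ, H⟩ := Thermo.exists_approx hab hf hdata
  exact ⟨U, V, W, Θ, pdx Θ, fun T hT => H.isWeakSol hab hf hdata hT,
    fun T _ => H.regT hab hf⟩
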